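/- Let Z ⊆ ℝ^{M+N} be a definable set in an o-minimal structure. For every ε > 0 there exists a positive constant c = c(Z, ε) with the following property: if T ≥ 1 and #π₂(Z~(ℚ,T)) > cT^ε, then there exists a continuous definable function δ : [0,1] → Z such that (1) the composition π₁∘δ : [0,1] → ℝ^M is semi-algebraic and its restriction to (0,1) is real analytic, and (2) the composition π₂∘δ : [0,1] → ℝ^N is non-constant. -/

import Mathlib

/-- Semialgebraic subsets of `ℝ^k`: the smallest collection of sets containing the zero sets and
positivity sets of real polynomials which is stable under finite unions, finite intersections and
complements. -/
inductive IsSemialgebraic : {k : ℕ} → Set (Fin k → ℝ) → Prop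
  | zero_set {k : ℕ} (p : MvPolynomial (Fin k) ℝ) :
      IsSemialgebraic {x | MvPolynomial.eval x p = 0}
  | pos_set {k : ℕ} (p : MvPolynomial (Fin k) ℝ) :
      IsSemialgebraic {x | 0 < MvPolynomial.eval x p}
  | union {k : ℕ} {s t : Set (Fin k → ℝ)} :
      IsSemialgebraic s → IsSemialgebraic t → IsSemialgebraic (s ∪ t)
  | inter {k : ℕ} {s t : Set (Fin k → ℝ)} :
      IsSemialgebraic s → IsSemialgebraic t → IsSemialgebraic (s ∩ t)
  | compl {k : ℕ} {s : Set (Fin k → ℝ)} : IsSemialgebraic s → IsSemialgebraic sᶜ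

/-- A *structure* (expanding the real field): a collection `sets N` of subsets of `ℝ^N` for each
`N`, such that each `sets N` is a boolean algebra containing all semialgebraic sets, and the
collection is stable under cartesian products and coordinate projections. -/
structure RealStructure where
  sets : (k : ℕ) → Set (Set (Fin k → ℝ))
  union_mem : ∀ k, ∀ s ∈ sets k, ∀ t ∈ sets k, s ∪ t ∈ sets k
  compl_mem : ∀ k, ∀ s ∈ sets k, sᶜ ∈ sets k
  semialgebraic_mem : ∀ (k) (s : Set (Fin k → ℝ)), IsSemialgebraic s → s ∈ sets k
  prod_mem : ∀ k l, ∀ s ∈ sets k, ∀ t ∈ sets l,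
    {z : Fin (k + l) → ℝ |
      (fun i => z (Fin.castAdd l i)) ∈ s ∧ (fun j => z (Fin.natAdd k j)) ∈ t} ∈ sets (k + l)
  proj_mem : ∀ k l, ∀ s ∈ sets (k + l),
    {x : Fin k → ℝ | ∃ y : Fin l → ℝ, Fin.append x y ∈ s} ∈ sets k

/-- A structure is *o-minimal* if the definable subsets of `ℝ` are exactly the finite unions of
open intervals (possibly unbounded) and points. -/
def RealStructure.IsOMinimal (S : RealStructure) : Prop :=
  ∀ s ∈ S.sets 1, ∃ (r : ℕ) (a b : Fin r → EReal) (F : Finset ℝ),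
    s = {x : Fin 1 → ℝ | (∃ i, a i < (x 0 : EReal) ∧ (x 0 : EReal) < b i) ∨ x 0 ∈ F}

/-- The `H₁`-height of a rational number `p/q` in lowest terms: `max(|p|, |q|)`. -/
def ratH (q : ℚ) : ℝ := max |(q.num : ℝ)| (q.den : ℝ)


/-- The set `Z∼(ℚ, T)`: points of `Z` whose first `M` coordinates are rational of `H₁`-height
at most `T`. -/
def ZRat (M N : ℕ) (Z : Set (Fin (M + N) → ℝ)) (T : ℝ) : Set (Fin (M + N) → ℝ) :=
  {p ∈ Z | ∀ i : Fin M, ∃ q : ℚ, (q : ℝ) = p (Fin.castAdd N i) ∧ ratH q ≤ T}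

/-- The projection `π₂(Z∼(ℚ, T))` to the last `N` coordinates. -/
def ZRatProj (M N : ℕ) (Z : Set (Fin (M + N) → ℝ)) (T : ℝ) : Set (Fin N → ℝ) :=
  (fun p (j : Fin N) => p (Fin.natAdd M j)) '' ZRat M N Z T

section

open Set Filter Topology

theorem IsSemialgebraic.comap {k l : ℕ} (σ : Fin k → Fin l) {s : Set (Fin k → ℝ)}
    (hs : IsSemialgebraic s) : IsSemialgebraic {v : Fin l → ℝ | (fun i => v (σ i)) ∈ s} := by
  induction hs with
  | zero_set p =>
    have := IsSemialgebraic.zero_set (MvPolynomial.rename σ p)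
    simpa [MvPolynomial.eval_rename, Function.comp_def] using this
  | pos_set p =>
    have := IsSemialgebraic.pos_set (MvPolynomial.rename σ p)
    simpa [MvPolynomial.eval_rename, Function.comp_def] using this
  | union _ _ h1 h2 => exact h1.union h2
  | inter _ _ h1 h2 => exact h1.inter h2
  | compl _ h => exact h.compl

theorem IsSemialgebraic.univ {k : ℕ} : IsSemialgebraic (Set.univ : Set (Fin k → ℝ)) := by
  simpa using IsSemialgebraic.zero_set (0 : MvPolynomial (Fin k) ℝ)

theorem IsSemialgebraic.forall_fin {k n : ℕ} {s : Fin n → Set (Fin k → ℝ)}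
    (h : ∀ i, IsSemialgebraic (s i)) : IsSemialgebraic {v | ∀ i, v ∈ s i} := by
  induction n with
  | zero => simpa using IsSemialgebraic.univ
  | succ n ih =>
    have := (h 0).inter (ih (fun i => h i.succ))
    convert this using 1
    ext v; simp [Fin.forall_fin_succ]

theorem IsSemialgebraic.eq_set {k : ℕ} (p q : MvPolynomial (Fin k) ℝ) :
    IsSemialgebraic {x | MvPolynomial.eval x p = MvPolynomial.eval x q} := by
  simpa [sub_eq_zero] using IsSemialgebraic.zero_set (p - q)

/-- Types whose elements are encoded by points of a semialgebraic subset of some `ℝ^dim`. -/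
class DSpace (E : Type) where
  dim : ℕ
  emb : E → Fin dim → ℝ
  inj : Function.Injective emb
  range_sa : IsSemialgebraic (Set.range emb)

open DSpace

instance : DSpace ℝ where
  dim := 1
  emb x := fun _ => x
  inj x y h := congrFun h 0
  range_sa := by
    convert IsSemialgebraic.univ
    ext v; simp only [mem_range, mem_univ, iff_true]
    exact ⟨v 0, funext fun i => by rw [Subsingleton.elim i 0]⟩

instance : DSpace Unit where
  dim := 0
  emb _ := Fin.elim0
  inj _ _ _ := rfl
  range_sa := by
    convert IsSemialgebraic.univ
    ext v; simp only [mem_range, mem_univ, iff_true]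
    exact ⟨(), Subsingleton.elim _ _⟩

open Classical in
noncomputable instance : DSpace Prop where
  dim := 1
  emb p := fun _ => if p then 1 else 0
  inj p q h := by
    have := congrFun h 0
    by_cases hp : p <;> by_cases hq : q <;> simp_all
  range_sa := by
    convert IsSemialgebraic.zero_set (k := 1)
      (MvPolynomial.X 0 * (MvPolynomial.X 0 - MvPolynomial.C 1)) using 1
    ext v
    simp only [mem_range, map_mul, MvPolynomial.eval_X, map_sub, MvPolynomial.eval_C,
      mul_eq_zero, Set.mem_ofPred_eq]
    constructor
    · rintro ⟨p, rfl⟩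
      by_cases hp : p <;> simp [hp]
    · rintro (h | h)
      · exact ⟨False, funext fun i => by rw [Subsingleton.elim i 0, h]; simp⟩
      · exact ⟨True, funext fun i => by rw [Subsingleton.elim i 0]; simp; linarith⟩

instance (n : ℕ) : DSpace (Fin n → ℝ) where
  dim := n
  emb x := x
  inj _ _ h := h
  range_sa := by convert IsSemialgebraic.univ; ext; simp

instance {E F : Type} [DSpace E] [DSpace F] : DSpace (E × F) where
  dim := dim E + dim F
  emb x := Fin.append (emb x.1) (emb x.2)
  inj x y h := by
    refine Prod.ext (inj (funext fun i => ?_)) (inj (funext fun i => ?_))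
    · simpa using congrFun h (Fin.castAdd _ i)
    · simpa using congrFun h (Fin.natAdd _ i)
  range_sa := by
    convert ((range_sa (E := E)).comap (Fin.castAdd (dim F))).inter
      ((range_sa (E := F)).comap (Fin.natAdd (dim E))) using 1
    ext v
    constructor
    · rintro ⟨x, rfl⟩
      exact ⟨⟨x.1, by simp⟩, ⟨x.2, by simp⟩⟩
    · rintro ⟨⟨x, hx⟩, ⟨y, hy⟩⟩
      refine ⟨(x, y), ?_⟩
      simp only [hx, hy]
      exact Fin.append_castAdd_natAdd

theorem RealStructure.inter_mem (S : RealStructure) {k : ℕ} {s t : Set (Fin k → ℝ)}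
    (hs : s ∈ S.sets k) (ht : t ∈ S.sets k) : s ∩ t ∈ S.sets k := by
  rw [← compl_compl (s ∩ t), compl_inter]
  exact S.compl_mem _ _ (S.union_mem _ _ (S.compl_mem _ _ hs) _ (S.compl_mem _ _ ht))

theorem RealStructure.comap_mem (S : RealStructure) {k l : ℕ} (σ : Fin k → Fin l)
    {s : Set (Fin k → ℝ)} (hs : s ∈ S.sets k) :
    {v : Fin l → ℝ | (fun i => v (σ i)) ∈ s} ∈ S.sets l := by
  have h1 := S.prod_mem l k univ (S.semialgebraic_mem _ _ .univ) s hs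
  have h2 : IsSemialgebraic {v : Fin (l + k) → ℝ |
      ∀ i, v ∈ {v : Fin (l + k) → ℝ | v (Fin.natAdd l i) = v (Fin.castAdd k (σ i))}} :=
    .forall_fin fun i => by
      simpa using IsSemialgebraic.eq_set (MvPolynomial.X (Fin.natAdd l i))
        (MvPolynomial.X (Fin.castAdd k (σ i)))
  have h3 := S.proj_mem _ _ _ (S.inter_mem h1 (S.semialgebraic_mem _ _ h2))
  convert h3 using 1
  ext v
  simp only [Set.mem_ofPred_eq, mem_inter_iff, mem_univ, true_and, Fin.append_right, Fin.append_left]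
  constructor
  · intro h; exact ⟨_, h, fun i => rfl⟩
  · rintro ⟨y, hy, h⟩
    have : y = fun i => v (σ i) := funext h
    rwa [← this]

/-- Definable subsets of a `DSpace`. -/
def DSet (S : RealStructure) {E : Type} [DSpace E] (s : Set E) : Prop :=
  emb '' s ∈ S.sets (dim E)

/-- Definable maps between `DSpace`s. -/
@[fun_prop]
def Df (S : RealStructure) {E F : Type} [DSpace E] [DSpace F] (f : E → F) : Prop :=
  DSet S {p : E × F | p.2 = f p.1}

section
variable {S : RealStructure} {E F G H : Type} [DSpace E] [DSpace F] [DSpace G] [DSpace H]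

theorem DSet.inter {s t : Set E} (hs : DSet S s) (ht : DSet S t) : DSet S (s ∩ t) := by
  unfold DSet; rw [image_inter inj]; exact S.inter_mem hs ht

theorem DSet.union {s t : Set E} (hs : DSet S s) (ht : DSet S t) : DSet S (s ∪ t) := by
  unfold DSet; rw [image_union]; exact S.union_mem _ _ hs _ ht

theorem DSet.compl {s : Set E} (hs : DSet S s) : DSet S sᶜ := by
  have h : emb '' sᶜ = range (emb (E := E)) ∩ (emb '' s)ᶜ := by
    rw [compl_eq_univ_sdiff, image_sdiff inj, image_univ]; rfl
  unfold DSet; rw [h]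
  exact S.inter_mem (S.semialgebraic_mem _ _ range_sa) (S.compl_mem _ _ hs)

/-- Maps that only permute, duplicate or forget coordinates. -/
def Coord (φ : E → F) : Prop :=
  ∃ σ : Fin (dim F) → Fin (dim E), ∀ x i, emb (φ x) i = emb x (σ i)

theorem Coord.id : Coord (fun x : E => x) := ⟨fun i => i, fun _ _ => rfl⟩

theorem Coord.fst {φ : E → F × G} (h : Coord φ) : Coord (fun x => (φ x).1) := by
  obtain ⟨σ, h⟩ := h
  refine ⟨fun i => σ (Fin.castAdd _ i), fun x i => ?_⟩
  rw [← h]; exact (Fin.append_left (emb (φ x).1) (emb (φ x).2) i).symm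

theorem Coord.snd {φ : E → F × G} (h : Coord φ) : Coord (fun x => (φ x).2) := by
  obtain ⟨σ, h⟩ := h
  refine ⟨fun i => σ (Fin.natAdd _ i), fun x i => ?_⟩
  rw [← h]; exact (Fin.append_right (emb (φ x).1) (emb (φ x).2) i).symm

theorem Coord.prodMk {φ : E → F} {ψ : E → G} (h : Coord φ) (h' : Coord ψ) :
    Coord (fun x => (φ x, ψ x)) := by
  obtain ⟨σ, h⟩ := h
  obtain ⟨τ, h'⟩ := h'
  refine ⟨Fin.addCases σ τ, fun x i => ?_⟩
  refine Fin.addCases (fun j => ?_) (fun j => ?_) i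
  · dsimp only
    rw [Fin.addCases_left, ← h]; exact Fin.append_left _ _ _
  · dsimp only
    rw [Fin.addCases_right, ← h']; exact Fin.append_right _ _ _

theorem Coord.apply {n : ℕ} {φ : E → Fin n → ℝ} (h : Coord φ) (i : Fin n) :
    Coord (fun x => φ x i) := by
  obtain ⟨σ, h⟩ := h
  exact ⟨fun _ => σ i, fun x _ => h x i⟩

theorem DSet.comap {φ : E → F} (h : Coord φ) {s : Set F} (hs : DSet S s) :
    DSet S {x | φ x ∈ s} := by
  obtain ⟨σ, h⟩ := h
  have : emb '' {x | φ x ∈ s} = range (emb (E := E)) ∩ {v | (fun i => v (σ i)) ∈ emb '' s} := by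
    ext v
    constructor
    · rintro ⟨x, hx, rfl⟩
      exact ⟨⟨x, rfl⟩, φ x, hx, funext (h x)⟩
    · rintro ⟨⟨x, rfl⟩, y, hy, h'⟩
      have : y = φ x := inj (by rw [h']; exact (funext (h x)).symm)
      exact ⟨x, by rw [Set.mem_ofPred_eq, ← this]; exact hy, rfl⟩
  unfold DSet; rw [this]
  exact S.inter_mem (S.semialgebraic_mem _ _ range_sa) (S.comap_mem σ hs)

theorem DSet.proj {s : Set (E × F)} (hs : DSet S s) : DSet S {x | ∃ y, (x, y) ∈ s} := by
  have := S.proj_mem (dim E) (dim F) _ hs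
  unfold DSet
  convert this using 1
  ext v
  constructor
  · rintro ⟨x, ⟨y, h⟩, rfl⟩
    exact ⟨emb y, (x, y), h, rfl⟩
  · rintro ⟨y, ⟨⟨a, b⟩, h, h'⟩⟩
    refine ⟨a, ⟨b, h⟩, funext fun i => ?_⟩
    have := congrFun h' (Fin.castAdd _ i)
    rw [Fin.append_left] at this
    rw [← this]; exact (Fin.append_left (emb a) (emb b) i).symm

theorem Coord.df {φ : E → F} (h : Coord φ) : Df S φ := by
  obtain ⟨σ, h⟩ := h
  refine S.semialgebraic_mem _ _ ?_
  have h2 : IsSemialgebraic {v : Fin (dim E + dim F) → ℝ |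
      ∀ i, v ∈ {v : Fin (dim E + dim F) → ℝ | v (Fin.natAdd _ i) = v (Fin.castAdd _ (σ i))}} :=
    .forall_fin fun i => by
      simpa using IsSemialgebraic.eq_set (MvPolynomial.X (Fin.natAdd (dim E) i))
        (MvPolynomial.X (Fin.castAdd (dim F) (σ i)))
  convert (range_sa (E := E × F)).inter h2 using 1
  ext v
  constructor
  · rintro ⟨⟨x, y⟩, hy, rfl⟩
    obtain rfl : y = φ x := hy
    refine ⟨⟨_, rfl⟩, fun i => ?_⟩
    change Fin.append (emb x) (emb (φ x)) _ = Fin.append (emb x) (emb (φ x)) _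
    rw [Fin.append_left, Fin.append_right, h]
  · rintro ⟨⟨⟨x, y⟩, rfl⟩, h'⟩
    refine ⟨_, ?_, rfl⟩
    refine inj (funext fun i => ?_)
    have := h' i
    change Fin.append (emb x) (emb y) _ = Fin.append (emb x) (emb y) _ at this
    rw [Fin.append_left, Fin.append_right] at this
    rw [h]; exact this

@[fun_prop]
theorem Df.id : Df S (fun x : E => x) := Coord.id.df

theorem Df.fst' : Df S (fun x : E × F => x.1) := Coord.id.fst.df

theorem Df.snd' : Df S (fun x : E × F => x.2) := Coord.id.snd.df

@[fun_prop]
theorem Df.const (c : F) : Df S (fun _ : E => c) := by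
  refine S.semialgebraic_mem _ _ ?_
  have h2 : IsSemialgebraic {v : Fin (dim E + dim F) → ℝ |
      ∀ i, v ∈ {v : Fin (dim E + dim F) → ℝ | v (Fin.natAdd _ i) = emb c i}} :=
    .forall_fin fun i => by
      simpa using IsSemialgebraic.eq_set (MvPolynomial.X (Fin.natAdd (dim E) i))
        (MvPolynomial.C (emb c i))
  convert (range_sa (E := E × F)).inter h2 using 1
  ext v
  constructor
  · rintro ⟨⟨x, y⟩, hy, rfl⟩
    obtain rfl : y = c := hy
    refine ⟨⟨_, rfl⟩, fun i => ?_⟩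
    exact Fin.append_right _ _ _
  · rintro ⟨⟨⟨x, y⟩, rfl⟩, h'⟩
    refine ⟨_, ?_, rfl⟩
    refine inj (funext fun i => ?_)
    have := h' i
    change Fin.append (emb x) (emb y) _ = _ at this
    rwa [Fin.append_right] at this

@[fun_prop]
theorem Df.comp {g : F → G} {f : E → F} (hg : Df S g) (hf : Df S f) :
    Df S (fun x => g (f x)) := by
  have h1 : DSet S {q : (E × G) × F | (q.1.1, q.2) ∈ {p : E × F | p.2 = f p.1}} :=
    DSet.comap (Coord.id.fst.fst.prodMk Coord.id.snd) hf
  have h2 : DSet S {q : (E × G) × F | (q.2, q.1.2) ∈ {p : F × G | p.2 = g p.1}} :=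
    DSet.comap (Coord.id.snd.prodMk Coord.id.fst.snd) hg
  have := (h1.inter h2).proj
  unfold Df
  convert this using 1
  ext ⟨x, z⟩
  simp

@[fun_prop]
theorem Df.fst {f : E → F × G} (hf : Df S f) : Df S (fun x => (f x).1) := Df.fst'.comp hf

@[fun_prop]
theorem Df.snd {f : E → F × G} (hf : Df S f) : Df S (fun x => (f x).2) := Df.snd'.comp hf

@[fun_prop]
theorem Df.prodMk {f : E → F} {g : E → G} (hf : Df S f) (hg : Df S g) :
    Df S (fun x => (f x, g x)) := by
  have h1 : DSet S {q : E × (F × G) | (q.1, q.2.1) ∈ {p : E × F | p.2 = f p.1}} :=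
    DSet.comap (Coord.id.fst.prodMk Coord.id.snd.fst) hf
  have h2 : DSet S {q : E × (F × G) | (q.1, q.2.2) ∈ {p : E × G | p.2 = g p.1}} :=
    DSet.comap (Coord.id.fst.prodMk Coord.id.snd.snd) hg
  unfold Df
  convert h1.inter h2 using 1
  ext ⟨x, y, z⟩
  simp

theorem DSet.singleton (c : E) : DSet S {c} := by
  have h : DSet S {p : Unit × E | p.2 = c} := Df.const (E := Unit) c
  have : DSet S {q : E × Unit | (q.2, q.1) ∈ {p : Unit × E | p.2 = c}} :=
    DSet.comap (Coord.id.snd.prodMk Coord.id.fst) h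
  convert this.proj using 1
  ext x; simp

theorem df_prop {P : E → Prop} : Df S P ↔ DSet S {x | P x} := by
  constructor
  · intro h
    have h2 : DSet S {q : E × Prop | q.2 ∈ ({True} : Set Prop)} :=
      DSet.comap Coord.id.snd (.singleton True)
    convert (DSet.inter h h2).proj using 1
    ext x
    simp only [Set.mem_ofPred_eq, mem_inter_iff, mem_singleton_iff]
    exact ⟨fun h => ⟨True, by simp [h], rfl⟩, by rintro ⟨y, h1, h2⟩; rw [← h1, h2]; trivial⟩
  · intro h
    have h2 : ∀ p, DSet S {q : E × Prop | q.2 ∈ ({p} : Set Prop)} :=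
      fun p => DSet.comap Coord.id.snd (.singleton p)
    have h1 : DSet S {q : E × Prop | q.1 ∈ {x | P x}} := DSet.comap Coord.id.fst h
    unfold Df
    convert (h1.inter (h2 True)).union (h1.compl.inter (h2 False)) using 1
    ext ⟨x, p⟩
    by_cases hp : P x <;> by_cases hq : p <;> simp [hp, hq]

@[fun_prop]
theorem Df.and {P Q : E → Prop} (hP : Df S P) (hQ : Df S Q) : Df S (fun x => P x ∧ Q x) :=
  df_prop.2 ((df_prop.1 hP).inter (df_prop.1 hQ))

@[fun_prop]
theorem Df.or {P Q : E → Prop} (hP : Df S P) (hQ : Df S Q) : Df S (fun x => P x ∨ Q x) :=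
  df_prop.2 ((df_prop.1 hP).union (df_prop.1 hQ))

@[fun_prop]
theorem Df.not {P : E → Prop} (hP : Df S P) : Df S (fun x => ¬ P x) :=
  df_prop.2 (df_prop.1 hP).compl

@[fun_prop]
theorem Df.imp {P Q : E → Prop} (hP : Df S P) (hQ : Df S Q) : Df S (fun x => P x → Q x) := by
  simp only [imp_iff_not_or]; fun_prop

@[fun_prop]
theorem Df.iff {P Q : E → Prop} (hP : Df S P) (hQ : Df S Q) : Df S (fun x => P x ↔ Q x) := by
  simp only [iff_iff_and_or_not_and_not]; fun_prop

@[fun_prop]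
theorem Df.exists {Q : E → F → Prop} (hQ : Df S (fun p : E × F => Q p.1 p.2)) :
    Df S (fun x => ∃ y, Q x y) :=
  df_prop.2 (df_prop.1 hQ).proj

@[fun_prop]
theorem Df.forall {Q : E → F → Prop} (hQ : Df S (fun p : E × F => Q p.1 p.2)) :
    Df S (fun x => ∀ y, Q x y) := by
  have : Df S (fun x => ¬ ∃ y, ¬ Q x y) := by fun_prop
  simpa using this

@[fun_prop]
theorem Df.eq {f g : E → F} (hf : Df S f) (hg : Df S g) : Df S (fun x => f x = g x) := by
  refine df_prop.2 ?_
  convert (DSet.inter hf hg).proj using 1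
  ext x; simp

@[fun_prop]
theorem Df.ne {f g : E → F} (hf : Df S f) (hg : Df S g) : Df S (fun x => f x ≠ g x) :=
  (hf.eq hg).not

@[fun_prop]
theorem Df.forall_fintype {ι : Type*} [Finite ι] {P : ι → E → Prop} (h : ∀ i, Df S (P i)) :
    Df S (fun x => ∀ i, P i x) := by
  have := Fintype.ofFinite ι
  have key : ∀ s : Finset ι, Df S (fun x => ∀ i ∈ s, P i x) := by
    classical
    intro s
    induction s using Finset.induction_on with
    | empty => simpa using Df.const True
    | insert a s _ ih => simp only [Finset.forall_mem_insert]; have := h a; fun_prop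
  simpa using key Finset.univ

@[fun_prop]
theorem Df.exists_fintype {ι : Type*} [Finite ι] {P : ι → E → Prop} (h : ∀ i, Df S (P i)) :
    Df S (fun x => ∃ i, P i x) := by
  have : Df S (fun x => ¬ ∀ i, ¬ P i x) := Df.not (.forall_fintype fun i => (h i).not)
  simpa using this

@[fun_prop]
theorem Df.pi {n : ℕ} {f : E → Fin n → ℝ} (h : ∀ i, Df S (fun x => f x i)) :
    Df S (fun x i => f x i) := by
  refine df_prop.1 ?_
  simp only [funext_iff]
  refine .forall_fintype fun i => ?_
  have h1 := h i
  have h2 : Df S (fun p : E × (Fin n → ℝ) => p.2 i) := (Coord.id.snd.apply i).df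
  fun_prop

@[fun_prop]
theorem Df.apply {n : ℕ} (i : Fin n) : Df S (fun f : Fin n → ℝ => f i) :=
  (Coord.id.apply i).df

theorem df_polyOp {f : ℝ × ℝ → ℝ} (p : MvPolynomial (Fin 3) ℝ)
    (h : ∀ x y z : ℝ, MvPolynomial.eval ![x, y, z] p = 0 ↔ z = f (x, y)) : Df S f := by
  refine S.semialgebraic_mem _ _ ?_
  change IsSemialgebraic (k := 3) _
  convert IsSemialgebraic.zero_set p using 1
  ext v
  have hv : v = ![v 0, v 1, v 2] := by
    funext i; fin_cases i <;> rfl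
  constructor
  · rintro ⟨⟨⟨x, y⟩, z⟩, h', rfl⟩
    have h2 : emb ((x, y), z) = ![x, y, z] := by funext i; fin_cases i <;> rfl
    change MvPolynomial.eval (emb ((x, y), z)) p = 0
    rw [h2]
    exact (h x y z).2 h'
  · intro h'
    refine ⟨((v 0, v 1), v 2), (h _ _ _).1 ?_, ?_⟩
    · rw [← hv]; exact h'
    · funext i; fin_cases i <;> rfl

@[fun_prop]
theorem Df.add {f g : E → ℝ} (hf : Df S f) (hg : Df S g) : Df S (fun x => f x + g x) := by
  have : Df S (fun p : ℝ × ℝ => p.1 + p.2) :=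
    df_polyOp (MvPolynomial.X 2 - (MvPolynomial.X 0 + MvPolynomial.X 1))
      (fun x y z => by simp [sub_eq_zero])
  exact this.comp (hf.prodMk hg)

@[fun_prop]
theorem Df.sub {f g : E → ℝ} (hf : Df S f) (hg : Df S g) : Df S (fun x => f x - g x) := by
  have : Df S (fun p : ℝ × ℝ => p.1 - p.2) :=
    df_polyOp (MvPolynomial.X 2 - (MvPolynomial.X 0 - MvPolynomial.X 1))
      (fun x y z => by simp [sub_eq_zero])
  exact this.comp (hf.prodMk hg)

@[fun_prop]
theorem Df.mul {f g : E → ℝ} (hf : Df S f) (hg : Df S g) : Df S (fun x => f x * g x) := by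
  have : Df S (fun p : ℝ × ℝ => p.1 * p.2) :=
    df_polyOp (MvPolynomial.X 2 - (MvPolynomial.X 0 * MvPolynomial.X 1))
      (fun x y z => by simp [sub_eq_zero])
  exact this.comp (hf.prodMk hg)

@[fun_prop]
theorem Df.neg {f : E → ℝ} (hf : Df S f) : Df S (fun x => - f x) := by
  simp only [← zero_sub]; fun_prop

@[fun_prop]
theorem Df.pow {f : E → ℝ} (hf : Df S f) (n : ℕ) : Df S (fun x => f x ^ n) := by
  induction n with
  | zero => simpa using Df.const (1 : ℝ)
  | succ n ih => simp only [pow_succ]; fun_prop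

@[fun_prop]
theorem Df.lt {f g : E → ℝ} (hf : Df S f) (hg : Df S g) : Df S (fun x => f x < g x) := by
  have : Df S (fun p : ℝ × ℝ => p.1 < p.2) := by
    refine df_prop.2 (S.semialgebraic_mem _ _ ?_)
    change IsSemialgebraic (k := 2) _
    convert IsSemialgebraic.pos_set (k := 2) (MvPolynomial.X 1 - MvPolynomial.X 0) using 1
    ext v
    constructor
    · rintro ⟨⟨x, y⟩, h', rfl⟩
      have h2 : emb (x, y) = ![x, y] := by funext i; fin_cases i <;> rfl
      change 0 < MvPolynomial.eval (emb (x, y)) (MvPolynomial.X 1 - MvPolynomial.X 0)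
      rw [h2]
      have h3 : x < y := h'
      simpa using h3
    · intro h'
      have h3 : 0 < MvPolynomial.eval v (MvPolynomial.X 1 - MvPolynomial.X 0) := h'
      refine ⟨(v 0, v 1), ?_, ?_⟩
      · show v 0 < v 1
        simpa using h3
      funext i; fin_cases i <;> rfl
  exact this.comp (hf.prodMk hg)

@[fun_prop]
theorem Df.le {f g : E → ℝ} (hf : Df S f) (hg : Df S g) : Df S (fun x => f x ≤ g x) := by
  simp only [← not_lt]; fun_prop

@[fun_prop]
theorem Df.ite {P : E → Prop} [DecidablePred P] {f g : E → F} (hP : Df S P) (hf : Df S f) (hg : Df S g) :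
    Df S (fun x => if P x then f x else g x) := by
  have : Df S (fun p : E × F => (P p.1 ∧ p.2 = f p.1) ∨ (¬ P p.1 ∧ p.2 = g p.1)) := by fun_prop
  have := df_prop.1 this
  unfold Df
  convert this using 1
  ext ⟨x, y⟩
  by_cases h : P x <;> simp [h]

/-- A function characterised by a definable relation is definable. -/
theorem Df.of_graph {f : E → F} {R : E × F → Prop} (hR : Df S R)
    (h : ∀ x y, R (x, y) ↔ y = f x) : Df S f := by
  have := df_prop.1 hR
  unfold Df
  convert this using 1
  ext ⟨x, y⟩
  exact (h x y).symm

@[fun_prop]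
theorem Df.inv {f : E → ℝ} (hf : Df S f) : Df S (fun x => (f x)⁻¹) := by
  refine .of_graph (R := fun p : E × ℝ => (f p.1 = 0 ∧ p.2 = 0) ∨ f p.1 * p.2 = 1)
    (by fun_prop) fun x y => ?_
  by_cases h : f x = 0
  · simp [h]
  · simp only [h, false_and, false_or]
    constructor
    · intro h'; exact eq_inv_of_mul_eq_one_right h'
    · rintro rfl; exact mul_inv_cancel₀ h

@[fun_prop]
theorem Df.div {f g : E → ℝ} (hf : Df S f) (hg : Df S g) : Df S (fun x => f x / g x) := by
  simp only [div_eq_mul_inv]; fun_prop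

@[fun_prop]
theorem Df.max {f g : E → ℝ} (hf : Df S f) (hg : Df S g) : Df S (fun x => max (f x) (g x)) := by
  simp only [max_def]
  exact .ite (by fun_prop) hg hf

@[fun_prop]
theorem Df.abs {f : E → ℝ} (hf : Df S f) : Df S (fun x => |f x|) := by
  simp only [abs_eq_max_neg]; exact hf.max hf.neg

@[fun_prop]
theorem Df.finset_sum {ι : Type*} (s : Finset ι) {f : ι → E → ℝ} (h : ∀ i ∈ s, Df S (f i)) :
    Df S (fun x => ∑ i ∈ s, f i x) := by
  classical
  induction s using Finset.induction_on with
  | empty => simpa using Df.const (0 : ℝ)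
  | insert a s ha ih =>
    simp only [Finset.sum_insert ha]
    exact (h a (by simp)).add (ih fun i hi => h i (by simp [hi]))

@[fun_prop]
theorem Df.finset_prod {ι : Type*} (s : Finset ι) {f : ι → E → ℝ} (h : ∀ i ∈ s, Df S (f i)) :
    Df S (fun x => ∏ i ∈ s, f i x) := by
  classical
  induction s using Finset.induction_on with
  | empty => simpa using Df.const (1 : ℝ)
  | insert a s ha ih =>
    simp only [Finset.prod_insert ha]
    exact (h a (by simp)).mul (ih fun i hi => h i (by simp [hi]))

end

end

section

open Set Filter Topology DSpace

section
variable {S : RealStructure}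

theorem omin_form (hS : S.IsOMinimal) {P : ℝ → Prop} (hP : Df S P) :
    ∃ (r : ℕ) (a b : Fin r → EReal) (F : Finset ℝ),
      ∀ x : ℝ, P x ↔ (∃ i, a i < (x : EReal) ∧ (x : EReal) < b i) ∨ x ∈ F := by
  obtain ⟨r, a, b, F, h⟩ := hS _ (df_prop.1 hP)
  refine ⟨r, a, b, F, fun x => ?_⟩
  have h1 : emb x ∈ emb '' {x | P x} ↔ P x := inj.mem_set_image
  rw [← h1, h]
  rfl

theorem finite_of_no_interval (hS : S.IsOMinimal) {P : ℝ → Prop} (hP : Df S P)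
    (h : ∀ a b, a < b → ∃ x ∈ Ioo a b, ¬ P x) : {x | P x}.Finite := by
  obtain ⟨r, a, b, F, hF⟩ := omin_form hS hP
  refine F.finite_toSet.subset fun x hx => ?_
  rcases (hF x).1 hx with ⟨i, h1, h2⟩ | h'
  · exfalso
    obtain ⟨y, hy1, hy2⟩ := EReal.lt_iff_exists_real_btwn.1 h1
    rw [EReal.coe_lt_coe_iff] at hy2
    obtain ⟨z, hz, hz'⟩ := h y x hy2
    refine hz' ((hF z).2 (Or.inl ⟨i, hy1.trans (by exact_mod_cast hz.1), ?_⟩))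
    exact lt_trans (by exact_mod_cast hz.2) h2
  · exact h'

theorem germ_right (hS : S.IsOMinimal) {P : ℝ → Prop} (hP : Df S P) (a : ℝ) :
    ∃ c : Prop, ∀ᶠ x in 𝓝[>] a, (P x ↔ c) := by
  obtain ⟨r, u, v, F, hF⟩ := omin_form hS hP
  have h1 : ∀ e : EReal, ∃ c : Prop, ∀ᶠ x : ℝ in 𝓝[>] a, (e < (x : EReal) ↔ c) := by
    intro e
    rcases le_or_gt e a with h | h
    · refine ⟨True, ?_⟩
      filter_upwards [self_mem_nhdsWithin] with x hx
      simpa using h.trans_lt (by exact_mod_cast hx)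
    · refine ⟨False, ?_⟩
      obtain ⟨y, hy1, hy2⟩ := EReal.lt_iff_exists_real_btwn.1 h
      rw [EReal.coe_lt_coe_iff] at hy1
      filter_upwards [Ioo_mem_nhdsGT hy1] with x hx
      simpa using le_trans (by exact_mod_cast hx.2.le) hy2.le
  have h2 : ∀ e : EReal, ∃ c : Prop, ∀ᶠ x : ℝ in 𝓝[>] a, ((x : EReal) < e ↔ c) := by
    intro e
    rcases le_or_gt e a with h | h
    · refine ⟨False, ?_⟩
      filter_upwards [self_mem_nhdsWithin] with x hx
      simpa using (h.trans_lt (by exact_mod_cast hx)).le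
    · refine ⟨True, ?_⟩
      obtain ⟨y, hy1, hy2⟩ := EReal.lt_iff_exists_real_btwn.1 h
      rw [EReal.coe_lt_coe_iff] at hy1
      filter_upwards [Ioo_mem_nhdsGT hy1] with x hx
      simpa using lt_trans (by exact_mod_cast hx.2) hy2
  have h3 : ∀ᶠ x in 𝓝[>] a, x ∉ F := by
    have : ((F : Set ℝ) \ {a})ᶜ ∈ 𝓝 a :=
      (F.finite_toSet.subset sdiff_subset).isClosed.isOpen_compl.mem_nhds (by simp)
    filter_upwards [mem_nhdsWithin_of_mem_nhds this, self_mem_nhdsWithin] with x hx hx'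
    intro h
    exact hx ⟨h, (ne_of_gt hx' : x ≠ a)⟩
  choose c hc using h1
  choose d hd using h2
  refine ⟨∃ i, c (u i) ∧ d (v i), ?_⟩
  filter_upwards [h3, eventually_all.2 fun i => hc (u i), eventually_all.2 fun i => hd (v i)]
    with x hx h1 h2
  rw [hF]
  simp [hx, h1, h2]

/-- An interval covered by countably many definable sets: one of them contains an interval. -/
theorem exists_interval_of_cover (hS : S.IsOMinimal) {ι : Type*} [Countable ι]
    {P : ι → ℝ → Prop} (hP : ∀ i, Df S (P i)) {a b : ℝ} (hab : a < b)
    (h : ∀ x ∈ Ioo a b, ∃ i, P i x) :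
    ∃ i a' b', a ≤ a' ∧ a' < b' ∧ b' ≤ b ∧ ∀ x ∈ Ioo a' b', P i x := by
  by_contra! hcon
  have hfin : ∀ i, {x | P i x ∧ a < x ∧ x < b}.Finite := by
    intro i
    have := hP i
    refine finite_of_no_interval hS (by fun_prop) fun c d hcd => ?_
    by_contra! hc
    have hm : (c + d) / 2 ∈ Ioo c d := ⟨by linarith, by linarith⟩
    obtain ⟨x, hx, hx'⟩ := hcon i (max a c) (min b d) (le_max_left _ _)
      (by have := (hc _ hm).2; have := hm.1; have := hm.2; grind) (min_le_left _ _)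
    exact hx' (hc x ⟨(le_max_right _ _).trans_lt hx.1, hx.2.trans_le (min_le_right _ _)⟩).1
  have h1 : Ioo a b ⊆ ⋃ i, {x | P i x ∧ a < x ∧ x < b} := fun x hx => by
    obtain ⟨i, hi⟩ := h x hx
    exact mem_iUnion.2 ⟨i, hi, hx.1, hx.2⟩
  have h2 := (countable_iUnion fun i => (hfin i).countable).mono h1
  exact (Cardinal.Real.Ioo_countable_iff.1 h2).not_gt hab

theorem exists_monotone (hS : S.IsOMinimal) {f : ℝ → ℝ} (hf : Df S f) {a b : ℝ} (hab : a < b) :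
    ∃ a' b', a ≤ a' ∧ a' < b' ∧ b' ≤ b ∧
      (MonotoneOn f (Ioo a' b') ∨ AntitoneOn f (Ioo a' b')) := by
  have key : ∀ x ∈ Ioo a b, ∃ i : ℚ × Bool,
      x < i.1 ∧ ∀ y, x < y → y < i.1 → (f x ≤ f y ↔ i.2 = true) := by
    intro x _
    obtain ⟨c, hc⟩ := germ_right hS (P := fun y => f x ≤ f y) (by fun_prop) x
    obtain ⟨u, hu, hu'⟩ := mem_nhdsGT_iff_exists_Ioo_subset.1 hc
    obtain ⟨q, hq1, hq2⟩ := exists_rat_btwn (show x < u from hu)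
    by_cases hc' : c
    · exact ⟨(q, true), hq1, fun y h1 h2 => by simpa [hc'] using hu' ⟨h1, h2.trans hq2⟩⟩
    · exact ⟨(q, false), hq1, fun y h1 h2 => by simpa [hc'] using hu' ⟨h1, h2.trans hq2⟩⟩
  obtain ⟨⟨q, c⟩, a', b', h1, h2, h3, h4⟩ :=
    exists_interval_of_cover hS (fun i => by fun_prop) hab key
  refine ⟨a', b', h1, h2, h3, ?_⟩
  cases c
  · right
    intro x hx y hy hxy
    rcases hxy.eq_or_lt with rfl | hxy
    · rfl
    · have := (h4 x hx).2 y hxy (h4 y hy).1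
      simp at this; exact this.le
  · left
    intro x hx y hy hxy
    rcases hxy.eq_or_lt with rfl | hxy
    · rfl
    · have := (h4 x hx).2 y hxy (h4 y hy).1
      simpa using this

variable {E : Type} [DSpace E]

@[fun_prop]
theorem Df.hasDerivAt {f : E × ℝ → ℝ} (hf : Df S f) {u v : E → ℝ} (hu : Df S u) (hv : Df S v) :
    Df S (fun p => HasDerivAt (fun x => f (p, x)) (u p) (v p)) := by
  have key : ∀ p, HasDerivAt (fun x => f (p, x)) (u p) (v p) ↔
      ∀ ε : ℝ, 0 < ε → ∃ δ : ℝ, 0 < δ ∧ ∀ y, |y - v p| < δ →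
        |f (p, y) - f (p, v p) - (y - v p) * u p| ≤ ε * |y - v p| := by
    intro p
    rw [hasDerivAt_iff_isLittleO, Asymptotics.isLittleO_iff]
    simp only [Metric.eventually_nhds_iff, Real.dist_eq, Real.norm_eq_abs, smul_eq_mul]
  simp only [key]
  fun_prop

theorem Df.differentiableAt {f : E × ℝ → ℝ} (hf : Df S f) :
    Df S (fun p : E × ℝ => DifferentiableAt ℝ (fun x => f (p.1, x)) p.2) := by
  have key : ∀ p : E × ℝ, DifferentiableAt ℝ (fun x => f (p.1, x)) p.2 ↔
      ∃ L, HasDerivAt (fun x => f (p.1, x)) L p.2 := fun p =>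
    ⟨fun h => ⟨_, h.hasDerivAt⟩, fun ⟨L, h⟩ => h.differentiableAt⟩
  simp only [key]
  refine Df.exists ?_
  exact Df.hasDerivAt (f := fun q : ((E × ℝ) × ℝ) × ℝ => f (q.1.1.1, q.2))
    (u := fun q => q.2) (v := fun q => q.1.2) (by fun_prop) (by fun_prop) (by fun_prop)

theorem Df.deriv {f : E × ℝ → ℝ} (hf : Df S f) :
    Df S (fun p : E × ℝ => deriv (fun x => f (p.1, x)) p.2) := by
  have h1 := hf.differentiableAt
  refine .of_graph (R := fun q : (E × ℝ) × ℝ =>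
    HasDerivAt (fun x => f (q.1.1, x)) q.2 q.1.2 ∨
      (¬ DifferentiableAt ℝ (fun x => f (q.1.1, x)) q.1.2 ∧ q.2 = 0)) ?_ ?_
  · refine Df.or ?_ ?_
    · exact Df.hasDerivAt (f := fun q : ((E × ℝ) × ℝ) × ℝ => f (q.1.1.1, q.2))
        (u := fun q => q.2) (v := fun q => q.1.2) (by fun_prop) (by fun_prop) (by fun_prop)
    · have : Df S (fun q : (E × ℝ) × ℝ => DifferentiableAt ℝ (fun x => f (q.1.1, x)) q.1.2) :=
        h1.comp (g := fun p : E × ℝ => DifferentiableAt ℝ (fun x => f (p.1, x)) p.2)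
          (f := fun q : (E × ℝ) × ℝ => q.1) (by fun_prop)
      fun_prop
  · rintro ⟨e, x⟩ y
    dsimp only
    by_cases h : DifferentiableAt ℝ (fun x => f (e, x)) x
    · simp only [h, not_true, false_and, or_false]
      exact ⟨fun h' => h'.deriv.symm, fun h' => h' ▸ h.hasDerivAt⟩
    · simp only [h, not_false_eq_true, true_and, deriv_zero_of_not_differentiableAt h,
        or_iff_right_iff_imp]
      exact fun h' => absurd h'.differentiableAt h

theorem finite_not_differentiableAt (hS : S.IsOMinimal) {f : ℝ → ℝ} (hf : Df S f) :
    {x | ¬ DifferentiableAt ℝ f x}.Finite := by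
  have h1 : Df S (fun p : Unit × ℝ => f p.2) := by fun_prop
  have h2 : Df S (fun x : ℝ => DifferentiableAt ℝ f x) :=
    h1.differentiableAt.comp (f := fun x : ℝ => ((), x)) (by fun_prop)
  refine finite_of_no_interval hS h2.not fun a b hab => ?_
  simp only [not_not]
  obtain ⟨a', b', h1, h2, h3, h4⟩ := exists_monotone hS hf hab
  have h5 : ∀ᵐ x, x ∈ Ioo a' b' → DifferentiableWithinAt ℝ f (Ioo a' b') x := by
    rcases h4 with h4 | h4
    · exact h4.ae_differentiableWithinAt_of_mem
    · have := h4.neg.ae_differentiableWithinAt_of_mem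
      filter_upwards [this] with x hx hx'
      simpa using (hx hx').neg
  have h6 : (MeasureTheory.volume (Ioo a' b')) ≠ 0 := by simp [h2]
  by_contra! hcon
  refine h6 (MeasureTheory.measure_mono_null (fun x hx => ?_) h5)
  intro h
  exact hcon x ⟨h1.trans_lt hx.1, hx.2.trans_le h3⟩
    ((h hx).differentiableAt (Ioo_mem_nhds hx.1 hx.2))

end

end

section

open Set Filter Topology DSpace

section
variable {S : RealStructure} {E F : Type} [DSpace E] [DSpace F]

/-- Boundary points of a subset of the line. -/
def Bdry (P : ℝ → Prop) (x : ℝ) : Prop :=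
  ∀ ε : ℝ, 0 < ε → (∃ y, |y - x| < ε ∧ P y) ∧ ∃ y, |y - x| < ε ∧ ¬ P y

theorem Df.bdry {P : E × ℝ → Prop} (hP : Df S P) :
    Df S (fun p : E × ℝ => Bdry (fun y => P (p.1, y)) p.2) := by
  unfold Bdry; fun_prop

theorem bdry_iff (P : ℝ → Prop) (x : ℝ) : Bdry P x ↔ x ∈ frontier {x | P x} := by
  rw [frontier_eq_closure_inter_closure, mem_inter_iff, Metric.mem_closure_iff,
    Metric.mem_closure_iff]
  simp only [Bdry, Real.dist_eq, abs_sub_comm x]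
  constructor
  · intro h
    refine ⟨fun ε hε => ?_, fun ε hε => ?_⟩
    · obtain ⟨y, h1, h2⟩ := (h ε hε).1; exact ⟨y, h2, h1⟩
    · obtain ⟨y, h1, h2⟩ := (h ε hε).2; exact ⟨y, h2, h1⟩
  · intro h ε hε
    obtain ⟨y, h1, h2⟩ := h.1 ε hε
    obtain ⟨z, h3, h4⟩ := h.2 ε hε
    exact ⟨⟨y, h2, h1⟩, ⟨z, h4, h3⟩⟩

/-- A predicate without boundary points on a connected set is constant there. -/
theorem iff_of_no_bdry {P : ℝ → Prop} {I : Set ℝ} (hI : IsPreconnected I)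
    (h : ∀ x ∈ I, ¬ Bdry P x) {x y : ℝ} (hx : x ∈ I) (hy : y ∈ I) : P x ↔ P y := by
  have key : ∀ x ∈ I, ∀ y ∈ I, P x → P y := by
    intro x hx y hy hP
    by_contra hn
    have h1 : ∀ z ∈ I, z ∈ interior {x | P x} ∨ z ∈ interior {x | P x}ᶜ := by
      intro z hz
      by_contra! hc
      rw [interior_compl, Set.mem_compl_iff, not_not] at hc
      exact h z hz ((bdry_iff _ _).2 ⟨hc.2, hc.1⟩)
    obtain ⟨z, _, hz, hz'⟩ := hI _ _ isOpen_interior isOpen_interior h1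
      ⟨x, hx, (h1 x hx).resolve_right fun h' => interior_subset h' hP⟩
      ⟨y, hy, (h1 y hy).resolve_left fun h' => hn (interior_subset h')⟩
    exact interior_subset hz' (interior_subset hz)
  exact ⟨key x hx y hy, key y hy x hx⟩

theorem finite_bdry (hS : S.IsOMinimal) {P : ℝ → Prop} (hP : Df S P) :
    {x | Bdry P x}.Finite := by
  have h1 : Df S (fun p : Unit × ℝ => P p.2) := by fun_prop
  have h2 : Df S (fun x : ℝ => Bdry P x) := h1.bdry.comp (f := fun x : ℝ => ((), x)) (by fun_prop)
  refine finite_of_no_interval hS h2 fun a b hab => ?_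
  obtain ⟨c, hc⟩ := germ_right hS hP a
  obtain ⟨u, hu, hu'⟩ := mem_nhdsGT_iff_exists_Ioo_subset.1 hc
  have hu : a < u := hu
  have hm : a < min u b := lt_min hu hab
  refine ⟨(a + min u b) / 2, ⟨by linarith, by linarith [min_le_right u b]⟩, fun h => ?_⟩
  obtain ⟨⟨y, h1, h2⟩, ⟨z, h3, h4⟩⟩ := h ((min u b - a) / 2) (by linarith)
  rw [abs_lt] at h1 h3
  have h5 := hu' (show y ∈ Ioo a u from ⟨by linarith, by linarith [min_le_left u b]⟩)
  have h6 := hu' (show z ∈ Ioo a u from ⟨by linarith, by linarith [min_le_left u b]⟩)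
  exact h4 (h6.2 (h5.1 h2))

/-- Definable families of finite sets of bounded cardinality are enumerated by definable maps. -/
theorem exists_enum {n : ℕ} : ∀ {B : E × ℝ → Prop}, Df S B →
    (∀ e, {t | B (e, t)}.encard ≤ n) →
    ∃ b : Fin n → E → ℝ, (∀ i, Df S (b i)) ∧ ∀ e t, B (e, t) → ∃ i, t = b i e := by
  classical
  induction n with
  | zero =>
    intro B _ hB
    refine ⟨fun i => i.elim0, fun i => i.elim0, fun e t h => ?_⟩
    have := hB e
    simp only [Nat.cast_zero, nonpos_iff_eq_zero, encard_eq_zero] at this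
    exact absurd (show t ∈ {t | B (e, t)} from h) (by simp [this])
  | succ n ih =>
    intro B hBd hB
    have hfin : ∀ e, {t | B (e, t)}.Finite := fun e => finite_of_encard_le_coe (hB e)
    have hmin : ∀ e, ∃ m, ((∃ s, B (e, s)) → B (e, m)) ∧ (∀ s, B (e, s) → m ≤ s) ∧
        ((¬ ∃ s, B (e, s)) → m = 0) := by
      intro e
      by_cases h : ∃ s, B (e, s)
      · obtain ⟨m, hm, hm'⟩ := exists_min_image _ id (hfin e) h
        exact ⟨m, fun _ => hm, hm', fun h' => absurd h h'⟩
      · push Not at h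
        exact ⟨0, fun ⟨s, hs⟩ => absurd hs (h s), fun s hs => absurd hs (h s), fun _ => rfl⟩
    choose m hm1 hm2 hm3 using hmin
    have hmd : Df S m := by
      refine .of_graph (R := fun p : E × ℝ => (B p ∧ ∀ s, B (p.1, s) → p.2 ≤ s) ∨
        (¬ (∃ s, B (p.1, s)) ∧ p.2 = 0)) (by fun_prop) fun e t => ?_
      by_cases h : ∃ s, B (e, s)
      · simp only [h, not_true, false_and, or_false]
        constructor
        · rintro ⟨h1, h2⟩; exact le_antisymm (h2 _ (hm1 e h)) (hm2 e t h1)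
        · rintro rfl; exact ⟨hm1 e h, hm2 e⟩
      · have : ¬ B (e, t) := fun h' => h ⟨_, h'⟩
        simp [h, this, hm3 e h]
    obtain ⟨b, hb1, hb2⟩ := @ih (fun p => B p ∧ p.2 ≠ m p.1) (by fun_prop) (by
      intro e
      by_cases h : ∃ s, B (e, s)
      · have h1 : {t | B (e, t)} = insert (m e) {t | B (e, t) ∧ t ≠ m e} := by
          ext t
          by_cases ht : t = m e
          · simpa [ht] using hm1 e h
          · simp [ht]
        have h2 := hB e
        rw [h1, encard_insert_of_notMem (by simp), Nat.cast_add, Nat.cast_one] at h2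
        exact (ENat.add_le_add_iff_right (by simp)).1 h2
      · push Not at h
        have : {t | B (e, t) ∧ t ≠ m e} = ∅ := by ext t; simp [h t]
        simp [this])
    refine ⟨Fin.cons m b, fun i => Fin.cases (by simpa using hmd) (fun i => by simpa using hb1 i) i,
      fun e t h => ?_⟩
    by_cases ht : t = m e
    · exact ⟨0, by simpa using ht⟩
    · obtain ⟨i, hi⟩ := hb2 e t ⟨h, ht⟩
      exact ⟨i.succ, by simpa using hi⟩

/-- Sample points for the complement of a finite subset of the line. -/
noncomputable def sample {n : ℕ} (b : Fin n → ℝ) : Option (Fin n × Fin n × Fin 3) → ℝ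
  | none => 0
  | some (i, j, s) => (b i + b j) / 2 + ((s : ℕ) - 1)

theorem exists_sample {n : ℕ} (b : Fin n → ℝ) (x : ℝ) :
    ∃ l, x = sample b l ∨ ∀ y ∈ uIcc x (sample b l), ∀ i, y ≠ b i := by
  classical
  by_cases hx : ∃ i, x = b i
  · obtain ⟨i, rfl⟩ := hx
    exact ⟨some (i, i, 1), Or.inl (by simp [sample])⟩
  push Not at hx
  set L := Finset.univ.filter fun i => b i < x with hL
  set U := Finset.univ.filter fun i => x < b i with hU
  have hLU : ∀ i, i ∈ L ∨ i ∈ U := fun i => by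
    simp only [hL, hU, Finset.mem_filter, Finset.mem_univ, true_and]
    exact lt_or_gt_of_ne (hx i).symm
  rcases L.eq_empty_or_nonempty with h1 | h1 <;> rcases U.eq_empty_or_nonempty with h2 | h2
  · refine ⟨none, Or.inr fun y _ i => ?_⟩
    have := hLU i; simp [h1, h2] at this
  · obtain ⟨j, hj, hj'⟩ := U.exists_min_image b h2
    have hjx : x < b j := by simpa [hU] using hj
    refine ⟨some (j, j, 0), Or.inr fun y hy i => ?_⟩
    have hi : i ∈ U := by have := hLU i; simpa [h1] using this
    have := hj' i hi
    rw [mem_uIcc] at hy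
    simp [sample] at hy
    grind
  · obtain ⟨j, hj, hj'⟩ := L.exists_max_image b h1
    have hjx : b j < x := by simpa [hL] using hj
    refine ⟨some (j, j, 2), Or.inr fun y hy i => ?_⟩
    have hi : i ∈ L := by have := hLU i; simpa [h2] using this
    have := hj' i hi
    rw [mem_uIcc] at hy
    simp [sample] at hy
    grind
  · obtain ⟨j, hj, hj'⟩ := L.exists_max_image b h1
    have hjx : b j < x := by simpa [hL] using hj
    obtain ⟨k, hk, hk'⟩ := U.exists_min_image b h2
    have hkx : x < b k := by simpa [hU] using hk
    refine ⟨some (j, k, 1), Or.inr fun y hy i => ?_⟩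
    rw [mem_uIcc] at hy
    simp [sample] at hy
    rcases hLU i with hi | hi
    · have := hj' i hi
      grind
    · have := hk' i hi
      grind

theorem Df.sample {n : ℕ} {b : Fin n → E → ℝ} (hb : ∀ i, Df S (b i))
    (l : Option (Fin n × Fin n × Fin 3)) : Df S (fun e => sample (fun i => b i e) l) := by
  cases l with
  | none => simpa [_root_.sample] using Df.const (0 : ℝ)
  | some p =>
    have h1 := hb p.1
    have h2 := hb p.2.1
    simp only [_root_.sample]
    fun_prop

end

end

section

open Set Filter Topology DSpace

section
variable {S : RealStructure} {E F : Type} [DSpace E] [DSpace F]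

/-- The fibres of `A` near `x₀` are close to the fibre over `x₀`, with matching cardinality. -/
def StableAt (A : ℝ → ℝ → Prop) (x₀ : ℝ) : Prop :=
  ∃ ε : ℝ, 0 < ε ∧ ∃ δ : ℝ, 0 < δ ∧ (∀ r r', A x₀ r → A x₀ r' → |r - r'| < 2 * ε → r = r') ∧
    ∀ x, |x - x₀| < δ → (∀ r, A x₀ r → ∃ r', A x r' ∧ |r' - r| < ε) ∧
      (∀ r', A x r' → ∃ r, A x₀ r ∧ |r' - r| < ε) ∧
      ∀ r r', A x r → A x r' → |r - r'| < 2 * ε → r = r'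

theorem Df.stableAt {A : E × ℝ × ℝ → Prop} (hA : Df S A) :
    Df S (fun p : E × ℝ => StableAt (fun x y => A (p.1, x, y)) p.2) := by
  unfold StableAt; fun_prop

theorem StableAt.encard_eq {A : ℝ → ℝ → Prop} {x₀ : ℝ} (h : StableAt A x₀) :
    ∃ δ : ℝ, 0 < δ ∧ ∀ x, |x - x₀| < δ → {t | A x t}.encard = {t | A x₀ t}.encard := by
  obtain ⟨ε, hε, δ, hδ, h0, h1⟩ := h
  refine ⟨δ, hδ, fun x hx => ?_⟩
  obtain ⟨h2, h3, h4⟩ := h1 x hx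
  refine le_antisymm ?_ ?_
  · choose! g hg1 hg2 using h3
    refine encard_le_encard_of_injOn (f := g) hg1 fun r hr r' hr' he => h4 r r' hr hr' ?_
    have h5 := hg2 r hr
    have h6 := hg2 r' hr'
    rw [he] at h5
    rw [abs_lt] at *
    constructor <;> linarith
  · choose! g hg1 hg2 using h2
    refine encard_le_encard_of_injOn (f := g) hg1 fun r hr r' hr' he => h0 r r' hr hr' ?_
    have h5 := hg2 r hr
    have h6 := hg2 r' hr'
    rw [he] at h5
    rw [abs_lt] at *
    constructor <;> linarith

theorem encard_eq_of_stable {A : ℝ → ℝ → Prop} {I : Set ℝ} (hI : IsPreconnected I)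
    (h : ∀ x ∈ I, StableAt A x) {x y : ℝ} (hx : x ∈ I) (hy : y ∈ I) :
    {t | A x t}.encard = {t | A y t}.encard := by
  refine (iff_of_no_bdry (P := fun z => {t | A z t}.encard = {t | A y t}.encard) hI
    (fun z hz hb => ?_) hx hy).2 rfl
  obtain ⟨δ, hδ, h1⟩ := (h z hz).encard_eq
  obtain ⟨⟨u, hu, hu'⟩, ⟨v, hv, hv'⟩⟩ := hb δ hδ
  exact hv' ((h1 v hv).trans ((h1 u hu).symm.trans hu'))

theorem exists_stableAt (hS : S.IsOMinimal) {A : ℝ × ℝ → Prop} (hA : Df S A)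
    (hfin : ∀ x, {t | A (x, t)}.Finite) {a b : ℝ} (hab : a < b) :
    ∃ x ∈ Ioo a b, StableAt (fun x y => A (x, y)) x := by
  classical
  obtain ⟨n, a', b', h1, h2, h3, h4⟩ := exists_interval_of_cover hS
    (P := fun n x => ∃ v : Fin n → ℝ, (∀ i j, v i = v j → i = j) ∧
      ∀ t, A (x, t) ↔ ∃ i, v i = t) (fun n => by fun_prop) hab (by
      intro x _
      refine ⟨(hfin x).toFinset.card, fun i => ((hfin x).toFinset.equivFin.symm i : ℝ), ?_, ?_⟩
      · intro i j h
        simpa [Subtype.coe_inj] using h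
      · intro t
        constructor
        · intro h
          exact ⟨(hfin x).toFinset.equivFin ⟨t, by simpa using h⟩, by simp⟩
        · rintro ⟨i, rfl⟩
          have := ((hfin x).toFinset.equivFin.symm i).2
          exact (hfin x).mem_toFinset.1 this)
  obtain ⟨b, hb, hb'⟩ := exists_enum (n := n) (E := ℝ)
    (B := fun p : ℝ × ℝ => A p ∧ a' < p.1 ∧ p.1 < b') (by fun_prop) (by
      intro x
      by_cases hx : x ∈ Ioo a' b'
      · obtain ⟨v, hv1, hv2⟩ := h4 x hx
        have : {t | A (x, t) ∧ a' < x ∧ x < b'} ⊆ range v := fun t ht => (hv2 t).1 ht.1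
        refine (encard_le_encard this).trans ?_
        rw [← image_univ]
        refine (encard_image_le _ _).trans ?_
        simp
      · have : {t | A (x, t) ∧ a' < x ∧ x < b'} = ∅ := by
          ext t
          simp only [mem_ofPred_eq, mem_empty_iff_false, iff_false]
          exact fun h => hx h.2
        simp [this])
  have hbd : ∀ x ∈ Ioo a' b', (∀ i j, b i x = b j x → i = j) ∧ ∀ t, A (x, t) ↔ ∃ i, b i x = t := by
    intro x hx
    obtain ⟨v, hv1, hv2⟩ := h4 x hx
    have h5 : Finset.univ.image v ⊆ Finset.univ.image (fun i => b i x) := by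
      intro t ht
      simp only [Finset.mem_image, Finset.mem_univ, true_and] at ht ⊢
      obtain ⟨i, hi⟩ := hb' x t ⟨(hv2 t).2 ht, hx.1, hx.2⟩
      exact ⟨i, hi.symm⟩
    have h6 : (Finset.univ.image v).card = n := by
      rw [Finset.card_image_of_injective _ (fun i j => hv1 i j)]; simp
    have h7 : (Finset.univ.image (fun i => b i x)).card ≤ n := by
      simpa using Finset.card_image_le (s := (Finset.univ : Finset (Fin n))) (f := fun i => b i x)
    have h8 := Finset.eq_of_subset_of_card_le h5 (by omega)
    have h9 : InjOn (fun i => b i x) (Finset.univ : Finset (Fin n)) := by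
      rw [← Finset.card_image_iff, ← h8, h6]; simp
    refine ⟨fun i j h => h9 (by simp) (by simp) h, fun t => ?_⟩
    rw [hv2]
    have := Finset.ext_iff.1 h8 t
    simpa using this
  have hnd : (⋃ i, {x | ¬ DifferentiableAt ℝ (b i) x}).Finite :=
    finite_iUnion fun i => finite_not_differentiableAt hS (hb i)
  obtain ⟨x₀, hx₀, hx₀'⟩ := (Ioo_infinite h2).exists_notMem_finite hnd
  simp only [mem_iUnion, mem_ofPred_eq, not_exists, not_not] at hx₀'
  refine ⟨x₀, ⟨h1.trans_lt hx₀.1, hx₀.2.trans_le h3⟩, ?_⟩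
  obtain ⟨ε, hε, hε'⟩ : ∃ ε : ℝ, 0 < ε ∧ ∀ i j, |b i x₀ - b j x₀| < 4 * ε → i = j := by
    have : ∀ᶠ ε : ℝ in 𝓝[>] 0, ∀ i j, |b i x₀ - b j x₀| < 4 * ε → i = j := by
      rw [eventually_all]; intro i
      rw [eventually_all]; intro j
      by_cases hij : i = j
      · exact Eventually.of_forall fun _ _ => hij
      · have : 0 < |b i x₀ - b j x₀| / 4 := by
          have := abs_pos.2 (sub_ne_zero.2 fun h => hij ((hbd x₀ hx₀).1 i j h))
          linarith
        filter_upwards [Ioo_mem_nhdsGT this] with ε hε h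
        exact absurd h (by have := hε.2; linarith)
    obtain ⟨ε, h⟩ := (this.and self_mem_nhdsWithin).exists
    exact ⟨ε, h.2, h.1⟩
  have hc : ∀ᶠ x in 𝓝 x₀, x ∈ Ioo a' b' ∧ ∀ i, |b i x - b i x₀| < ε := by
    have hI : ∀ᶠ x in 𝓝 x₀, x ∈ Ioo a' b' := Ioo_mem_nhds hx₀.1 hx₀.2
    refine hI.and ?_
    rw [eventually_all]; intro i
    exact (Metric.continuousAt_iff'.1 (hx₀' i).continuousAt) ε hε
  obtain ⟨δ, hδ, hδ'⟩ := Metric.eventually_nhds_iff.1 hc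
  refine ⟨ε, hε, δ, hδ, ?_, fun x hx => ?_⟩
  · intro r r' hr hr' h
    obtain ⟨i, rfl⟩ := ((hbd x₀ hx₀).2 r).1 hr
    obtain ⟨j, rfl⟩ := ((hbd x₀ hx₀).2 r').1 hr'
    rw [hε' i j (by linarith)]
  · obtain ⟨h5, h6⟩ := hδ' (show dist x x₀ < δ from hx)
    refine ⟨fun r hr => ?_, fun r hr => ?_, fun r r' hr hr' h => ?_⟩
    · obtain ⟨i, rfl⟩ := ((hbd x₀ hx₀).2 r).1 hr
      exact ⟨b i x, ((hbd x h5).2 _).2 ⟨i, rfl⟩, h6 i⟩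
    · obtain ⟨i, rfl⟩ := ((hbd x h5).2 r).1 hr
      exact ⟨b i x₀, ((hbd x₀ hx₀).2 _).2 ⟨i, rfl⟩, h6 i⟩
    · obtain ⟨i, rfl⟩ := ((hbd x h5).2 r).1 hr
      obtain ⟨j, rfl⟩ := ((hbd x h5).2 r').1 hr'
      have h7 := h6 i
      have h8 := h6 j
      have : |b i x₀ - b j x₀| < 4 * ε := by
        rw [abs_lt] at *
        constructor <;> linarith
      rw [hε' i j this]

/-- Definable families of finite subsets of the line over `E` have bounded cardinality. -/
def UnifFinite (S : RealStructure) (E : Type) [DSpace E] : Prop :=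
  ∀ A : E × ℝ → Prop, Df S A → (∀ e, {t | A (e, t)}.Finite) →
    ∃ N : ℕ, ∀ e, {t | A (e, t)}.encard ≤ N

theorem UnifFinite.of_injective {f : E → F} (hf : Df S f) (hinj : Function.Injective f)
    (h : UnifFinite S F) : UnifFinite S E := by
  intro A hA hfin
  have h1 : ∀ e, {t | ∃ e', f e' = f e ∧ A (e', t)} = {t | A (e, t)} := by
    intro e; ext t
    exact ⟨fun ⟨e', h1, h2⟩ => hinj h1 ▸ h2, fun h => ⟨e, rfl, h⟩⟩
  obtain ⟨N, hN⟩ := h (fun p => ∃ e, f e = p.1 ∧ A (e, p.2)) (by fun_prop) (by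
    intro v
    by_cases hv : ∃ e, f e = v
    · obtain ⟨e, rfl⟩ := hv
      exact (h1 e).symm ▸ hfin e
    · push Not at hv
      convert finite_empty
      ext t; simp only [mem_ofPred_eq, mem_empty_iff_false, iff_false, not_exists, not_and]
      exact fun e h => absurd h (hv e))
  exact ⟨N, fun e => h1 e ▸ hN (f e)⟩

/-- Definable sample points for the complement of a definable family of finite sets. -/
theorem exists_df_sample {n : ℕ} {b : Fin n → E → ℝ} (hb : ∀ i, Df S (b i)) :
    ∃ c : Option (Fin n × Fin n × Fin 3) → E → ℝ, (∀ l, Df S (c l)) ∧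
      ∀ e x, ∃ l, x = c l e ∨ ∀ y ∈ uIcc x (c l e), ∀ i, y ≠ b i e :=
  ⟨fun l e => sample (fun i => b i e) l, Df.sample hb, fun _ x => exists_sample _ x⟩

theorem UnifFinite.prod_real (hS : S.IsOMinimal) (h : UnifFinite S E) :
    UnifFinite S (E × ℝ) := by
  intro A hA hfin
  have hst : Df S (fun p : E × ℝ => StableAt (fun x y => A ((p.1, x), y)) p.2) :=
    Df.stableAt (A := fun q => A ((q.1, q.2.1), q.2.2)) (by fun_prop)
  obtain ⟨N, hN⟩ := h _ hst.not (by
    intro e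
    have : Df S (fun x => StableAt (fun x y => A ((e, x), y)) x) :=
      hst.comp (f := fun x => (e, x)) (by fun_prop)
    refine finite_of_no_interval hS this.not fun a b hab => ?_
    simp only [not_not]
    exact exists_stableAt hS (A := fun q => A ((e, q.1), q.2)) (by fun_prop)
      (fun x => hfin (e, x)) hab)
  obtain ⟨b, hb, hb'⟩ := exists_enum hst.not hN
  obtain ⟨c, hc, hc'⟩ := exists_df_sample hb
  have : ∀ l, ∃ M : ℕ, ∀ e, {t | A ((e, c l e), t)}.encard ≤ M := fun l =>
    h (fun p => A ((p.1, c l p.1), p.2)) (by have := hc l; fun_prop) (fun e => hfin (e, c l e))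
  choose M hM using this
  refine ⟨∑ l, M l, fun ⟨e, x⟩ => ?_⟩
  have hle : ∀ l, (M l : ℕ∞) ≤ ((∑ l, M l : ℕ) : ℕ∞) := fun l => by
    exact_mod_cast Finset.single_le_sum (f := M) (fun _ _ => Nat.zero_le _) (Finset.mem_univ l)
  obtain ⟨l, hl | hl⟩ := hc' e x
  · rw [hl]; exact (hM l e).trans (hle l)
  · have := encard_eq_of_stable (A := fun x y => A ((e, x), y)) (I := uIcc x (c l e))
      isPreconnected_uIcc (fun y hy => ?_) left_mem_uIcc right_mem_uIcc
    · rw [this]; exact (hM l e).trans (hle l)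
    · by_contra hcon
      obtain ⟨i, hi⟩ := hb' e y hcon
      exact hl y hy i hi

theorem unifFinite (hS : S.IsOMinimal) : UnifFinite S E := by
  have key : ∀ n, UnifFinite S (Fin n → ℝ) := by
    intro n
    induction n with
    | zero =>
      intro A _ hfin
      refine ⟨(hfin Fin.elim0).toFinset.card, fun e => ?_⟩
      rw [Subsingleton.elim e Fin.elim0, (hfin _).encard_eq_coe_toFinset_card]
    | succ n ih =>
      refine (ih.prod_real hS).of_injective (f := fun v => (fun i => v i.succ, v 0))
        (by fun_prop) fun v w h => ?_
      simp only [Prod.mk.injEq, funext_iff] at h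
      funext i
      exact Fin.cases h.2 h.1 i
  exact (key (dim E)).of_injective (f := emb)
    (Coord.df ⟨fun i => i, fun x i => rfl⟩) inj

/-- Definable families of finite subsets of the line are enumerated by definable functions. -/
theorem exists_enum_of_finite (hS : S.IsOMinimal) {B : E × ℝ → Prop} (hB : Df S B)
    (hfin : ∀ e, {t | B (e, t)}.Finite) :
    ∃ (n : ℕ) (b : Fin n → E → ℝ), (∀ i, Df S (b i)) ∧ ∀ e t, B (e, t) → ∃ i, t = b i e := by
  obtain ⟨n, hn⟩ := unifFinite hS B hB hfin
  exact ⟨n, exists_enum hB hn⟩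

theorem exists_df_choice_fintype {ι : Type*} [Finite ι] {R : E × F → Prop} (hR : Df S R)
    [Nonempty F] {c : ι → E → F} (hc : ∀ i, Df S (c i)) :
    ∃ g : E → F, Df S g ∧ ∀ e, (∃ i, R (e, c i e)) → R (e, g e) := by
  classical
  have := Fintype.ofFinite ι
  have key : ∀ s : Finset ι, ∃ g : E → F, Df S g ∧ ∀ e, (∃ i ∈ s, R (e, c i e)) → R (e, g e) := by
    intro s
    induction s using Finset.induction_on with
    | empty => exact ⟨fun _ => Classical.arbitrary F, by fun_prop, by simp⟩
    | insert i s _ ih =>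
      obtain ⟨g, hg, hg'⟩ := ih
      have := hc i
      refine ⟨fun e => if R (e, c i e) then c i e else g e, by fun_prop, fun e he => ?_⟩
      by_cases h : R (e, c i e)
      · simp [h]
      · simp only [h, if_false]
        refine hg' e ?_
        obtain ⟨j, hj, hj'⟩ := he
        rcases Finset.mem_insert.1 hj with rfl | hj
        · exact absurd hj' h
        · exact ⟨j, hj, hj'⟩
  obtain ⟨g, hg, hg'⟩ := key Finset.univ
  exact ⟨g, hg, fun e ⟨i, hi⟩ => hg' e ⟨i, Finset.mem_univ _, hi⟩⟩

theorem exists_df_choice_real (hS : S.IsOMinimal) {R : E × ℝ → Prop} (hR : Df S R) :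
    ∃ g : E → ℝ, Df S g ∧ ∀ e, (∃ t, R (e, t)) → R (e, g e) := by
  obtain ⟨n, b, hb, hb'⟩ := exists_enum_of_finite hS (Df.bdry hR)
    (fun e => finite_bdry hS (P := fun y => R (e, y)) (by fun_prop))
  obtain ⟨c, hc, hc'⟩ := exists_df_sample hb
  obtain ⟨g, hg, hg'⟩ := exists_df_choice_fintype hR hc
  refine ⟨g, hg, fun e ⟨t, ht⟩ => hg' e ?_⟩
  obtain ⟨l, hl | hl⟩ := hc' e t
  · exact ⟨l, hl ▸ ht⟩
  · refine ⟨l, ?_⟩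
    refine (iff_of_no_bdry (P := fun y => R (e, y)) isPreconnected_uIcc
      (fun y hy hbd => ?_) left_mem_uIcc right_mem_uIcc).1 ht
    obtain ⟨i, hi⟩ := hb' e y hbd
    exact hl y hy i hi

theorem exists_df_choice (hS : S.IsOMinimal) {n : ℕ} : ∀ {R : E × (Fin n → ℝ) → Prop}, Df S R →
    ∃ g : E → Fin n → ℝ, Df S g ∧ ∀ e, (∃ t, R (e, t)) → R (e, g e) := by
  induction n with
  | zero =>
    intro R _
    refine ⟨fun _ => Fin.elim0, by fun_prop, fun e ⟨t, ht⟩ => ?_⟩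
    rwa [Subsingleton.elim Fin.elim0 t]
  | succ n ih =>
    intro R hR
    have hcons : Df S (fun p : ℝ × (Fin n → ℝ) => (Fin.cons p.1 p.2 : Fin (n + 1) → ℝ)) := by
      refine .pi fun i => Fin.cases ?_ (fun j => ?_) i
      · simp only [Fin.cons_zero]; fun_prop
      · simp only [Fin.cons_succ]; fun_prop
    have h1 : Df S (fun p : (E × (Fin n → ℝ)) × ℝ =>
        R (p.1.1, (Fin.cons p.2 p.1.2 : Fin (n + 1) → ℝ))) :=
      hR.comp (Df.prodMk (by fun_prop)
        (hcons.comp (f := fun p : (E × (Fin n → ℝ)) × ℝ => (p.2, p.1.2)) (by fun_prop)))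
    obtain ⟨g, hg, hg'⟩ := exists_df_choice_real hS h1
    obtain ⟨h, hh, hh'⟩ := ih (R := fun p => ∃ t, R (p.1, Fin.cons t p.2)) (Df.exists h1)
    refine ⟨fun e => Fin.cons (g (e, h e)) (h e),
      hcons.comp (f := fun e => (g (e, h e), h e)) (by fun_prop), fun e ⟨t, ht⟩ => ?_⟩
    refine hg' (e, h e) (hh' e ⟨fun i => t i.succ, t 0, ?_⟩)
    convert ht
    funext i
    exact Fin.cases rfl (fun _ => rfl) i

end

end

section

open Set Filter Topology DSpace

/-- Insert a coordinate. -/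
def ins {n : ℕ} (i : Fin (n + 1)) (t : ℝ) (v : Fin n → ℝ) : Fin (n + 1) → ℝ :=
  i.insertNth t v

@[simp] theorem ins_same {n : ℕ} (i : Fin (n + 1)) (t : ℝ) (v : Fin n → ℝ) : ins i t v i = t := by
  simp [ins]

@[simp] theorem ins_succAbove {n : ℕ} (i : Fin (n + 1)) (t : ℝ) (v : Fin n → ℝ) (j : Fin n) :
    ins i t v (i.succAbove j) = v j := by
  simp [ins]

@[simp] theorem ins_zero_succ {n : ℕ} (t : ℝ) (v : Fin n → ℝ) (j : Fin n) :
    ins 0 t v j.succ = v j := by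
  simp [ins]

theorem ins_self {n : ℕ} (i : Fin (n + 1)) (x : Fin (n + 1) → ℝ) :
    ins i (x i) (fun j => x (i.succAbove j)) = x := by
  exact Fin.insertNth_self_removeNth i x

theorem ins_zero_self {n : ℕ} (x : Fin (n + 1) → ℝ) : ins 0 (x 0) (fun j => x j.succ) = x := by
  simpa using ins_self 0 x

section
variable {S : RealStructure} {E F : Type} [DSpace E] [DSpace F]

@[fun_prop]
theorem Df.ins {n : ℕ} (i : Fin (n + 1)) {t : E → ℝ} {v : E → Fin n → ℝ} (ht : Df S t)
    (hv : Df S v) : Df S (fun e => ins i (t e) (v e)) := by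
  refine .pi fun j => ?_
  rcases Fin.eq_self_or_eq_succAbove i j with rfl | ⟨j, rfl⟩
  · simpa using ht
  · simp only [ins_succAbove]; fun_prop

/-- `P` holds in a neighbourhood of `x`. -/
def Near {k : ℕ} (P : (Fin k → ℝ) → Prop) (x : Fin k → ℝ) : Prop :=
  ∃ δ : ℝ, 0 < δ ∧ ∀ y : Fin k → ℝ, (∀ i, |y i - x i| < δ) → P y

theorem near_iff {k : ℕ} {P : (Fin k → ℝ) → Prop} {x : Fin k → ℝ} :
    Near P x ↔ ∀ᶠ y in 𝓝 x, P y := by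
  rw [Metric.eventually_nhds_iff]
  constructor
  · rintro ⟨δ, hδ, h⟩
    exact ⟨δ, hδ, fun y hy => h y ((dist_pi_lt_iff hδ).1 hy)⟩
  · rintro ⟨δ, hδ, h⟩
    exact ⟨δ, hδ, fun y hy => h ((dist_pi_lt_iff hδ).2 hy)⟩

theorem Df.near {k : ℕ} {P : E × (Fin k → ℝ) → Prop} (hP : Df S P) :
    Df S (fun p : E × (Fin k → ℝ) => Near (fun y => P (p.1, y)) p.2) := by
  unfold Near; fun_prop

theorem Df.eventually {k : ℕ} {P : E × (Fin k → ℝ) → Prop} (hP : Df S P) :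
    Df S (fun p : E × (Fin k → ℝ) => ∀ᶠ y in 𝓝 p.2, P (p.1, y)) := by
  simpa only [near_iff] using hP.near

theorem Df.eventually₁ {P : E × ℝ → Prop} (hP : Df S P) :
    Df S (fun p : E × ℝ => ∀ᶠ y in 𝓝 p.2, P (p.1, y)) := by
  simp only [Metric.eventually_nhds_iff, Real.dist_eq]
  fun_prop

theorem Df.continuousAt {k : ℕ} {f : E × (Fin k → ℝ) → ℝ} (hf : Df S f) :
    Df S (fun p : E × (Fin k → ℝ) => ContinuousAt (fun y => f (p.1, y)) p.2) := by
  have key : ∀ p : E × (Fin k → ℝ), ContinuousAt (fun y => f (p.1, y)) p.2 ↔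
      ∀ ε : ℝ, 0 < ε → ∀ᶠ y in 𝓝 p.2, |f (p.1, y) - f p| < ε := fun p => by
    simp only [Metric.continuousAt_iff', Real.dist_eq]
  simp only [key]
  have := Df.eventually (S := S) (E := (E × (Fin k → ℝ)) × ℝ)
    (P := fun q => |f (q.1.1.1, q.2) - f q.1.1| < q.1.2) (by fun_prop)
  have h2 : Df S (fun q : (E × (Fin k → ℝ)) × ℝ => ∀ᶠ y in 𝓝 q.1.2, |f (q.1.1, y) - f q.1| < q.2) :=
    this.comp (f := fun q : (E × (Fin k → ℝ)) × ℝ => (q, q.1.2)) (by fun_prop)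
  fun_prop

theorem exists_open_of_cover (hS : S.IsOMinimal) {k : ℕ} : ∀ {ι : Type} [Countable ι]
    {P : ι → (Fin k → ℝ) → Prop}, (∀ i, Df S (P i)) → ∀ {W : Set (Fin k → ℝ)}, IsOpen W →
    W.Nonempty → (∀ x ∈ W, ∃ i, P i x) →
    ∃ i, ∃ V ⊆ W, IsOpen V ∧ V.Nonempty ∧ ∀ x ∈ V, P i x := by
  induction k with
  | zero =>
    intro ι _ P _ W hW ⟨x, hx⟩ h
    obtain ⟨i, hi⟩ := h x hx
    exact ⟨i, W, Subset.rfl, hW, ⟨x, hx⟩, fun y _ => Subsingleton.elim x y ▸ hi⟩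
  | succ k ih =>
    intro ι _ P hP W hW ⟨x₀, hx₀⟩ h
    obtain ⟨ε, hε, hεW⟩ := Metric.isOpen_iff.1 hW x₀ hx₀
    have hbox : ∀ t ∈ Ioo (x₀ 0 - ε) (x₀ 0 + ε), ∀ v ∈ Metric.ball (fun j => x₀ (Fin.succ j)) ε,
        ins 0 t v ∈ W := by
      intro t ht v hv
      refine hεW ((dist_pi_lt_iff hε).2 fun i => ?_)
      refine Fin.cases ?_ (fun j => ?_) i
      · rw [ins_same, Real.dist_eq, abs_lt]; constructor <;> linarith [ht.1, ht.2]
      · rw [ins_zero_succ]; exact (dist_pi_lt_iff hε).1 hv j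
    obtain ⟨⟨i, p, q⟩, V, hV1, hV2, ⟨v₀, hv₀⟩, hV4⟩ := ih (ι := ι × ℚ × ℚ)
      (P := fun j v => (x₀ 0 - ε ≤ j.2.1 ∧ (j.2.1 : ℝ) < j.2.2 ∧ j.2.2 ≤ x₀ 0 + ε) ∧
        ∀ t : ℝ, j.2.1 < t → t < j.2.2 → P j.1 (ins 0 t v))
      (fun j => by have := hP j.1; fun_prop) Metric.isOpen_ball ⟨_, Metric.mem_ball_self hε⟩ (by
        intro v hv
        obtain ⟨i, a', b', h1, h2, h3, h4⟩ := exists_interval_of_cover hS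
          (P := fun i t => P i (ins 0 t v)) (fun i => by have := hP i; fun_prop)
          (show x₀ 0 - ε < x₀ 0 + ε by linarith) (fun t ht => h _ (hbox t ht v hv))
        obtain ⟨p, hp1, hp2⟩ := exists_rat_btwn h2
        obtain ⟨q, hq1, hq2⟩ := exists_rat_btwn hp2
        exact ⟨(i, p, q), ⟨h1.trans hp1.le, hq1, hq2.le.trans h3⟩,
          fun t h5 h6 => h4 t ⟨hp1.trans h5, h6.trans hq2⟩⟩)
    obtain ⟨⟨h1, h2, h3⟩, _⟩ := hV4 v₀ hv₀
    refine ⟨i, {x | x 0 ∈ Ioo (p : ℝ) q ∧ (fun j => x (Fin.succ j)) ∈ V}, ?_, ?_, ?_, ?_⟩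
    · rintro x ⟨hx, hx'⟩
      rw [← ins_zero_self x]
      exact hbox _ ⟨h1.trans_lt hx.1, hx.2.trans_le h3⟩ _ (hV1 hx')
    · exact (isOpen_Ioo.preimage (continuous_apply 0)).inter
        (hV2.preimage (continuous_pi fun j => continuous_apply (Fin.succ j)))
    · refine ⟨ins 0 ((p + q) / 2) v₀, ?_⟩
      dsimp only at h2
      simp only [mem_ofPred_eq, ins_same, ins_zero_succ]
      exact ⟨⟨by linarith, by linarith⟩, hv₀⟩
    · rintro x ⟨hx, hx'⟩
      rw [← ins_zero_self x]
      exact (hV4 _ hx').2 _ hx.1 hx.2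

/-- Definable functions are generically continuous. -/
theorem exists_open_continuousAt (hS : S.IsOMinimal) {k n : ℕ} {f : (Fin k → ℝ) → Fin n → ℝ}
    (hf : Df S f) {W : Set (Fin k → ℝ)} (hW : IsOpen W) (hne : W.Nonempty) :
    ∃ V ⊆ W, IsOpen V ∧ V.Nonempty ∧ ∀ x ∈ V, ContinuousAt f x := by
  have hcont : ∀ j, Df S (fun x => ContinuousAt (fun y => f y j) x) := fun j =>
    (Df.continuousAt (E := Unit) (f := fun p => f p.2 j) (by fun_prop)).comp
      (f := fun x => ((), x)) (by fun_prop)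
  have hev : ∀ (j) (p q : ℚ), Df S (fun x => ∀ᶠ y in 𝓝 x, p < f y j ∧ f y j < q) := fun j p q =>
    (Df.eventually (E := Unit) (P := fun z => p < f z.2 j ∧ f z.2 j < q) (by fun_prop)).comp
      (f := fun x => ((), x)) (by fun_prop)
  obtain ⟨i, V, h1, h2, h3, h4⟩ := exists_open_of_cover hS (ι := Option (Fin n × ℚ × ℚ))
    (P := fun i => i.elim (fun x => ∀ j, ContinuousAt (fun y => f y j) x) fun i x =>
      (i.2.1 < f x i.1 ∧ f x i.1 < i.2.2) ∧
        ¬ ∀ᶠ y in 𝓝 x, i.2.1 < f y i.1 ∧ f y i.1 < i.2.2)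
    (fun i => by
      cases i with
      | none => dsimp only [Option.elim]; fun_prop
      | some i => have := hev i.1 i.2.1 i.2.2; dsimp only [Option.elim]; fun_prop) hW hne (by
      intro x _
      by_contra hcon
      rw [not_exists] at hcon
      refine hcon none fun j => ?_
      rw [Metric.continuousAt_iff']
      intro ε hε
      obtain ⟨p, hp1, hp2⟩ := exists_rat_btwn (show f x j - ε < f x j by linarith)
      obtain ⟨q, hq1, hq2⟩ := exists_rat_btwn (show f x j < f x j + ε by linarith)
      have := hcon (some (j, p, q))
      dsimp only [Option.elim] at this
      rw [not_and, not_not] at this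
      filter_upwards [this ⟨hp2, hq1⟩] with y hy
      rw [Real.dist_eq, abs_lt]
      constructor <;> linarith [hy.1, hy.2])
  refine ⟨V, h1, h2, h3, fun x hx => ?_⟩
  cases i with
  | none => exact continuousAt_pi.2 (h4 x hx)
  | some i =>
    refine absurd ?_ (h4 x hx).2
    filter_upwards [h2.mem_nhds hx] with y hy
    exact (h4 y hy).1

theorem exists_rat_box {k : ℕ} {P : (Fin k → ℝ) → Prop} {x : Fin k → ℝ} (h : Near P x) :
    ∃ (c : Fin k → ℚ) (r : ℚ), 0 < r ∧ ∀ y : Fin k → ℝ, (∀ i, |y i - c i| < r) → P y := by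
  obtain ⟨δ, hδ, h⟩ := h
  obtain ⟨r, hr1, hr2⟩ := exists_rat_btwn (half_pos hδ)
  have : ∀ i, ∃ c : ℚ, |x i - c| < r := fun i => by
    obtain ⟨c, h1, h2⟩ := exists_rat_btwn (show x i < x i + r by linarith)
    exact ⟨c, by rw [abs_lt]; constructor <;> linarith⟩
  choose c hc using this
  refine ⟨c, r, by exact_mod_cast hr1, fun y hy => h y fun i => ?_⟩
  have h1 := hc i
  have h2 := hy i
  rw [abs_lt] at *
  constructor <;> linarith

/-- Definable families of sets with empty interior are covered by finitely many graphs. -/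
theorem exists_graph_cover (hS : S.IsOMinimal) {k : ℕ} : ∀ {E : Type} [DSpace E]
    {R : E × (Fin (k + 1) → ℝ) → Prop}, Df S R →
    (∀ e x, ¬ ∀ᶠ y in 𝓝 x, R (e, y)) →
    ∃ (L : Type) (_ : Finite L) (i : L → Fin (k + 1)) (g : L → E × (Fin k → ℝ) → ℝ),
      (∀ l, Df S (g l)) ∧ ∀ e x, R (e, x) →
        ∃ l, x (i l) = g l (e, fun j => x ((i l).succAbove j)) := by
  have key : ∀ {k : ℕ} {E : Type} [DSpace E] {R : E × (Fin (k + 1) → ℝ) → Prop}, Df S R →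
      (∀ e x, ¬ ∀ᶠ y in 𝓝 x, R (e, y)) →
      ∃ (n : ℕ) (b : Fin n → E → ℝ), (∀ i, Df S (b i)) ∧ ∀ e t v,
        (∀ᶠ w in 𝓝 v, R (e, ins 0 t w)) → ∃ i, t = b i e := by
    intro k E _ R hR hint
    have hB : Df S (fun p : E × ℝ => ∃ v, Near (fun w => R (p.1, ins 0 p.2 w)) v) := by
      have : Df S (fun q : (E × ℝ) × (Fin k → ℝ) => Near (fun w => R (q.1.1, ins 0 q.1.2 w)) q.2) :=
        Df.near (P := fun q : (E × ℝ) × (Fin k → ℝ) => R (q.1.1, ins 0 q.1.2 q.2)) (by fun_prop)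
      fun_prop
    obtain ⟨n, b, hb, hb'⟩ := exists_enum_of_finite hS hB fun e => by
      refine finite_of_no_interval hS (hB.comp (f := fun t => (e, t)) (by fun_prop)) fun a b hab => ?_
      by_contra! hcon
      obtain ⟨⟨c, r⟩, a', b', h1, h2, h3, h4⟩ := exists_interval_of_cover hS
        (P := fun (j : (Fin k → ℚ) × ℚ) t => 0 < j.2 ∧
          ∀ y : Fin k → ℝ, (∀ i, |y i - j.1 i| < j.2) → R (e, ins 0 t y))
        (fun j => by fun_prop) hab (fun t ht => by
          obtain ⟨v, hv⟩ := hcon t ht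
          obtain ⟨c, r, h1, h2⟩ := exists_rat_box hv
          exact ⟨(c, r), h1, h2⟩)
      have hm : (a' + b') / 2 ∈ Ioo a' b' := ⟨by linarith, by linarith⟩
      refine hint e (ins 0 ((a' + b') / 2) fun i => (c i : ℝ)) ?_
      have hr : (0 : ℝ) < r := by exact_mod_cast (h4 _ hm).1
      have e1 : ∀ᶠ y : Fin (k + 1) → ℝ in 𝓝 (ins 0 ((a' + b') / 2) fun i => (c i : ℝ)),
          y 0 ∈ Ioo a' b' := by
        refine (continuous_apply 0).continuousAt.eventually_mem ?_
        rw [ins_same]; exact Ioo_mem_nhds hm.1 hm.2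
      have e2 : ∀ᶠ y : Fin (k + 1) → ℝ in 𝓝 (ins 0 ((a' + b') / 2) fun i => (c i : ℝ)),
          ∀ i : Fin k, |y i.succ - c i| < r := by
        rw [eventually_all]; intro i
        have := (continuous_apply (A := fun _ : Fin (k + 1) => ℝ) i.succ).continuousAt
          (x := (ins 0 ((a' + b') / 2) fun i => (c i : ℝ)))
        have := (Metric.continuousAt_iff'.1 this) r hr
        simpa [Real.dist_eq] using this
      filter_upwards [e1, e2] with y h5 h6
      rw [← ins_zero_self y]
      exact (h4 _ h5).2 _ h6
    exact ⟨n, b, hb, fun e t v h => hb' e t ⟨v, near_iff.2 h⟩⟩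
  induction k with
  | zero =>
    intro E _ R hR hint
    obtain ⟨n, b, hb, hb'⟩ := key hR hint
    refine ⟨Fin n, inferInstance, fun _ => 0, fun l p => b l p.1, fun l => ?_, fun e x hx => ?_⟩
    · have := hb l; fun_prop
    · refine hb' e (x 0) Fin.elim0 (Eventually.of_forall fun w => ?_)
      rw [← ins_zero_self x] at hx
      rwa [Subsingleton.elim w (fun j => x j.succ)]
  | succ k ih =>
    intro E _ R hR hint
    obtain ⟨n, b, hb, hb'⟩ := key hR hint
    have hnb : Df S (fun p : E × ℝ => ∀ i, p.2 ≠ b i p.1) :=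
      Df.forall_fintype fun i => by have := hb i; fun_prop
    obtain ⟨L, hL, i, g, hg, hg'⟩ := ih (E := E × ℝ)
      (R := fun p => R (p.1.1, ins 0 p.1.2 p.2) ∧ ∀ i, p.1.2 ≠ b i p.1.1)
      (by fun_prop) (fun e x h => by
        obtain ⟨j, hj⟩ := hb' e.1 e.2 x (h.mono fun _ h => h.1)
        exact h.self_of_nhds.2 j hj)
    refine ⟨Fin n ⊕ L, inferInstance, Sum.elim (fun _ => 0) (fun l => (i l).succ),
      Sum.elim (fun l p => b l p.1) (fun l p => g l ((p.1, p.2 0), fun j => p.2 j.succ)),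
      ?_, fun e x hx => ?_⟩
    · rintro (l | l)
      · have := hb l; dsimp only [Sum.elim_inl]; fun_prop
      · have := hg l; dsimp only [Sum.elim_inr]; fun_prop
    · by_cases hj : ∃ j, x 0 = b j e
      · obtain ⟨j, hj⟩ := hj
        exact ⟨Sum.inl j, hj⟩
      · push Not at hj
        obtain ⟨l, hl⟩ := hg' (e, x 0) (fun j => x j.succ) ⟨by rwa [ins_zero_self], hj⟩
        refine ⟨Sum.inr l, ?_⟩
        simpa using hl

end

end

section

open Set Filter Topology DSpace

theorem abs_sub_taylor_le {s : Set ℝ} (hs : OrdConnected s) {B : ℝ} (r : ℕ) : ∀ {G : ℕ → ℝ → ℝ},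
    (∀ i < r, ∀ u ∈ s, HasDerivAt (G i) (G (i + 1) u) u) → (∀ u ∈ s, |G r u| ≤ B) →
    ∀ a ∈ s, ∀ u ∈ s,
      |G 0 u - ∑ i ∈ Finset.range r, G i a * ((u - a) ^ i / i.factorial)| ≤ B * |u - a| ^ r := by
  induction r with
  | zero => intro G _ hB a _ u hu; simpa using hB u hu
  | succ r ih =>
    intro G hG hB a ha u hu
    have hB0 : 0 ≤ B := (abs_nonneg _).trans (hB u hu)
    have ih' := ih (G := fun i => G (i + 1)) (fun i hi => hG (i + 1) (by omega)) hB a ha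
    have hsub : uIcc a u ⊆ s := hs.uIcc_subset ha hu
    have hder : ∀ x ∈ uIcc a u, HasDerivWithinAt
        (fun u => G 0 u - ∑ i ∈ Finset.range (r + 1), G i a * ((u - a) ^ i / i.factorial))
        (G 1 x - ∑ i ∈ Finset.range r, G (i + 1) a * ((x - a) ^ i / i.factorial)) (uIcc a u) x := by
      intro x hx
      refine HasDerivAt.hasDerivWithinAt ?_
      refine (hG 0 (by omega) x (hsub hx)).sub ?_
      have h1 : ∀ i ∈ Finset.range (r + 1),
          HasDerivAt (fun u : ℝ => G i a * ((u - a) ^ i / i.factorial))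
            (G i a * ((i * (x - a) ^ (i - 1) * 1) / i.factorial)) x := fun i _ =>
        ((((hasDerivAt_id x).sub_const a).pow i).div_const _).const_mul _
      have := HasDerivAt.fun_sum h1
      rw [Finset.sum_range_succ'] at this
      convert this using 1
      simp only [CharP.cast_eq_zero, zero_mul, zero_div, mul_zero, add_zero]
      refine Finset.sum_congr rfl fun i _ => ?_
      rw [Nat.factorial_succ]
      push_cast
      have : ((i : ℝ) + 1) ≠ 0 := by positivity
      have h3 : (i.factorial : ℝ) ≠ 0 := by positivity
      field_simp
    have hbd : ∀ x ∈ uIcc a u,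
        ‖G 1 x - ∑ i ∈ Finset.range r, G (i + 1) a * ((x - a) ^ i / i.factorial)‖ ≤
          B * |u - a| ^ r := by
      intro x hx
      refine (ih' x (hsub hx)).trans ?_
      have : |x - a| ≤ |u - a| := by
        exact abs_sub_left_of_mem_uIcc hx
      gcongr
    have := (convex_uIcc a u).norm_image_sub_le_of_norm_hasDerivWithin_le hder hbd
      left_mem_uIcc right_mem_uIcc
    rw [Finset.sum_range_succ' (fun i => G i a * ((a - a) ^ i / i.factorial))] at this
    simp only [sub_self, Real.norm_eq_abs] at this
    simp at this
    rw [pow_succ, ← mul_assoc]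
    simpa using this

/-- `G 0` is `1`-bounded and `1`-Lipschitz on `(α, β)` with successive derivatives `G i`, which are
monotone or antitone for `1 ≤ i ≤ p + 1`. -/
structure Tame (p : ℕ) (α β : ℝ) (G : ℕ → ℝ → ℝ) : Prop where
  bound : ∀ u ∈ Ioo α β, |G 0 u| ≤ 1
  bound' : ∀ u ∈ Ioo α β, |G 1 u| ≤ 1
  deriv : ∀ i < p + 1, ∀ u ∈ Ioo α β, HasDerivAt (G i) (G (i + 1) u) u
  mono : ∀ i ≤ p, MonotoneOn (G (i + 1)) (Ioo α β) ∨ AntitoneOn (G (i + 1)) (Ioo α β)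

theorem deriv_le_of_monotone {g g' : ℝ → ℝ} {u d B : ℝ} (hd : 0 < d)
    (hg : ∀ x ∈ Icc (u - d) (u + d), HasDerivAt g (g' x) x)
    (hm : MonotoneOn g' (Icc (u - d) (u + d)) ∨ AntitoneOn g' (Icc (u - d) (u + d)))
    (hB : ∀ x ∈ Icc (u - d) (u + d), |g x| ≤ B) : |g' u| * d ≤ 2 * B := by
  have hc : ContinuousOn g (Icc (u - d) (u + d)) := fun x hx =>
    (hg x hx).continuousAt.continuousWithinAt
  obtain ⟨x, hx, hx'⟩ := exists_hasDerivAt_eq_slope g g' (show u < u + d by linarith)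
    (hc.mono (Icc_subset_Icc (by linarith) le_rfl))
    (fun x hx => hg x ⟨by linarith [hx.1], by linarith [hx.2]⟩)
  obtain ⟨y, hy, hy'⟩ := exists_hasDerivAt_eq_slope g g' (show u - d < u by linarith)
    (hc.mono (Icc_subset_Icc le_rfl (by linarith)))
    (fun x hx => hg x ⟨by linarith [hx.1], by linarith [hx.2]⟩)
  have hx'' : g' x * d = g (u + d) - g u := by
    rw [hx', add_sub_cancel_left]; field_simp
  have hy'' : g' y * d = g u - g (u - d) := by
    rw [hy', sub_sub_cancel]; field_simp
  have mu : u ∈ Icc (u - d) (u + d) := ⟨by linarith, by linarith⟩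
  have mx : x ∈ Icc (u - d) (u + d) := ⟨by linarith [hx.1], by linarith [hx.2]⟩
  have my : y ∈ Icc (u - d) (u + d) := ⟨by linarith [hy.1], by linarith [hy.2]⟩
  have b1 := abs_le.1 (hB u mu)
  have b2 := abs_le.1 (hB (u + d) ⟨by linarith, by linarith⟩)
  have b3 := abs_le.1 (hB (u - d) ⟨by linarith, by linarith⟩)
  rw [← abs_of_pos hd, ← abs_mul, abs_le]
  rcases hm with hm | hm
  · have h1 := mul_le_mul_of_nonneg_right (hm mu mx hx.1.le) hd.le
    have h2 := mul_le_mul_of_nonneg_right (hm my mu hy.2.le) hd.le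
    constructor <;> linarith
  · have h1 := mul_le_mul_of_nonneg_right (hm mu mx hx.1.le) hd.le
    have h2 := mul_le_mul_of_nonneg_right (hm my mu hy.2.le) hd.le
    constructor <;> linarith

theorem Tame.abs_mul_pow_le {p : ℕ} {α β : ℝ} {G : ℕ → ℝ → ℝ} (h : Tame p α β G) (i : ℕ) :
    i ≤ p → ∀ u d : ℝ, 0 < d → α ≤ u - d → u + d ≤ β → |G (i + 1) u| * d ^ i ≤ 2 ^ (i + 1) ^ 2 := by
  induction i with
  | zero =>
    intro _ u d hd h1 h2
    have := h.bound' u ⟨by linarith, by linarith⟩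
    norm_num; linarith
  | succ i ih =>
    intro hi u d hd h1 h2
    have hsub : Icc (u - d / 2) (u + d / 2) ⊆ Ioo α β := fun x hx =>
      ⟨by linarith [hx.1], by linarith [hx.2]⟩
    have := deriv_le_of_monotone (g := G (i + 1)) (g' := G (i + 2)) (u := u) (d := d / 2)
      (B := 2 ^ (i + 1) ^ 2 / (d / 2) ^ i) (by positivity)
      (fun x hx => h.deriv _ (by omega) x (hsub hx))
      ((h.mono (i + 1) hi).imp (fun h => h.mono hsub) (fun h => h.mono hsub))
      (fun x hx => by
        rw [le_div_iff₀ (by positivity)]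
        exact ih (by omega) x (d / 2) (by positivity) (by linarith [hx.1]) (by linarith [hx.2]))
    have h3 : |G (i + 1 + 1) u| * d ^ (i + 1) ≤ 2 ^ (i + 1) ^ 2 * 2 ^ (i + 2) := by
      have h4 := mul_le_mul_of_nonneg_right this (show 0 ≤ 2 * d ^ i by positivity)
      calc _ = |G (i + 2) u| * (d / 2) * (2 * d ^ i) := by ring
        _ ≤ _ := h4
        _ = _ := by rw [div_pow]; field_simp; ring
    refine h3.trans ?_
    rw [← pow_add]
    exact pow_le_pow_right₀ (by norm_num) (by nlinarith)

open Classical in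
/-- The (truncated) normalised `i`-th Taylor coefficient at the node of parameter `z`. -/
noncomputable def node (p : ℕ) (α β : ℝ) (G : ℕ → ℝ → ℝ) (i : ℕ) (z : ℝ) : ℝ :=
  if |G i (α + (β - α) / 2 * z ^ (p + 1)) * ((β - α) / 2 * z ^ (p + 1)) ^ (i - 1) / 2 ^ i ^ 2| ≤ 1
  then G i (α + (β - α) / 2 * z ^ (p + 1)) * ((β - α) / 2 * z ^ (p + 1)) ^ (i - 1) / 2 ^ i ^ 2
  else 0

theorem abs_node_le (p : ℕ) (α β : ℝ) (G : ℕ → ℝ → ℝ) (i : ℕ) (z : ℝ) :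
    |node p α β G i z| ≤ 1 := by
  unfold node; split_ifs with h
  · exact h
  · simp

theorem Tame.node_eq {p : ℕ} {α β : ℝ} {G : ℕ → ℝ → ℝ} (h : Tame p α β G) (hαβ : α < β) {i : ℕ}
    (hi : i < p + 1) {z : ℝ} (hz : 0 < z) (hz1 : z < 1) : node p α β G i z =
      G i (α + (β - α) / 2 * z ^ (p + 1)) * ((β - α) / 2 * z ^ (p + 1)) ^ (i - 1) / 2 ^ i ^ 2 := by
  have h0 : 0 < (β - α) / 2 := by linarith
  have h1 : 0 < (β - α) / 2 * z ^ (p + 1) := by positivity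
  have h2 : (β - α) / 2 * z ^ (p + 1) ≤ (β - α) / 2 :=
    mul_le_of_le_one_right h0.le (pow_le_one₀ hz.le hz1.le)
  refine if_pos ?_
  cases i with
  | zero => simpa using h.bound _ ⟨by linarith, by linarith⟩
  | succ i =>
    rw [abs_div, abs_of_pos (show (0:ℝ) < 2 ^ (i + 1) ^ 2 by positivity), div_le_one (by positivity),
      abs_mul, abs_of_pos (show 0 < ((β - α) / 2 * z ^ (p + 1)) ^ (i + 1 - 1) by positivity)]
    exact h.abs_mul_pow_le i (by omega) _ _ h1 (by linarith) (by linarith)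

end

section

open Set Filter Topology DSpace

theorem pow_sub_pow_le {a b c : ℝ} (ha : 0 ≤ a) (hb : 0 ≤ b) (hac : a ≤ c) (hbc : b ≤ c) (p : ℕ) :
    |a ^ (p + 1) - b ^ (p + 1)| ≤ (p + 1) * c ^ p * |a - b| := by
  have := (convex_uIcc (𝕜 := ℝ) b a).norm_image_sub_le_of_norm_hasDerivWithin_le
    (f := fun x : ℝ => x ^ (p + 1)) (f' := fun x => (p + 1) * x ^ p) (C := (p + 1) * c ^ p)
    (fun x _ => by simpa using (hasDerivAt_pow (p + 1) x).hasDerivWithinAt)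
    (fun x hx => by
      have h0 : 0 ≤ x := (le_inf hb ha).trans hx.1
      have h1 : x ≤ c := hx.2.trans (sup_le hbc hac)
      rw [Real.norm_eq_abs, abs_of_nonneg (by positivity)]; gcongr)
    left_mem_uIcc right_mem_uIcc
  simpa using this

set_option maxHeartbeats 1000000 in
theorem node_approx (p : ℕ) {K : ℝ} (hK : 0 ≤ K) : ∃ C : ℝ, 0 < C ∧ ∀ (α β u : ℝ) (m : ℕ), α < u →
    u - α ≤ (β - α) / 2 → β - α ≤ 2 * K → 1 ≤ m →
    ∃ (q : Fin m) (w : Fin (p + 1) → ℝ), (∀ i, |w i| ≤ C) ∧ ∀ G, Tame p α β G →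
      |G 0 u - ∑ i : Fin (p + 1), w i * node p α β G i (((q : ℕ) + 1 / 2) / m)| ≤
        C / m ^ (p + 1) := by
  set A : ℝ := 2 ^ (p + 1) ^ 2 with hA
  set C1 : ℝ := A * (A * (K + 1)) with hC1
  set C2 : ℝ := (2 ^ (p + 1)) ^ p * A * K * ((p + 1) * 2 ^ p) ^ (p + 1) with hC2
  refine ⟨C1 + C2 + K + 1, by positivity, fun α β u m h1 h2 h3 hm => ?_⟩
  have hC1' : 0 ≤ C1 := by positivity
  have hC2' : 0 ≤ C2 := by positivity
  have hmpos : (0 : ℝ) < m := by exact_mod_cast hm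
  set l := (β - α) / 2 with hl
  have hl0 : 0 < l := by linarith
  have hlK : l ≤ K := by linarith
  obtain ⟨t, ht0, ht1, ht⟩ : ∃ t : ℝ, 0 < t ∧ t ≤ 1 ∧ u = α + l * t ^ (p + 1) := by
    have h0 : 0 < (u - α) / l := div_pos (by linarith) hl0
    refine ⟨((u - α) / l) ^ (((p + 1 : ℕ) : ℝ)⁻¹), Real.rpow_pos_of_pos h0 _,
      Real.rpow_le_one h0.le ((div_le_one hl0).2 h2) (by positivity), ?_⟩
    rw [Real.rpow_inv_natCast_pow h0.le (by omega)]
    field_simp; ring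
  obtain ⟨q, hqm, hq1, hq2⟩ : ∃ q : ℕ, q < m ∧ (q : ℝ) < t * m ∧ t * m ≤ q + 1 := by
    have h0 : 0 < t * m := by positivity
    have h5 : 0 < ⌈t * m⌉₊ := Nat.ceil_pos.2 h0
    have h6 : ⌈t * m⌉₊ ≤ m := Nat.ceil_le.2 (by nlinarith)
    refine ⟨⌈t * m⌉₊ - 1, by omega, ?_, ?_⟩
    · exact Nat.lt_ceil.1 (by omega)
    · have := Nat.le_ceil (t * m)
      rw [show (⌈t * m⌉₊ : ℝ) = ((⌈t * m⌉₊ - 1 : ℕ) : ℝ) + 1 by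
        rw [Nat.cast_sub (by omega)]; simp] at this
      exact this
  set z : ℝ := (q + 1 / 2) / m with hz
  have hz0 : 0 < z := by positivity
  have hq1m : (q : ℝ) + 1 ≤ m := by exact_mod_cast hqm
  have hz1 : z < 1 := by rw [hz, div_lt_one hmpos]; linarith
  have hzm : z * m = q + 1 / 2 := by rw [hz]; field_simp
  have htz : |t - z| ≤ 1 / m := by
    rw [le_div_iff₀ hmpos]
    have e : |t - z| * m = |(t - z) * m| := by rw [abs_mul, abs_of_pos hmpos]
    rw [e, abs_le, sub_mul, hzm]
    constructor <;> linarith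
  set h := l * z ^ (p + 1) with hh
  have hh0 : 0 < h := by positivity
  have hhl : h ≤ l := mul_le_of_le_one_right hl0.le (pow_le_one₀ hz0.le hz1.le)
  have hu1 : l * t ^ (p + 1) ≤ l := mul_le_of_le_one_right hl0.le (pow_le_one₀ ht0.le ht1)
  have hu0 : 0 < l * t ^ (p + 1) := by positivity
  have hαβ : α < β := by linarith
  have huI : u ∈ Ioo α β := ⟨by linarith, by linarith⟩
  have hvI : α + h ∈ Ioo α β := ⟨by linarith, by linarith⟩
  have hK1 : C1 + C2 + K + 1 ≥ 1 := by linarith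
  rcases Nat.eq_zero_or_pos q with rfl | hqpos
  · refine ⟨⟨0, hqm⟩, Pi.single 0 1, fun i => ?_, fun G hG => ?_⟩
    · refine le_trans ?_ hK1
      by_cases hi : i = 0
      · subst hi; simp
      · simp [hi]
    · have h7 := abs_sub_taylor_le ordConnected_Ioo 1 (G := G) (B := 1)
        (fun i hi u hu => hG.deriv i (by omega) u hu) hG.bound' (α + h) hvI u huI
      rw [Finset.sum_range_one] at h7
      rw [Finset.sum_eq_single 0 (by intro i _ hi; simp [hi]) (by simp)]
      rw [← hz]
      rw [hG.node_eq hαβ (by simp) hz0 hz1]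
      simp only [Pi.single_eq_same, Fin.val_zero, one_mul]
      simp only [pow_zero, Nat.factorial_zero, Nat.cast_one, div_one, mul_one, one_mul, pow_one] at h7
      have h8 : |u - (α + h)| ≤ K / m ^ (p + 1) := by
        have e1 : t ^ (p + 1) ≤ (1 / m) ^ (p + 1) := by
          apply pow_le_pow_left₀ ht0.le
          rw [le_div_iff₀ hmpos]; simpa using hq2
        have e2 : z ^ (p + 1) ≤ (1 / m) ^ (p + 1) := by
          apply pow_le_pow_left₀ hz0.le
          rw [le_div_iff₀ hmpos, hzm]; norm_num
        have e3 : (1 / (m:ℝ)) ^ (p + 1) * K = K / m ^ (p + 1) := by rw [one_div, inv_pow]; field_simp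
        have e4 : l * t ^ (p + 1) ≤ (1 / m) ^ (p + 1) * K := by
          rw [mul_comm]; gcongr
        have e5 : l * z ^ (p + 1) ≤ (1 / m) ^ (p + 1) * K := by
          rw [mul_comm]; gcongr
        rw [← e3, ht, abs_le]
        constructor <;> linarith
      refine le_trans ?_ (h8.trans ?_)
      · simpa using h7
      · gcongr; linarith
  · have hq1' : (1 : ℝ) ≤ q := by exact_mod_cast hqpos
    have htz2 : t ≤ 2 * z := by
      refine le_of_mul_le_mul_right ?_ hmpos
      rw [mul_assoc, hzm]; linarith
    have hzt2 : z ≤ 2 * t := by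
      refine le_of_mul_le_mul_right ?_ hmpos
      rw [mul_assoc, hzm]; linarith
    have hut : l * t ^ (p + 1) ≤ 2 ^ (p + 1) * h := by
      rw [hh]
      calc l * t ^ (p + 1) ≤ l * (2 * z) ^ (p + 1) := by gcongr
        _ = _ := by rw [mul_pow]; ring
    have hht : h ≤ 2 ^ (p + 1) * (l * t ^ (p + 1)) := by
      rw [hh]
      calc l * z ^ (p + 1) ≤ l * (2 * t) ^ (p + 1) := by gcongr
        _ = _ := by rw [mul_pow]; ring
    have h21 : (1 : ℝ) ≤ 2 ^ (p + 1) := one_le_pow₀ (by norm_num)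
    have huv : |u - (α + h)| ≤ 2 ^ (p + 1) * h := by
      rw [ht, abs_le]
      constructor <;> nlinarith
    have huv2 : |u - (α + h)| ≤ l * z ^ p * ((p + 1) * 2 ^ p) / m := by
      have := pow_sub_pow_le ht0.le hz0.le htz2 (by linarith) p
      calc |u - (α + h)| = l * |t ^ (p + 1) - z ^ (p + 1)| := by
            rw [ht, ← abs_of_pos hl0, ← abs_mul, abs_of_pos hl0]; congr 1; rw [hh]; ring
        _ ≤ l * ((p + 1) * (2 * z) ^ p * (1 / m)) := by gcongr; exact this.trans (by gcongr)
        _ = _ := by rw [mul_pow]; ring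
    refine ⟨⟨q, hqm⟩, fun i => 2 ^ (i : ℕ) ^ 2 * ((u - (α + h)) ^ (i : ℕ) / (i : ℕ).factorial) /
      h ^ ((i : ℕ) - 1), fun i => ?_, fun G hG => ?_⟩
    · have hi : (i : ℕ) ≤ p + 1 := i.2.le
      have e1 : |u - (α + h)| ^ (i : ℕ) ≤ A * (K + 1) * h ^ ((i : ℕ) - 1) := by
        calc _ ≤ (2 ^ (p + 1) * h) ^ (i : ℕ) := by gcongr
          _ = 2 ^ ((p + 1) * i) * h ^ (i : ℕ) := by rw [mul_pow, ← pow_mul]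
          _ ≤ A * ((K + 1) * h ^ ((i : ℕ) - 1)) := by
              gcongr ?_ * ?_
              · rw [hA]; apply pow_le_pow_right₀ (by norm_num); nlinarith
              · rcases Nat.eq_zero_or_pos (i : ℕ) with h0 | h0
                · rw [h0]; simp; linarith
                · rw [← Nat.succ_pred_eq_of_pos h0, pow_succ']
                  simp only [Nat.succ_eq_add_one, Nat.add_sub_cancel, Nat.pred_eq_sub_one]
                  gcongr; linarith
          _ = _ := by ring
      rw [abs_div, abs_mul, abs_div, abs_of_pos (show 0 < h ^ ((i:ℕ) - 1) by positivity),
        abs_of_pos (show (0:ℝ) < 2 ^ (i:ℕ) ^ 2 by positivity), Nat.abs_cast, abs_pow]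
      rw [div_le_iff₀ (by positivity)]
      calc 2 ^ (i : ℕ) ^ 2 * (|u - (α + h)| ^ (i : ℕ) / (i : ℕ).factorial)
          ≤ A * (A * (K + 1) * h ^ ((i : ℕ) - 1)) := by
            gcongr ?_ * ?_
            · rw [hA]; apply pow_le_pow_right₀ (by norm_num); nlinarith
            · refine (div_le_self (by positivity) ?_).trans e1
              exact_mod_cast Nat.factorial_pos _
        _ = C1 * h ^ ((i : ℕ) - 1) := by rw [hC1]; ring
        _ ≤ _ := by gcongr; linarith
    · have hcut : h / 2 ^ (p + 1) ≤ h := div_le_self hh0.le h21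
      have hcut2 : h / 2 ^ (p + 1) ≤ u - α := by
        rw [div_le_iff₀ (by positivity), ht]; linarith
      set d := h / 2 ^ (p + 1) with hd
      have hd0 : 0 < d := by positivity
      have hlb : l + l = β - α := by rw [hl]; ring
      have hT := abs_sub_taylor_le (s := Icc (α + d) (α + l)) ordConnected_Icc (p + 1) (G := G)
        (B := A / d ^ p) (fun i hi x hx => hG.deriv i hi x ⟨by linarith [hx.1], by linarith [hx.2]⟩)
        (fun x hx => by
          rw [le_div_iff₀ (by positivity)]
          exact hG.abs_mul_pow_le p le_rfl x d hd0 (by linarith [hx.1]) (by linarith [hx.2]))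
        (α + h) ⟨by linarith, by linarith⟩ u ⟨by linarith, by linarith⟩
      rw [Finset.sum_range (fun i => G i (α + h) * ((u - (α + h)) ^ i / i.factorial))] at hT
      have e0 : ∀ i : Fin (p + 1), G i (α + h) * ((u - (α + h)) ^ (i : ℕ) / (i : ℕ).factorial) =
          2 ^ (i : ℕ) ^ 2 * ((u - (α + h)) ^ (i : ℕ) / (i : ℕ).factorial) /
            h ^ ((i : ℕ) - 1) * node p α β G i ((q + 1 / 2) / m) := by
        intro i
        rw [← hz, hG.node_eq hαβ i.2 hz0 hz1, ← hl, ← hh]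
        field_simp
      rw [Finset.sum_congr rfl fun i _ => e0 i] at hT
      refine hT.trans ?_
      calc A / d ^ p * |u - (α + h)| ^ (p + 1)
          ≤ A / d ^ p * (l * z ^ p * ((p + 1) * 2 ^ p) / m) ^ (p + 1) := by gcongr
        _ = (2 ^ (p + 1)) ^ p * A * l * ((p + 1) * 2 ^ p) ^ (p + 1) / m ^ (p + 1) := by
            rw [hd, hh]
            simp only [div_pow, mul_pow]
            field_simp
            ring_nf
        _ ≤ C2 / m ^ (p + 1) := by rw [hC2]; gcongr
        _ ≤ _ := by gcongr; linarith

end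

section

open Set Filter Topology DSpace

/-- Iterated derivatives with respect to the last variable. -/
noncomputable def itd {E : Type} (f : E × ℝ → ℝ) : ℕ → E × ℝ → ℝ
  | 0 => f
  | j + 1 => fun p => deriv (fun x => itd f j (p.1, x)) p.2

theorem monotoneOn_or_antitoneOn {g : ℝ → ℝ} {I : Set ℝ} (hI : OrdConnected I)
    (hd : ∀ y ∈ I, DifferentiableAt ℝ g y) (h1 : ∀ y ∈ I, ¬ Bdry (fun y => 0 < deriv g y) y)
    (h2 : ∀ y ∈ I, ¬ Bdry (fun y => deriv g y < 0) y) : MonotoneOn g I ∨ AntitoneOn g I := by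
  rcases I.eq_empty_or_nonempty with rfl | ⟨x, hx⟩
  · exact Or.inl (by simp [MonotoneOn])
  have hc : ContinuousOn g I := fun y hy => (hd y hy).continuousAt.continuousWithinAt
  have hdi : DifferentiableOn ℝ g (interior I) := fun y hy =>
    (hd y (interior_subset hy)).differentiableWithinAt
  by_cases hx1 : deriv g x < 0
  · refine Or.inr (antitoneOn_of_deriv_nonpos hI.convex hc hdi fun y hy => ?_)
    exact ((iff_of_no_bdry hI.isPreconnected h2 hx (interior_subset hy)).1 hx1).le
  · refine Or.inl (monotoneOn_of_deriv_nonneg hI.convex hc hdi fun y hy => ?_)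
    have := mt (iff_of_no_bdry hI.isPreconnected h2 hx (interior_subset hy)).2 hx1
    exact not_lt.1 this

theorem ordConnected_star (R : ℝ → Prop) (c : ℝ) : OrdConnected {x | ∀ y ∈ uIcc x c, R y} := by
  refine ⟨fun x hx x' hx' y hy z hz => ?_⟩
  rw [mem_uIcc] at hz
  rcases hz with ⟨h1, h2⟩ | ⟨h1, h2⟩
  · exact hx z (mem_uIcc.2 (Or.inl ⟨hy.1.trans h1, h2⟩))
  · exact hx' z (mem_uIcc.2 (Or.inr ⟨h1, h2.trans hy.2⟩))

theorem div_one_add_abs_strictMono : StrictMono (fun x : ℝ => x / (1 + |x|)) := by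
  intro x y hxy
  dsimp only
  rw [div_lt_div_iff₀ (by positivity) (by positivity)]
  rcases abs_cases x with ⟨h1, h2⟩ | ⟨h1, h2⟩ <;> rcases abs_cases y with ⟨h3, h4⟩ | ⟨h3, h4⟩ <;>
    rw [h1, h3] <;> nlinarith

section
variable {S : RealStructure} {E F : Type} [DSpace E] [DSpace F]

theorem Df.itd {f : E × ℝ → ℝ} (hf : Df S f) (j : ℕ) : Df S (itd f j) := by
  induction j with
  | zero => exact hf
  | succ j ih => exact ih.deriv

theorem Df.star {R : E × ℝ → Prop} (hR : Df S R) {c : E → ℝ} (hc : Df S c) :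
    Df S (fun p : E × ℝ => ∀ y ∈ uIcc p.2 (c p.1), R (p.1, y)) := by
  simp only [mem_uIcc]
  fun_prop

theorem exists_sample_of_finite (hS : S.IsOMinimal) {R : E × ℝ → Prop} (hR : Df S R)
    (hfin : ∀ e, {y | ¬ R (e, y)}.Finite) :
    ∃ (L : Type) (_ : Finite L) (c : L → E → ℝ), (∀ l, Df S (c l)) ∧
      ∀ e x, ∃ l, x = c l e ∨ ∀ y ∈ uIcc x (c l e), R (e, y) := by
  obtain ⟨n, b, hb, hb'⟩ := exists_enum_of_finite hS hR.not hfin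
  obtain ⟨c, hc, hc'⟩ := exists_df_sample hb
  refine ⟨_, inferInstance, c, hc, fun e x => (hc' e x).imp fun l hl => hl.imp_right fun h y hy => ?_⟩
  by_contra hcon
  obtain ⟨i, hi⟩ := hb' e y hcon
  exact h y hy i hi

/-- The function `x ↦ f (e, x)` is differentiable at `y`, and its derivative has locally constant
sign near `y`. -/
def Regular {E : Type} (f : E × ℝ → ℝ) (p : E × ℝ) : Prop :=
  DifferentiableAt ℝ (fun x => f (p.1, x)) p.2 ∧
    ¬ Bdry (fun y => 0 < deriv (fun x => f (p.1, x)) y) p.2 ∧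
    ¬ Bdry (fun y => deriv (fun x => f (p.1, x)) y < 0) p.2

theorem Df.regular {f : E × ℝ → ℝ} (hf : Df S f) : Df S (Regular f) := by
  have h1 := hf.differentiableAt
  have h2 := hf.deriv
  have h3 := Df.bdry (S := S) (P := fun p : E × ℝ => 0 < _root_.deriv (fun x => f (p.1, x)) p.2) (by fun_prop)
  have h4 := Df.bdry (S := S) (P := fun p : E × ℝ => _root_.deriv (fun x => f (p.1, x)) p.2 < 0) (by fun_prop)
  exact h1.and (h3.not.and h4.not)

theorem finite_not_regular (hS : S.IsOMinimal) {f : E × ℝ → ℝ} (hf : Df S f) (e : E) :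
    {y | ¬ Regular f (e, y)}.Finite := by
  have h2 := hf.deriv
  have h2' : Df S (fun y => deriv (fun x => f (e, x)) y) :=
    h2.comp (f := fun y => (e, y)) (by fun_prop)
  refine ((finite_not_differentiableAt hS (f := fun x => f (e, x)) (by fun_prop)).union
    ((finite_bdry hS (P := fun y => 0 < deriv (fun x => f (e, x)) y) (by fun_prop)).union
    (finite_bdry hS (P := fun y => deriv (fun x => f (e, x)) y < 0) (by fun_prop)))).subset ?_
  intro y hy
  simp only [Regular, mem_ofPred_eq] at hy
  simp only [mem_union, mem_ofPred_eq]
  by_contra h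
  simp only [not_or, not_not] at h
  exact hy h

theorem Regular.monotoneOn {α : Type} {f : α × ℝ → ℝ} {e : α} {I : Set ℝ} (hI : OrdConnected I)
    (h : ∀ y ∈ I, Regular f (e, y)) :
    MonotoneOn (fun x => f (e, x)) I ∨ AntitoneOn (fun x => f (e, x)) I :=
  monotoneOn_or_antitoneOn hI (fun y hy => (h y hy).1) (fun y hy => (h y hy).2.1)
    (fun y hy => (h y hy).2.2)

/-- Finitely many bounded functions of one variable become simultaneously Lipschitz after a
piecewise change of variables. -/
theorem exists_lipschitz_param (hS : S.IsOMinimal) {κ : Type} [Fintype κ] {f : κ → E × ℝ → ℝ}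
    (hf : ∀ k, Df S (f k)) (hb : ∀ k p, |f k p| ≤ 1) :
    ∃ (L : Type) (_ : Finite L) (D : L → E × ℝ → Prop) (ψ : L → E × ℝ → ℝ) (K : ℝ), 0 ≤ K ∧
      (∀ l, Df S (D l)) ∧ (∀ l, Df S (ψ l)) ∧ (∀ l e u, D l (e, u) → |u| ≤ K) ∧
      (∀ e x, ∃ l u, D l (e, u) ∧ ψ l (e, u) = x) ∧
      ∀ l e u u', D l (e, u) → D l (e, u') → ∀ k,
        |f k (e, ψ l (e, u)) - f k (e, ψ l (e, u'))| ≤ |u - u'| := by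
  have hreg : Df S (fun p : E × ℝ => ∀ k, Regular (f k) p) :=
    Df.forall_fintype fun k => (hf k).regular
  obtain ⟨L, hL, c, hc, hc'⟩ := exists_sample_of_finite hS hreg fun e => by
    refine (finite_iUnion fun k => finite_not_regular hS (hf k) e).subset fun y hy => ?_
    simpa using hy
  let I : L → E → ℝ → Prop := fun l e x => ∀ y ∈ uIcc x (c l e), ∀ k, Regular (f k) (e, y)
  have hIc : ∀ l e, OrdConnected {x | I l e x} := fun l e =>
    ordConnected_star (fun y => ∀ k, Regular (f k) (e, y)) _
  have hI : ∀ l, Df S (fun p : E × ℝ => I l p.1 p.2) := fun l => by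
    exact hreg.star (hc l)
  let sg : Bool → ℝ := fun b => if b then 1 else -1
  let s : (κ → Bool) → E × ℝ → ℝ := fun ε p => p.2 / (1 + |p.2|) + ∑ k, sg (ε k) * f k p
  have hs : ∀ ε, Df S (s ε) := fun ε => by
    have : Df S (fun p : E × ℝ => ∑ k, sg (ε k) * f k p) :=
      Df.finset_sum _ fun k _ => (Df.const _).mul (hf k)
    simp only [s]
    fun_prop
  let D : L × (κ → Bool) → E × ℝ → Prop := fun l p =>
    (∀ k, ∀ x y, I l.1 p.1 x → I l.1 p.1 y → x ≤ y →
      sg (l.2 k) * f k (p.1, x) ≤ sg (l.2 k) * f k (p.1, y)) ∧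
      ∃ x, I l.1 p.1 x ∧ s l.2 (p.1, x) = p.2
  have hD : ∀ l, Df S (D l) := fun l => by
    have h1 := hI l.1
    have h2 := hs l.2
    have h3 : ∀ k, Df S (fun p : E × ℝ => ∀ x y, I l.1 p.1 x → I l.1 p.1 y → x ≤ y →
      sg (l.2 k) * f k (p.1, x) ≤ sg (l.2 k) * f k (p.1, y)) := fun k => by
      have := hf k
      have h4 : Df S (fun q : (E × ℝ) × ℝ => I l.1 q.1.1 q.2) :=
        h1.comp (f := fun q : (E × ℝ) × ℝ => (q.1.1, q.2)) (by fun_prop)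
      have h5 : Df S (fun q : ((E × ℝ) × ℝ) × ℝ => I l.1 q.1.1.1 q.1.2) :=
        h1.comp (f := fun q : ((E × ℝ) × ℝ) × ℝ => (q.1.1.1, q.1.2)) (by fun_prop)
      have h6 : Df S (fun q : ((E × ℝ) × ℝ) × ℝ => I l.1 q.1.1.1 q.2) :=
        h1.comp (f := fun q : ((E × ℝ) × ℝ) × ℝ => (q.1.1.1, q.2)) (by fun_prop)
      fun_prop
    have h4 : Df S (fun q : (E × ℝ) × ℝ => I l.1 q.1.1 q.2) :=
      h1.comp (f := fun q : (E × ℝ) × ℝ => (q.1.1, q.2)) (by fun_prop)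
    exact (Df.forall_fintype h3).and (by fun_prop)
  have hψ : ∀ l : L × (κ → Bool), ∃ ψ : E × ℝ → ℝ, Df S ψ ∧ ∀ p : E × ℝ,
      (∃ x, I l.1 p.1 x ∧ s l.2 (p.1, x) = p.2) →
        I l.1 p.1 (ψ p) ∧ s l.2 (p.1, ψ p) = p.2 := fun l => by
    have h2 := hs l.2
    have h4 : Df S (fun q : (E × ℝ) × ℝ => I l.1 q.1.1 q.2) :=
      (hI l.1).comp (f := fun q : (E × ℝ) × ℝ => (q.1.1, q.2)) (by fun_prop)
    exact exists_df_choice_real hS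
      (R := fun q : (E × ℝ) × ℝ => I l.1 q.1.1 q.2 ∧ s l.2 (q.1.1, q.2) = q.1.2) (by fun_prop)
  choose ψ hψ hψ' using hψ
  refine ⟨L ⊕ L × (κ → Bool), inferInstance, Sum.elim (fun _ p => p.2 = 0) D,
    Sum.elim (fun l p => c l p.1) ψ, 1 + Fintype.card κ, by positivity, ?_, ?_, ?_, ?_, ?_⟩
  · rintro (l | l)
    · dsimp only [Sum.elim_inl]; fun_prop
    · exact hD l
  · rintro (l | l)
    · have := hc l
      dsimp only [Sum.elim_inl]; fun_prop
    · exact hψ l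
  · rintro (l | l) e u hu
    · simp only [Sum.elim_inl] at hu
      rw [hu]; simp; positivity
    · obtain ⟨-, x, -, hx⟩ := hu
      have hx : s l.2 (e, x) = u := hx
      rw [← hx]
      simp only [s]
      refine (abs_add_le _ _).trans (add_le_add ?_ ?_)
      · rw [abs_div, abs_of_pos (show 0 < 1 + |x| by positivity), div_le_one (by positivity)]
        linarith
      · refine (Finset.abs_sum_le_sum_abs _ _).trans ?_
        refine (Finset.sum_le_card_nsmul _ _ 1 fun k _ => ?_).trans (by simp)
        rw [abs_mul]
        have : |sg (l.2 k)| = 1 := by simp only [sg]; split_ifs <;> simp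
        rw [this, one_mul]; exact hb k _
  · intro e x
    obtain ⟨l, hl | hl⟩ := hc' e x
    · exact ⟨Sum.inl l, 0, rfl, hl.symm⟩
    · have hex : ∀ k, ∃ b : Bool, ∀ x y, I l e x → I l e y → x ≤ y →
          sg b * f k (e, x) ≤ sg b * f k (e, y) := fun k => by
        rcases Regular.monotoneOn (f := f k) (e := e) (hIc l e)
          (fun y hy => hy y left_mem_uIcc k) with h | h
        · exact ⟨true, fun x y hx hy hxy => by simpa [sg] using h hx hy hxy⟩
        · exact ⟨false, fun x y hx hy hxy => by simpa [sg] using h hx hy hxy⟩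
      choose ε hε using hex
      have hD' : D (l, ε) (e, s ε (e, x)) := ⟨hε, x, hl, rfl⟩
      refine ⟨Sum.inr (l, ε), s ε (e, x), hD', ?_⟩
      obtain ⟨h1, h2⟩ := hψ' (l, ε) (e, s ε (e, x)) hD'.2
      have hmono : StrictMonoOn (fun x => s ε (e, x)) {x | I l e x} := by
        intro a ha b hb hab
        exact add_lt_add_of_lt_of_le (div_one_add_abs_strictMono hab)
          (Finset.sum_le_sum fun k _ => hε k a b ha hb hab.le)
      exact hmono.injOn h1 hl h2
  · rintro (l | l) e u u' hu hu' k
    · simp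
    · have key : ∀ u u', D l (e, u) → D l (e, u') → u ≤ u' →
          |f k (e, ψ l (e, u)) - f k (e, ψ l (e, u'))| ≤ |u - u'| := by
        intro u u' hu hu' huu
        obtain ⟨h1, h2⟩ := hψ' l _ hu.2
        obtain ⟨h3, h4⟩ := hψ' l _ hu'.2
        dsimp only at h1 h2 h3 h4
        have hmono : ∀ a b, I l.1 e a → I l.1 e b → a ≤ b →
            |f k (e, a) - f k (e, b)| ≤ s l.2 (e, b) - s l.2 (e, a) := by
          intro a b ha hb hab
          have e1 := div_one_add_abs_strictMono.monotone hab
          have e2 : |f k (e, a) - f k (e, b)| =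
              sg (l.2 k) * f k (e, b) - sg (l.2 k) * f k (e, a) := by
            have := hu.1 k a b ha hb hab
            dsimp only at this
            rw [← mul_sub, abs_sub_comm]
            have h9 : |sg (l.2 k)| = 1 := by simp only [sg]; split_ifs <;> simp
            rw [← abs_of_nonneg (show 0 ≤ sg (l.2 k) * (f k (e, b) - f k (e, a)) by linarith),
              abs_mul, h9, one_mul]
          have e3 := Finset.single_le_sum (s := Finset.univ)
            (f := fun k => sg (l.2 k) * f k (e, b) - sg (l.2 k) * f k (e, a))
            (fun k _ => sub_nonneg.2 (hu.1 k a b ha hb hab)) (Finset.mem_univ k)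
          rw [Finset.sum_sub_distrib] at e3
          simp only [s] at *
          linarith
        rcases le_total (ψ l (e, u)) (ψ l (e, u')) with h | h
        · have := hmono _ _ h1 h3 h
          rw [h2, h4] at this
          rw [abs_sub_comm u]
          exact this.trans (le_abs_self _)
        · have := hmono _ _ h3 h1 h
          rw [h2, h4] at this
          rw [abs_sub_comm]
          exact this.trans (le_abs_self _)
      rcases le_total u u' with h | h
      · exact key u u' hu hu' h
      · rw [abs_sub_comm, abs_sub_comm u]
        exact key u' u hu' hu h

end

end

section

open Set Filter Topology DSpace

theorem Tame.reflect {p : ℕ} {α β : ℝ} {G : ℕ → ℝ → ℝ} (h : Tame p α β G) :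
    Tame p (-β) (-α) (fun i x => (-1) ^ i * G i (-x)) := by
  have hm : ∀ u ∈ Ioo (-β) (-α), -u ∈ Ioo α β := fun u hu =>
    ⟨by linarith [hu.2], by linarith [hu.1]⟩
  refine ⟨fun u hu => ?_, fun u hu => ?_, fun i hi u hu => ?_, fun i hi => ?_⟩
  · simpa using h.bound _ (hm u hu)
  · simpa using h.bound' _ (hm u hu)
  · have := ((h.deriv i hi _ (hm u hu)).comp u (hasDerivAt_neg u)).const_mul ((-1) ^ i)
    refine this.congr_deriv ?_
    rw [pow_succ]
    ring
  · have key : ∀ c : ℝ, c = 1 ∨ c = -1 →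
        MonotoneOn (fun x => c * G (i + 1) (-x)) (Ioo (-β) (-α)) ∨
          AntitoneOn (fun x => c * G (i + 1) (-x)) (Ioo (-β) (-α)) := by
      intro c hc
      rcases hc with rfl | rfl <;> rcases h.mono i hi with h | h
      · exact Or.inr fun x hx y hy hxy => by
          have := h (hm y hy) (hm x hx) (neg_le_neg hxy); linarith
      · exact Or.inl fun x hx y hy hxy => by
          have := h (hm y hy) (hm x hx) (neg_le_neg hxy); linarith
      · exact Or.inl fun x hx y hy hxy => by
          have := h (hm y hy) (hm x hx) (neg_le_neg hxy); linarith
      · exact Or.inr fun x hx y hy hxy => by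
          have := h (hm y hy) (hm x hx) (neg_le_neg hxy); linarith
    exact key _ (neg_one_pow_eq_or ℝ (i + 1))

section
variable {S : RealStructure} {E F : Type} [DSpace E] [DSpace F]

theorem Df.node (p : ℕ) {α β : E → ℝ} {G : ℕ → E × ℝ → ℝ} (hα : Df S α) (hβ : Df S β)
    (hG : ∀ i, Df S (G i)) (i : ℕ) :
    Df S (fun q : E × ℝ => node p (α q.1) (β q.1) (fun i x => G i (q.1, x)) i q.2) := by
  have := hG i
  unfold _root_.node
  fun_prop

/-- `S`-definable families of functions `F k` of one variable on `{x | A (e, x)}` are approximated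
to precision `m ^ (-r)`, piecewise on `O(m)` pieces, by bounded combinations of `r` nodes. -/
def Approx (S : RealStructure) {κ : Type} (r : ℕ) (A : E × ℝ → Prop) (F : κ → E × ℝ → ℝ) : Prop :=
  ∃ (L : Type) (_ : Finite L) (C : ℝ) (Y : L → Fin r → κ → E × ℝ → ℝ), 0 < C ∧
    (∀ l i k, Df S (Y l i k)) ∧ (∀ l i k p, |Y l i k p| ≤ 1) ∧ ∀ e x, A (e, x) → ∀ m : ℕ, 1 ≤ m →
      ∃ l, ∃ q : Fin m, ∃ w : Fin r → ℝ, (∀ i, |w i| ≤ C) ∧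
        ∀ k, |F k (e, x) - ∑ i, w i * Y l i k (e, ((q : ℕ) + 1 / 2) / m)| ≤ C / m ^ r

theorem Approx.of_cover {κ ι : Type} [Fintype ι] {r : ℕ} {A : E × ℝ → Prop} {B : ι → E × ℝ → Prop}
    {f : κ → E × ℝ → ℝ} {g : ι → κ → E × ℝ → ℝ} (h : ∀ i, Approx S r (B i) (g i))
    (hc : ∀ e x, A (e, x) → ∃ i u, B i (e, u) ∧ ∀ k, f k (e, x) = g i k (e, u)) :
    Approx S r A f := by
  choose L hL C Y hC hY hY1 hY2 using h
  have hCle : ∀ i, C i ≤ 1 + ∑ i, C i := fun i => by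
    have := Finset.single_le_sum (f := C) (fun i _ => (hC i).le) (Finset.mem_univ i)
    linarith
  refine ⟨Σ i, L i, inferInstance, 1 + ∑ i, C i, fun l => Y l.1 l.2,
    add_pos_of_pos_of_nonneg one_pos (Finset.sum_nonneg fun i _ => (hC i).le),
    fun l => hY l.1 l.2, fun l => hY1 l.1 l.2, fun e x hx m hm => ?_⟩
  obtain ⟨i, u, hu, hf⟩ := hc e x hx
  obtain ⟨l, q, w, hw, hw'⟩ := hY2 i e u hu m hm
  refine ⟨⟨i, l⟩, q, w, fun j => (hw j).trans (hCle i), fun k => ?_⟩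
  rw [hf k]
  exact (hw' k).trans (by have := hCle i; gcongr)

theorem approx_point {κ : Type} (p : ℕ) {f : κ → E × ℝ → ℝ} (hf : ∀ k, Df S (f k))
    (hb : ∀ k p, |f k p| ≤ 1) {c : E → ℝ} (hc : Df S c) :
    Approx S (p + 1) (fun q => q.2 = c q.1) f := by
  refine ⟨Unit, inferInstance, 1, fun _ _ k q => f k (q.1, c q.1), one_pos, fun _ _ k => ?_,
    fun _ _ k q => hb k _, ?_⟩
  · have := hf k; fun_prop
  · intro e x hx m hm
    refine ⟨(), ⟨0, hm⟩, Pi.single 0 1, fun i => ?_, fun k => ?_⟩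
    · by_cases hi : i = 0
      · subst hi; simp
      · simp [hi]
    · rw [Finset.sum_eq_single 0 (by intro i _ hi; simp [hi]) (by simp)]
      dsimp only at hx
      subst hx
      simp

theorem approx_left {κ : Type} (p : ℕ) {G : κ → ℕ → E × ℝ → ℝ} (hG : ∀ k i, Df S (G k i))
    {α β : E → ℝ} (hα : Df S α) (hβ : Df S β) {K : ℝ} (hK : 0 ≤ K) :
    Approx S (p + 1) (fun q => (α q.1 < q.2 ∧ q.2 - α q.1 ≤ (β q.1 - α q.1) / 2 ∧
      β q.1 - α q.1 ≤ 2 * K) ∧ ∀ k, Tame p (α q.1) (β q.1) (fun i x => G k i (q.1, x)))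
      (fun k => G k 0) := by
  obtain ⟨C, hC, h⟩ := node_approx p hK
  refine ⟨Unit, inferInstance, C, fun _ i k q =>
    node p (α q.1) (β q.1) (fun i x => G k i (q.1, x)) i q.2, hC, fun _ i k =>
    Df.node p hα hβ (hG k) i, fun _ i k q => abs_node_le _ _ _ _ _ _, ?_⟩
  rintro e x ⟨⟨h1, h2, h3⟩, h4⟩ m hm
  obtain ⟨q, w, hw, hw'⟩ := h (α e) (β e) x m h1 h2 h3 hm
  exact ⟨(), q, w, hw, fun k => hw' _ (h4 k)⟩

theorem approx_of_lipschitz (hS : S.IsOMinimal) {κ : Type} [Fintype κ] (p : ℕ) {g : κ → E × ℝ → ℝ}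
    (hg : ∀ k, Df S (g k)) (hb : ∀ k q, |g k q| ≤ 1) {D : E × ℝ → Prop} (hD : Df S D) {K : ℝ}
    (hK : 0 ≤ K) (hDK : ∀ e u, D (e, u) → |u| ≤ K)
    (hlip : ∀ e u u', D (e, u) → D (e, u') → ∀ k, |g k (e, u) - g k (e, u')| ≤ |u - u'|) :
    Approx S (p + 1) D g := by
  have hreg : Df S (fun q : E × ℝ => ¬ Bdry (fun y => D (q.1, y)) q.2 ∧
      ∀ k, ∀ j : Fin (p + 2), Regular (itd (g k) j) q) :=
    hD.bdry.not.and (Df.forall_fintype fun k => Df.forall_fintype fun j => ((hg k).itd j).regular)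
  obtain ⟨L, hL, c, hc, hc'⟩ := exists_sample_of_finite hS hreg fun e => by
    refine ((finite_bdry hS (P := fun y => D (e, y)) (by fun_prop)).union (finite_iUnion fun k =>
      finite_iUnion fun j : Fin (p + 2) =>
        finite_not_regular hS ((hg k).itd j) e)).subset fun y hy => ?_
    simp only [mem_ofPred_eq, not_and_or, not_not, not_forall] at hy
    simp only [mem_union, mem_iUnion, mem_ofPred_eq]
    exact hy
  have := Fintype.ofFinite L
  let I : L → E → ℝ → Prop := fun l e x => ∀ y ∈ uIcc x (c l e), ¬ Bdry (fun y => D (e, y)) y ∧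
      ∀ k, ∀ j : Fin (p + 2), Regular (itd (g k) j) (e, y)
  have hIc : ∀ l e, OrdConnected {x | I l e x} := fun l e =>
    ordConnected_star (fun y => ¬ Bdry (fun y => D (e, y)) y ∧
      ∀ k, ∀ j : Fin (p + 2), Regular (itd (g k) j) (e, y)) _
  have hI : ∀ l, Df S (fun p : E × ℝ => I l p.1 p.2) := fun l => hreg.star (hc l)
  have hinf : ∀ l, ∃ α : E → ℝ, Df S α ∧ ∀ e, (∃ a, IsGLB {x | I l e x} a) →
      IsGLB {x | I l e x} (α e) := fun l => by
    refine exists_df_choice_real hS (R := fun q => IsGLB {x | I l q.1 x} q.2) ?_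
    simp only [IsGLB, IsGreatest, lowerBounds, upperBounds, mem_ofPred_eq]
    have h1 : Df S (fun q : (E × ℝ) × ℝ => I l q.1.1 q.2) :=
      (hI l).comp (f := fun q : (E × ℝ) × ℝ => (q.1.1, q.2)) (by fun_prop)
    have h2 : Df S (fun q : ((E × ℝ) × ℝ) × ℝ => I l q.1.1.1 q.2) :=
      (hI l).comp (f := fun q : ((E × ℝ) × ℝ) × ℝ => (q.1.1.1, q.2)) (by fun_prop)
    fun_prop
  have hsup : ∀ l, ∃ β : E → ℝ, Df S β ∧ ∀ e, (∃ a, IsLUB {x | I l e x} a) →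
      IsLUB {x | I l e x} (β e) := fun l => by
    refine exists_df_choice_real hS (R := fun q => IsLUB {x | I l q.1 x} q.2) ?_
    simp only [IsLUB, IsLeast, lowerBounds, upperBounds, mem_ofPred_eq]
    have h1 : Df S (fun q : (E × ℝ) × ℝ => I l q.1.1 q.2) :=
      (hI l).comp (f := fun q : (E × ℝ) × ℝ => (q.1.1, q.2)) (by fun_prop)
    have h2 : Df S (fun q : ((E × ℝ) × ℝ) × ℝ => I l q.1.1.1 q.2) :=
      (hI l).comp (f := fun q : ((E × ℝ) × ℝ) × ℝ => (q.1.1.1, q.2)) (by fun_prop)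
    fun_prop
  choose α hα hα' using hinf
  choose β hβ hβ' using hsup
  have hgr : ∀ k i, Df S (fun q : E × ℝ => (-1) ^ i * itd (g k) i (q.1, -q.2)) := fun k i => by
    have := (hg k).itd (S := S) i
    fun_prop
  have hLft := fun l => approx_left (S := S) p (fun k i => (hg k).itd i) (hα l) (hβ l) hK
  have hRgt := fun l => approx_left (S := S) p hgr (α := fun e => - β l e) (β := fun e => - α l e)
    (by have := hβ l; fun_prop) (by have := hα l; fun_prop) hK
  refine Approx.of_cover (ι := (Fin 3 × L) ⊕ (L ⊕ L))
    (B := Sum.elim (fun l q => q.2 = (if l.1 = 0 then c l.2 q.1 else if l.1 = 1 then α l.2 q.1 else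
      β l.2 q.1)) (Sum.elim
      (fun l q => (α l q.1 < q.2 ∧ q.2 - α l q.1 ≤ (β l q.1 - α l q.1) / 2 ∧
        β l q.1 - α l q.1 ≤ 2 * K) ∧
        ∀ k, Tame p (α l q.1) (β l q.1) (fun i x => itd (g k) i (q.1, x)))
      (fun l q => (-β l q.1 < q.2 ∧ q.2 - -β l q.1 ≤ (-α l q.1 - -β l q.1) / 2 ∧
        -α l q.1 - -β l q.1 ≤ 2 * K) ∧
        ∀ k, Tame p (-β l q.1) (-α l q.1) (fun i x => (-1) ^ i * itd (g k) i (q.1, -x)))))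
    (g := Sum.elim (fun l => g) (Sum.elim (fun l k => itd (g k) 0)
      (fun l k q => (-1) ^ 0 * itd (g k) 0 (q.1, -q.2)))) ?_ ?_
  · rintro (l | l | l)
    · exact approx_point p hg hb (c := fun e => if l.1 = 0 then c l.2 e else if l.1 = 1 then α l.2 e else
      β l.2 e) (by split_ifs; exacts [hc _, hα _, hβ _])
    · exact hLft l
    · exact hRgt l
  · intro e x hx
    obtain ⟨l, hl | hl⟩ := hc' e x
    · exact ⟨Sum.inl (0, l), x, hl, fun k => rfl⟩
    have hxI : I l e x := hl
    have hID : ∀ y, I l e y → D (e, y) := fun y hy =>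
      (iff_of_no_bdry (P := fun y => D (e, y)) (hIc l e).isPreconnected
        (fun z hz => (hz z left_mem_uIcc).1) hxI hy).1 hx
    have hA := hα' l e (Real.exists_isGLB ⟨x, hxI⟩ ⟨-K, fun y hy => (abs_le.1 (hDK e y (hID y hy))).1⟩)
    have hB := hβ' l e (Real.exists_isLUB ⟨x, hxI⟩ ⟨K, fun y hy => (abs_le.1 (hDK e y (hID y hy))).2⟩)
    have h1 : α l e ≤ x := hA.1 hxI
    have h2 : x ≤ β l e := hB.1 hxI
    have h3 : -K ≤ α l e := hA.2 fun y hy => (abs_le.1 (hDK e y (hID y hy))).1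
    have h4 : β l e ≤ K := hB.2 fun y hy => (abs_le.1 (hDK e y (hID y hy))).2
    rcases h1.eq_or_lt with h1 | h1
    · exact ⟨Sum.inl (1, l), x, h1.symm, fun k => rfl⟩
    rcases h2.eq_or_lt with h2 | h2
    · exact ⟨Sum.inl (2, l), x, h2, fun k => rfl⟩
    have hsub : ∀ y ∈ Ioo (α l e) (β l e), I l e y := by
      intro y hy
      obtain ⟨a, ha, -, hay⟩ := hA.exists_between hy.1
      obtain ⟨b, hb, hyb, -⟩ := hB.exists_between hy.2
      exact (hIc l e).out ha hb ⟨hay.le, hyb.le⟩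
    have hT : ∀ k, Tame p (α l e) (β l e) (fun i x => itd (g k) i (e, x)) := by
      intro k
      have hRg : ∀ u ∈ Ioo (α l e) (β l e), ∀ j < p + 2, Regular (itd (g k) j) (e, u) :=
        fun u hu j hj => (hsub u hu u left_mem_uIcc).2 k ⟨j, hj⟩
      refine ⟨fun u _ => hb k _, fun u hu => ?_, fun i hi u hu => ?_, fun i hi => ?_⟩
      · have hd : HasDerivAt (fun x => g k (e, x)) (itd (g k) 1 (e, u)) u :=
          (hRg u hu 0 (by omega)).1.hasDerivAt
        refine HasDerivAt.le_of_lip' hd zero_le_one ?_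
        filter_upwards [Ioo_mem_nhds hu.1 hu.2] with y hy
        rw [one_mul]
        exact hlip e y u (hID _ (hsub y hy)) (hID _ (hsub u hu)) k
      · exact (hRg u hu i (by omega)).1.hasDerivAt
      · exact Regular.monotoneOn (f := itd (g k) (i + 1)) ordConnected_Ioo
          fun u hu => hRg u hu (i + 1) (by omega)
    rcases le_total (x - α l e) ((β l e - α l e) / 2) with h5 | h5
    · exact ⟨Sum.inr (Sum.inl l), x, ⟨⟨h1, h5, by dsimp only; linarith⟩, hT⟩, fun k => rfl⟩
    · refine ⟨Sum.inr (Sum.inr l), -x, ⟨⟨?_, ?_, ?_⟩, fun k => (hT k).reflect⟩, fun k => ?_⟩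
      · dsimp only; linarith
      · dsimp only; linarith
      · dsimp only; linarith
      · simp [itd]

theorem approx_real (hS : S.IsOMinimal) {κ : Type} [Fintype κ] (p : ℕ) {f : κ → E × ℝ → ℝ}
    (hf : ∀ k, Df S (f k)) (hb : ∀ k q, |f k q| ≤ 1) :
    Approx S (p + 1) (fun _ => True) f := by
  obtain ⟨L, hL, D, ψ, K, hK, hD, hψ, hDK, hcov, hlip⟩ := exists_lipschitz_param hS hf hb
  have := Fintype.ofFinite L
  refine Approx.of_cover (ι := L) (B := D) (g := fun l k q => f k (q.1, ψ l q)) (fun l => ?_) ?_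
  · refine approx_of_lipschitz hS p (fun k => ?_) (fun k q => hb k _) (hD l) hK (hDK l)
      (fun e u u' h h' k => hlip l e u u' h h' k)
    have := hf k
    have := hψ l
    fun_prop
  · intro e x _
    obtain ⟨l, u, h1, h2⟩ := hcov e x
    exact ⟨l, u, h1, fun k => by rw [h2]⟩

end

end

section

open Set Filter Topology DSpace

theorem approx_pi {S : RealStructure} (hS : S.IsOMinimal) (p k : ℕ) :
    ∀ {E κ : Type} [DSpace E] [Fintype κ] {F : κ → E × (Fin k → ℝ) → ℝ}, (∀ a, Df S (F a)) →
      (∀ a q, |F a q| ≤ 1) →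
      ∃ (L : Type) (_ : Finite L) (J : Type) (_ : Fintype J) (C : ℝ)
        (Y : L → J → κ → E × (Fin k → ℝ) → ℝ), Fintype.card J = (p + 1) ^ k ∧ 0 < C ∧
        (∀ l j a, Df S (Y l j a)) ∧ (∀ l j a q, |Y l j a q| ≤ 1) ∧
        ∀ e x, ∀ m : ℕ, 1 ≤ m → ∃ l, ∃ q : Fin k → Fin m, ∃ w : J → ℝ, (∀ j, |w j| ≤ C) ∧
          ∀ a, |F a (e, x) - ∑ j, w j * Y l j a (e, fun i => ((q i : ℕ) + 1 / 2) / m)| ≤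
            C / m ^ (p + 1) := by
  induction k with
  | zero =>
    intro E κ _ _ F hF hb
    refine ⟨Unit, inferInstance, Unit, inferInstance, 1, fun _ _ => F, by simp, one_pos,
      fun _ _ => hF, fun _ _ => hb, fun e x m hm => ⟨(), fun i => i.elim0, 1, by simp, fun a => ?_⟩⟩
    have : x = fun i : Fin 0 => (((i.elim0 : Fin m) : ℕ) + 1 / 2 : ℝ) / m := by
      ext i; exact i.elim0
    rw [← this]
    simp
  | succ k ih =>
    intro E κ _ _ F hF hb
    obtain ⟨L, hL, J, hJ, C, Y, hcard, hC, hY, hY1, hY2⟩ := ih (E := E × ℝ) (κ := κ)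
      (F := fun a q => F a (q.1.1, ins 0 q.1.2 q.2)) (fun a => by have := hF a; fun_prop)
      (fun a q => hb a _)
    have h := fun l => approx_real hS (E := E × (Fin k → ℝ)) (κ := J × κ) p
      (f := fun a q => Y l a.1 a.2 ((q.1.1, q.2), q.1.2))
      (fun a => by have := hY l a.1 a.2; fun_prop) (fun a q => hY1 _ _ _ _)
    choose L₂ hL₂ C₂ Y₂ hC₂ hY₂ hY₂1 hY₂2 using h
    have := Fintype.ofFinite L
    have hCle : ∀ i, C₂ i ≤ ∑ i, C₂ i := fun i =>
      Finset.single_le_sum (f := C₂) (fun i _ => (hC₂ i).le) (Finset.mem_univ i)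
    have hCs : 0 ≤ ∑ i, C₂ i := Finset.sum_nonneg fun i _ => (hC₂ i).le
    refine ⟨Σ l, L₂ l, inferInstance, Fin (p + 1) × J, inferInstance,
      C + (Fintype.card J + 1) * C * ∑ i, C₂ i, fun l j a q =>
        Y₂ l.1 l.2 j.1 (j.2, a) ((q.1, fun i => q.2 i.succ), q.2 0), by simp [hcard, pow_succ, mul_comm],
      by positivity, fun l j a => ?_, fun l j a q => hY₂1 _ _ _ _ _, fun e x m hm => ?_⟩
    · have := hY₂ l.1 l.2 j.1 (j.2, a)
      fun_prop
    obtain ⟨l, q, w, hw, hw'⟩ := hY2 (e, x 0) (fun i => x i.succ) m hm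
    obtain ⟨l₂, q₂, w₂, hw₂, hw₂'⟩ := hY₂2 l (e, fun i => ((q i : ℕ) + 1 / 2) / m) (x 0) trivial m hm
    refine ⟨⟨l, l₂⟩, Fin.cons q₂ q, fun j => w j.2 * w₂ j.1, fun j => ?_, fun a => ?_⟩
    · rw [abs_mul]
      calc _ ≤ C * C₂ l := mul_le_mul (hw _) (hw₂ _) (abs_nonneg _) hC.le
        _ ≤ C * ∑ i, C₂ i := by have := hCle l; gcongr
        _ ≤ _ := by nlinarith [mul_nonneg (Nat.cast_nonneg (α := ℝ) (Fintype.card J)) (mul_nonneg hC.le hCs)]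
    · have h1 := hw' a
      have hx : ins 0 (x 0) (fun i => x i.succ) = x := ins_zero_self x
      simp only [hx] at h1
      simp only [Fin.cons_succ, Fin.cons_zero]
      set z : Fin k → ℝ := fun i => ((q i : ℕ) + 1 / 2) / m
      set t : ℝ := ((q₂ : ℕ) + 1 / 2) / m
      have h2 : |∑ j, w j * Y l j a ((e, x 0), z) -
          ∑ j : Fin (p + 1) × J, w j.2 * w₂ j.1 * Y₂ l l₂ j.1 (j.2, a) ((e, z), t)| ≤
          Fintype.card J * (C * (C₂ l / m ^ (p + 1))) := by
        rw [Fintype.sum_prod_type_right, ← Finset.sum_sub_distrib]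
        refine (Finset.abs_sum_le_sum_abs _ _).trans ?_
        rw [← nsmul_eq_mul]
        refine Finset.sum_le_card_nsmul _ _ _ fun j _ => ?_
        have h3 := hw₂' (j, a)
        have : w j * Y l j a ((e, x 0), z) - ∑ i, w j * w₂ i * Y₂ l l₂ i (j, a) ((e, z), t) =
            w j * (Y l j a ((e, x 0), z) - ∑ i, w₂ i * Y₂ l l₂ i (j, a) ((e, z), t)) := by
          rw [mul_sub, Finset.mul_sum]
          simp only [mul_assoc]
        rw [this, abs_mul]
        exact mul_le_mul (hw _) h3 (abs_nonneg _) hC.le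
      have h4 : C / (m : ℝ) ^ (p + 1) + Fintype.card J * (C * (C₂ l / m ^ (p + 1))) ≤
          (C + (Fintype.card J + 1) * C * ∑ i, C₂ i) / m ^ (p + 1) := by
        have h5 : C / (m : ℝ) ^ (p + 1) + Fintype.card J * (C * (C₂ l / m ^ (p + 1))) =
          (C + Fintype.card J * C * C₂ l) / m ^ (p + 1) := by ring
        rw [h5]
        refine div_le_div_of_nonneg_right ?_ (by positivity)
        have h6 := mul_le_mul_of_nonneg_left (hCle l)
          (mul_nonneg (Nat.cast_nonneg (α := ℝ) (Fintype.card J)) hC.le)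
        have h7 := mul_nonneg hC.le hCs
        linarith
      exact (abs_sub_le _ _ _).trans ((add_le_add h1 h2).trans h4)

end

section

open Set Filter Topology DSpace

theorem abs_det_le_of_approx {ι J : Type} [Fintype ι] [DecidableEq ι] [Fintype J] {C η : ℝ}
    (hC : 1 ≤ C) (hη : 0 ≤ η) (hη1 : η ≤ 1) {A : Matrix ι ι ℝ} {w : ι → J → ℝ} {Y : J → ι → ℝ}
    {ρ : ι → ι → ℝ} (hA : ∀ a u, A a u = ∑ j, w a j * Y j u + η * ρ a u)
    (hw : ∀ a j, |w a j| ≤ C) (hY : ∀ j u, |Y j u| ≤ 1) (hρ : ∀ a u, |ρ a u| ≤ C) :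
    |A.det| ≤ (Fintype.card J + 1) ^ Fintype.card ι * (C ^ Fintype.card ι *
      ((Fintype.card ι).factorial * C ^ Fintype.card ι)) *
      η ^ (Fintype.card ι - Fintype.card J) := by
  classical
  let c : ι → Option J → ℝ := fun a o => o.elim η (w a)
  let m : ι → Option J → ι → ℝ := fun a o => o.elim (ρ a) Y
  have h1 : A = fun a => ∑ o, c a o • m a o := by
    ext a u
    simp [Fintype.sum_option, c, m, hA, add_comm]
  have h2 : A.det = ∑ r : ι → Option J, (∏ a, c a (r a)) *
      Matrix.det (fun a => m a (r a)) := by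
    have := (Matrix.detRowAlternating (R := ℝ) (n := ι)).toMultilinearMap.map_sum
      (fun a o => c a o • m a o)
    rw [← h1] at this
    refine this.trans (Finset.sum_congr rfl fun r _ => ?_)
    exact (Matrix.detRowAlternating (R := ℝ) (n := ι)).toMultilinearMap.map_smul_univ
      (fun a => c a (r a)) (fun a => m a (r a))
  rw [h2]
  refine (Finset.abs_sum_le_sum_abs _ _).trans ((Finset.sum_le_card_nsmul _ _
    (C ^ Fintype.card ι * ((Fintype.card ι).factorial * C ^ Fintype.card ι) *
      η ^ (Fintype.card ι - Fintype.card J)) fun r _ => ?_).trans ?_)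
  · have hnn : 0 ≤ C ^ Fintype.card ι * ((Fintype.card ι).factorial * C ^ Fintype.card ι) *
      η ^ (Fintype.card ι - Fintype.card J) := by positivity
    rw [abs_mul]
    by_cases hz : Matrix.det (fun a => m a (r a)) = 0
    · rwa [hz, abs_zero, mul_zero]
    have hdet : |Matrix.det (fun a => m a (r a))| ≤
        (Fintype.card ι).factorial * C ^ Fintype.card ι := by
      have := Matrix.det_le (A := (fun a => m a (r a) : Matrix ι ι ℝ)) (abv := AbsoluteValue.abs)
        (x := C) (fun a u => by
          cases h : r a with
          | none => simpa [m, h] using hρ a u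
          | some j => simpa [m, h] using (hY j u).trans hC)
      simpa [nsmul_eq_mul] using this
    have hcard : Fintype.card ι - Fintype.card J ≤
        (Finset.univ.filter fun a => r a = none).card := by
      by_contra! hlt
      have hsplit := Finset.card_filter_add_card_filter_not (s := (Finset.univ : Finset ι))
        (fun a => r a = none)
      rw [Finset.card_univ] at hsplit
      obtain ⟨x, hx, y, hy, hxy, he⟩ := Finset.exists_ne_map_eq_of_card_lt_of_maps_to
        (s := Finset.univ.filter fun a => ¬ r a = none)
        (t := (Finset.univ : Finset J).image some) (f := r) (by
          rw [Finset.card_image_of_injective _ (Option.some_injective J), Finset.card_univ]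
          omega) (fun a ha => by
          simp only [Finset.coe_filter, Finset.mem_univ, true_and, mem_ofPred_eq] at ha
          obtain ⟨j, hj⟩ := Option.ne_none_iff_exists'.1 ha
          simp [hj])
      simp only [Finset.mem_filter, Finset.mem_univ, true_and] at hx
      obtain ⟨j, hj⟩ := Option.ne_none_iff_exists'.1 hx
      refine hz (Matrix.det_zero_of_row_eq hxy ?_)
      simp only [m, ← he, hj, Option.elim]
    have hprod : |∏ a, c a (r a)| ≤ C ^ Fintype.card ι *
        η ^ (Fintype.card ι - Fintype.card J) := by
      rw [Finset.abs_prod, ← Finset.prod_filter_mul_prod_filter_not _ (fun a => r a = none),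
        mul_comm]
      refine mul_le_mul ?_ ?_ (Finset.prod_nonneg fun _ _ => abs_nonneg _) (by positivity)
      · refine (Finset.prod_le_prod (g := fun _ => C) (fun _ _ => abs_nonneg _)
          fun a ha => ?_).trans ((Finset.prod_const C).trans_le
            (pow_le_pow_right₀ hC (Finset.card_le_univ _)))
        obtain ⟨j, hj⟩ := Option.ne_none_iff_exists'.1 (Finset.mem_filter.1 ha).2
        simpa [c, hj] using hw a j
      · rw [Finset.prod_congr rfl (g := fun _ => η) fun a ha => by
          simp [c, (Finset.mem_filter.1 ha).2, abs_of_nonneg hη], Finset.prod_const]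
        exact pow_le_pow_of_le_one hη hη1 hcard
    calc _ ≤ (C ^ Fintype.card ι * η ^ (Fintype.card ι - Fintype.card J)) *
        ((Fintype.card ι).factorial * C ^ Fintype.card ι) :=
          mul_le_mul hprod hdet (abs_nonneg _) (by positivity)
      _ = _ := by ring
  · rw [nsmul_eq_mul, Finset.card_univ, Fintype.card_fun, Fintype.card_option]
    push_cast
    rw [← mul_assoc]

theorem exists_annihilator {X ι : Type} [Fintype ι] [DecidableEq ι] {P : X → Prop} {v : X → ι → ℝ}
    (h : ∀ x : ι → X, (∀ a, P (x a)) → Matrix.det (fun a u => v (x a) u) = 0) :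
    ∃ c : ι → ℝ, c ≠ 0 ∧ ∀ x, P x → ∑ u, c u * v x u = 0 := by
  have hlt : Submodule.span ℝ (v '' {x | P x}) < ⊤ := by
    refine lt_top_iff_ne_top.2 fun htop => ?_
    obtain ⟨f, hf, -, hli⟩ := Submodule.exists_fun_fin_finrank_span_eq ℝ (v '' {x | P x})
    have hcard : Fintype.card ι = Module.finrank ℝ (Submodule.span ℝ (v '' {x | P x})) := by
      rw [htop, finrank_top, Module.finrank_fintype_fun_eq_card]
    choose g hg hg' using hf
    let e := Fintype.equivFinOfCardEq hcard
    have := h (fun a => g (e a)) fun a => hg _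
    simp only [hg'] at this
    have hli' : LinearIndependent ℝ (fun a => f (e a)) := hli.comp e e.injective
    have hu := (Matrix.linearIndependent_rows_iff_isUnit (A := (fun a u => f (e a) u :
      Matrix ι ι ℝ))).1 hli'
    exact ((Matrix.isUnit_iff_isUnit_det _).1 hu).ne_zero this
  obtain ⟨f, hf, hle⟩ := Submodule.exists_le_ker_of_lt_top _ hlt
  have hfe : ∀ z : ι → ℝ, f z = ∑ u, f (Pi.single u 1) * z u := fun z => by
    rw [f.pi_apply_eq_sum_univ z]
    exact Finset.sum_congr rfl fun u _ => by rw [smul_eq_mul, mul_comm]; congr 2; ext; simp [Pi.single_apply, eq_comm]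
  refine ⟨fun u => f (Pi.single u 1), fun h0 => hf ?_, fun x hx => ?_⟩
  · ext u
    simpa using congrFun h0 u
  · rw [← hfe]
    exact hle (Submodule.subset_span ⟨x, hx, rfl⟩)

theorem det_eq_zero_of_int {ι : Type} [Fintype ι] [DecidableEq ι] {A : Matrix ι ι ℝ} {s : ι → ℝ}
    {B : ℝ} (hs : ∀ a, 0 < s a) (hsB : ∀ a, s a ≤ B) (hz : ∀ a u, ∃ z : ℤ, s a * A a u = z)
    (hlt : |A.det| * B ^ Fintype.card ι < 1) : A.det = 0 := by
  choose z hz using hz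
  have h1 : (∏ a, s a) * A.det = ((Matrix.of z).det : ℤ) := by
    rw [← Matrix.det_mul_column]
    refine Eq.trans ?_ ((Int.castRingHom ℝ).map_det (Matrix.of z)).symm
    congr 1
    ext a u
    exact hz a u
  have hpos : 0 < ∏ a, s a := Finset.prod_pos fun a _ => hs a
  have hle : ∏ a, s a ≤ B ^ Fintype.card ι := by
    refine (Finset.prod_le_prod (fun a _ => (hs a).le) fun a _ => hsB a).trans_eq ?_
    rw [Finset.prod_const, Finset.card_univ]
  have h2 : |(((Matrix.of z).det : ℤ) : ℝ)| < 1 := by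
    rw [← h1, abs_mul, abs_of_pos hpos, mul_comm]
    exact (mul_le_mul_of_nonneg_left hle (abs_nonneg _)).trans_lt hlt
  have h3 : (Matrix.of z).det = 0 := by
    rw [← Int.abs_lt_one_iff]
    exact_mod_cast h2
  rw [h3, Int.cast_zero] at h1
  exact (mul_eq_zero.1 h1).resolve_left hpos.ne'

end

section

open Set Filter Topology DSpace

/-- `x` is a rational number of height at most `T`. -/
def RatLe (T x : ℝ) : Prop := ∃ q : ℚ, (q : ℝ) = x ∧ ratH q ≤ T

/-- Normalized monomials. -/
noncomputable def nmon {n : ℕ} (d : ℕ) (c : Fin n → ℝ) (u : Fin n → Fin (d + 1)) : ℝ :=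
  ∏ i, ((c i * (max 1 |c i|)⁻¹) ^ (u i : ℕ) * ((max 1 |c i|)⁻¹) ^ (d - (u i : ℕ)))

theorem abs_nmon_le {n d : ℕ} (c : Fin n → ℝ) (u : Fin n → Fin (d + 1)) : |nmon d c u| ≤ 1 := by
  rw [nmon, Finset.abs_prod]
  refine Finset.prod_le_one (fun _ _ => abs_nonneg _) fun i _ => ?_
  have h0 : 0 < max 1 |c i| := lt_max_of_lt_left one_pos
  rw [abs_mul, abs_pow, abs_pow, abs_mul, abs_inv, abs_of_pos h0]
  refine mul_le_one₀ (pow_le_one₀ (by positivity) ?_) (by positivity) (pow_le_one₀ (by positivity) ?_)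
  · rw [← div_eq_mul_inv]
    exact div_le_one_of_le₀ (le_max_right _ _) h0.le
  · exact inv_le_one_of_one_le₀ (le_max_left _ _)

theorem nmon_eq {n d : ℕ} (c : Fin n → ℝ) (u : Fin n → Fin (d + 1)) :
    nmon d c u = (∏ i, c i ^ (u i : ℕ)) * ∏ i, ((max 1 |c i|)⁻¹) ^ d := by
  rw [nmon, ← Finset.prod_mul_distrib]
  refine Finset.prod_congr rfl fun i _ => ?_
  rw [mul_pow, mul_assoc, ← pow_add]
  congr 2
  have := (u i).2
  omega

theorem RatLe.exists_int {T x : ℝ} (h : RatLe T x) : ∃ H : ℝ, 0 < H ∧ H ≤ T ∧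
    (∃ z : ℤ, H * (x * (max 1 |x|)⁻¹) = z) ∧ ∃ z : ℤ, H * (max 1 |x|)⁻¹ = z := by
  obtain ⟨q, rfl, hq⟩ := h
  have hd : (0 : ℝ) < q.den := by exact_mod_cast q.den_pos
  have hx : (q : ℝ) = q.num / q.den := by exact_mod_cast (Rat.num_div_den q).symm
  have hH : 0 < ratH q := lt_max_of_lt_right hd
  have hm : max 1 |(q : ℝ)| = ratH q / q.den := by
    rw [ratH, max_comm, eq_div_iff hd.ne', max_mul_of_nonneg _ _ hd.le, one_mul, hx, abs_div,
      abs_of_pos hd, div_mul_cancel₀ _ hd.ne']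
  refine ⟨ratH q, hH, hq, ⟨q.num, ?_⟩, ⟨q.den, ?_⟩⟩
  · rw [hm, hx]; field_simp
  · rw [hm]; field_simp; norm_cast

theorem RatLe.exists_scale {n d : ℕ} {T : ℝ} {c : Fin n → ℝ} (h : ∀ i, RatLe T (c i)) :
    ∃ s : ℝ, 0 < s ∧ s ≤ T ^ (n * d) ∧ ∀ u : Fin n → Fin (d + 1), ∃ z : ℤ, s * nmon d c u = z := by
  choose H hH hHT hz hz' using fun i => (h i).exists_int
  choose z hz using hz
  choose z' hz' using hz'
  refine ⟨∏ i, H i ^ d, Finset.prod_pos fun i _ => pow_pos (hH i) _, ?_, fun u =>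
    ⟨∏ i, (z i ^ (u i : ℕ) * z' i ^ (d - (u i : ℕ))), ?_⟩⟩
  · refine (Finset.prod_le_prod (g := fun _ => T ^ d) (fun i _ => (pow_pos (hH i) _).le)
      fun i _ => pow_le_pow_left₀ (hH i).le (hHT i) _).trans_eq ?_
    simp [← pow_mul, mul_comm]
  · rw [nmon, ← Finset.prod_mul_distrib]
    push_cast
    refine Finset.prod_congr rfl fun i _ => ?_
    rw [← hz, ← hz', mul_pow, mul_pow]
    have : H i ^ d = H i ^ (u i : ℕ) * H i ^ (d - (u i : ℕ)) := by
      rw [← pow_add]; congr 1; have := (u i).2; omega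
    rw [this]; ring

theorem small_det {K T m θ : ℝ} {n d r D R : ℕ} (hK : 1 ≤ K) (hT : 1 ≤ T) (hr : 1 ≤ r)
    (hθ : θ * r = 2 * (n * d : ℕ)) (hm : K ^ 2 * T ^ θ < m) (hD : 2 * R ≤ D) (hR : 1 ≤ R) :
    K * (1 / m ^ r) ^ (D - R) * (T ^ (n * d)) ^ D < 1 := by
  have hT0 : 0 < T := by linarith
  have hm0 : 0 < m := lt_trans (by positivity) hm
  set Q := K * T ^ (n * d)
  have hTp : 1 ≤ T ^ (n * d) := one_le_pow₀ hT
  have hQ : 1 ≤ Q := one_le_mul_of_one_le_of_one_le hK hTp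
  have h1 : Q ^ 2 < m ^ r := by
    calc Q ^ 2 = K ^ 2 * (T ^ θ) ^ r := by
          rw [mul_pow, ← Real.rpow_natCast (T ^ θ), ← Real.rpow_mul hT0.le, hθ, ← pow_mul]
          congr 1
          rw [← Real.rpow_natCast]
          congr 1
          push_cast; ring
      _ ≤ (K ^ 2) ^ r * (T ^ θ) ^ r := by
          have := le_self_pow₀ (one_le_pow₀ hK (n := 2)) (by omega : r ≠ 0)
          gcongr
      _ = (K ^ 2 * T ^ θ) ^ r := (mul_pow _ _ _).symm
      _ < m ^ r := by
          refine pow_lt_pow_left₀ hm (by positivity) (by omega)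
  have h2 : (Q ^ 2) ^ (D - R) < (m ^ r) ^ (D - R) :=
    pow_lt_pow_left₀ h1 (by positivity) (by omega)
  have h3 : K * (T ^ (n * d)) ^ D ≤ (Q ^ 2) ^ (D - R) := by
    calc K * (T ^ (n * d)) ^ D ≤ K ^ D * (T ^ (n * d)) ^ D := by
          have := le_self_pow₀ hK (by omega : D ≠ 0)
          gcongr
      _ = Q ^ D := (mul_pow _ _ _).symm
      _ ≤ Q ^ (2 * (D - R)) := pow_le_pow_right₀ hQ (by omega)
      _ = _ := pow_mul _ _ _
  rw [one_div, inv_pow, mul_right_comm, ← div_eq_mul_inv, div_lt_one (by positivity)]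
  exact h3.trans_lt h2

theorem exists_poly_cover {S : RealStructure} (hS : S.IsOMinimal) (k n : ℕ) {E : Type} [DSpace E]
    {Φ : Fin n → E × (Fin k → ℝ) → ℝ} (hΦ : ∀ j, Df S (Φ j)) {ε : ℝ} (hε : 0 < ε) :
    ∃ (d : ℕ) (c : ℝ), 0 < c ∧ ∀ e T, 1 ≤ T →
      ∃ (I : Type) (_ : Fintype I) (h : I → Fin n → (Fin (k + 1) → Fin (d + 1)) → ℝ),
        (Fintype.card I : ℝ) ≤ c * T ^ ε ∧ (∀ i j, h i j ≠ 0) ∧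
        ∀ x, (∀ i, RatLe T (x i)) → (∀ j, RatLe T (Φ j (e, x))) →
          ∃ i, ∀ j, ∑ u, h i j u * ∏ l, ins 0 (Φ j (e, x)) x l ^ (u l : ℕ) = 0 := by
  classical
  obtain ⟨s, hs⟩ := exists_nat_gt (4 * k * (k + 1) / ε)
  have hs0 : 0 < s := by
    have : (0 : ℝ) < s := lt_of_le_of_lt (by positivity) hs
    exact_mod_cast this
  have hsε : 4 * k * (k + 1) ≤ ε * s := by
    rw [div_lt_iff₀ hε] at hs; linarith
  set r := s ^ (k + 1) with hr
  have hr0 : 0 < r := pow_pos hs0 _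
  obtain ⟨p, hp⟩ : ∃ p, r = p + 1 := ⟨r - 1, by omega⟩
  obtain ⟨d, hd⟩ : ∃ d, 2 * s ^ k = d + 1 := ⟨2 * s ^ k - 1, by have := pow_pos hs0 k; omega⟩
  obtain ⟨L, hL, J, hJ, C, Y, hcard, hC, hY, hY1, hY2⟩ := approx_pi hS p k
    (κ := Fin n × (Fin (k + 1) → Fin (d + 1)))
    (F := fun a q => nmon d (ins 0 (Φ a.1 q) q.2) a.2) (fun a => by
      have := hΦ a.1
      unfold nmon
      fun_prop) (fun a q => abs_nmon_le _ _)
  have := Fintype.ofFinite L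
  set D := Fintype.card (Fin (k + 1) → Fin (d + 1)) with hDdef
  have hD : D = (2 * s ^ k) ^ (k + 1) := by simp [hDdef, hd]
  have hDR : 2 * Fintype.card J ≤ D := by
    rw [hcard, hD, ← hp, hr, mul_pow, pow_succ 2, ← pow_mul, ← pow_mul, mul_comm (k + 1)]
    have := Nat.one_le_two_pow (n := k)
    exact Nat.mul_le_mul_right _ (by omega)
  have hJ1 : 1 ≤ Fintype.card J := by rw [hcard]; exact Nat.one_le_pow _ _ (by omega)
  set C' := max 1 C
  set K : ℝ := (Fintype.card J + 1) ^ D * (C' ^ D * (D.factorial * C' ^ D)) with hKdef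
  have hC' : 1 ≤ C' := le_max_left _ _
  have hK : 1 ≤ K := by
    refine one_le_mul_of_one_le_of_one_le (one_le_pow₀ (by simp)) ?_
    refine one_le_mul_of_one_le_of_one_le (one_le_pow₀ hC') ?_
    exact one_le_mul_of_one_le_of_one_le (by exact_mod_cast D.factorial_pos) (one_le_pow₀ hC')
  set θ : ℝ := 2 * ((k + 1) * d : ℕ) / r with hθ
  have hr0' : (0 : ℝ) < r := by exact_mod_cast hr0
  have hθk : θ * k ≤ ε := by
    have h1 : (d : ℝ) ≤ 2 * s ^ k := by
      have : (2 * s ^ k : ℝ) = d + 1 := by exact_mod_cast hd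
      linarith
    rw [hθ, div_mul_eq_mul_div, div_le_iff₀ hr0', hr]
    push_cast
    calc 2 * (((k : ℝ) + 1) * d) * k ≤ 2 * (((k : ℝ) + 1) * (2 * s ^ k)) * k := by gcongr
      _ = (4 * k * (k + 1)) * s ^ k := by ring
      _ ≤ (ε * s) * s ^ k := by gcongr
      _ = _ := by ring
  refine ⟨d, Fintype.card L * (2 * K ^ 2) ^ k + 1, by positivity, fun e T hT => ?_⟩
  have hT0 : 0 < T := by linarith
  have hθ0 : 0 ≤ θ := by positivity
  have hT1 : 1 ≤ T ^ θ := Real.one_le_rpow hT hθ0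
  have hX1 : 1 ≤ K ^ 2 * T ^ θ := one_le_mul_of_one_le_of_one_le (one_le_pow₀ hK) hT1
  set m := ⌊K ^ 2 * T ^ θ⌋₊ + 1 with hm
  have hm1 : K ^ 2 * T ^ θ < m := by rw [hm]; push_cast; exact Nat.lt_floor_add_one _
  have hm2 : (m : ℝ) ≤ 2 * K ^ 2 * T ^ θ := by
    rw [hm]; push_cast
    have := Nat.floor_le (a := K ^ 2 * T ^ θ) (by positivity)
    linarith
  have hm0 : (1 : ℝ) ≤ m := hX1.trans hm1.le
  let P : L × (Fin k → Fin m) → (Fin k → ℝ) → Prop := fun i x => (∀ l, RatLe T (x l)) ∧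
    (∀ j, RatLe T (Φ j (e, x))) ∧ ∃ w : J → ℝ, (∀ j, |w j| ≤ C) ∧
      ∀ a : Fin n × (Fin (k + 1) → Fin (d + 1)), |nmon d (ins 0 (Φ a.1 (e, x)) x) a.2 -
        ∑ j, w j * Y i.1 j a (e, fun l => ((i.2 l : ℕ) + 1 / 2) / m)| ≤ C / m ^ (p + 1)
  have key : ∀ i j, ∃ h : (Fin (k + 1) → Fin (d + 1)) → ℝ, h ≠ 0 ∧ ∀ x, P i x →
      ∑ u, h u * nmon d (ins 0 (Φ j (e, x)) x) u = 0 := by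
    intro i j
    refine exists_annihilator fun x hx => ?_
    choose hx1 hx2 w hw hw' using hx
    have hsc : ∀ a l, RatLe T (ins 0 (Φ j (e, x a)) (x a) l) := fun a l => by
      refine Fin.cases ?_ (fun l => ?_) l
      · rw [ins_same]; exact hx2 a j
      · rw [ins_zero_succ]; exact hx1 a l
    choose σ hσ hσT hσz using fun a => RatLe.exists_scale (d := d) (hsc a)
    refine det_eq_zero_of_int hσ hσT hσz ?_
    have hb := abs_det_le_of_approx (η := 1 / (m : ℝ) ^ r) hC' (by positivity)
      (by rw [div_le_one (by positivity)]; exact one_le_pow₀ hm0)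
      (A := fun a u => nmon d (ins 0 (Φ j (e, x a)) (x a)) u) (w := w)
      (Y := fun l u => Y i.1 l (j, u) (e, fun l => ((i.2 l : ℕ) + 1 / 2) / m))
      (ρ := fun a u => (m : ℝ) ^ r * (nmon d (ins 0 (Φ j (e, x a)) (x a)) u -
        ∑ l, w a l * Y i.1 l (j, u) (e, fun l => ((i.2 l : ℕ) + 1 / 2) / m)))
      (fun a u => by
        rw [one_div_mul_eq_div, mul_div_cancel_left₀ _ (by positivity), add_sub_cancel]) (fun a l => (hw a l).trans (le_max_right _ _))
      (fun l u => hY1 _ _ _ _) (fun a u => by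
        have h1 := hw' a (j, u)
        rw [← hp, le_div_iff₀ (by positivity)] at h1
        rw [abs_mul, abs_of_nonneg (by positivity), mul_comm]
        exact h1.trans (le_max_right _ _))
    refine (mul_le_mul_of_nonneg_right hb (by positivity)).trans_lt ?_
    exact small_det hK hT hr0 (by rw [hθ]; field_simp) hm1 hDR hJ1
  choose h hne hh using key
  refine ⟨L × (Fin k → Fin m), inferInstance, h, ?_, hne, fun x hx hx' => ?_⟩
  · have h1 : (m : ℝ) ^ k ≤ (2 * K ^ 2) ^ k * T ^ ε := by
      calc (m : ℝ) ^ k ≤ (2 * K ^ 2 * T ^ θ) ^ k := by gcongr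
        _ = (2 * K ^ 2) ^ k * T ^ (θ * k) := by
          rw [mul_pow, Real.rpow_mul hT0.le, Real.rpow_natCast]
        _ ≤ _ := by
          have := Real.rpow_le_rpow_of_exponent_le hT hθk
          gcongr
    have h2 : 0 ≤ T ^ ε := by positivity
    simp only [Fintype.card_prod, Fintype.card_fun, Fintype.card_fin]
    push_cast
    calc _ ≤ (Fintype.card L : ℝ) * ((2 * K ^ 2) ^ k * T ^ ε) := by gcongr
      _ ≤ _ := by linarith
  · obtain ⟨l, q, w, hw, hw'⟩ := hY2 e x m (by omega)
    refine ⟨(l, q), fun j => ?_⟩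
    have h1 := hh (l, q) j x ⟨hx, hx', w, hw, hw'⟩
    simp only [nmon_eq, ← mul_assoc] at h1
    rw [← Finset.sum_mul] at h1
    refine (mul_eq_zero.1 h1).resolve_right (Finset.prod_pos fun l _ => ?_).ne'
    have : 0 < max 1 |ins 0 (Φ j (e, x)) x l| := lt_max_of_lt_left one_pos
    positivity

end

section

open Set Filter Topology DSpace

/-- The restriction of a polynomial in two variables to a vertical line. -/
noncomputable def slice (s : ℝ) : MvPolynomial (Fin 2) ℝ →ₐ[ℝ] Polynomial ℝ :=
  MvPolynomial.aeval ![Polynomial.C s, Polynomial.X]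

theorem eval_slice (s y : ℝ) (Q : MvPolynomial (Fin 2) ℝ) :
    (slice s Q).eval y = MvPolynomial.eval ![s, y] Q := by
  induction Q using MvPolynomial.induction_on with
  | C a => simp [slice]
  | add p q hp hq => simp [hp, hq]
  | mul_X p i hp =>
    rw [map_mul, Polynomial.eval_mul, hp, map_mul]
    congr 1
    fin_cases i <;> simp [slice]

theorem derivative_slice (s : ℝ) (Q : MvPolynomial (Fin 2) ℝ) :
    Polynomial.derivative (slice s Q) = slice s (MvPolynomial.pderiv 1 Q) := by
  induction Q using MvPolynomial.induction_on with
  | C a => simp [slice]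
  | add p q hp hq => simp [hp, hq]
  | mul_X p i hp =>
    rw [map_mul, Polynomial.derivative_mul, hp, MvPolynomial.pderiv_mul, map_add, map_mul, map_mul]
    congr 2
    fin_cases i <;> simp [slice, MvPolynomial.pderiv_X]

theorem iterate_derivative_slice (s : ℝ) (Q : MvPolynomial (Fin 2) ℝ) (n : ℕ) :
    Polynomial.derivative^[n] (slice s Q) = slice s ((MvPolynomial.pderiv 1)^[n] Q) := by
  induction n with
  | zero => rfl
  | succ n ih => rw [Function.iterate_succ_apply', Function.iterate_succ_apply', ih, derivative_slice]

theorem hasDerivAt_slice (s y : ℝ) (Q : MvPolynomial (Fin 2) ℝ) :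
    HasDerivAt (fun y => MvPolynomial.eval ![s, y] Q)
      (MvPolynomial.eval ![s, y] (MvPolynomial.pderiv 1 Q)) y := by
  have := (slice s Q).hasDerivAt y
  simpa only [derivative_slice, eval_slice] using this

theorem analyticAt_eval₂ (Q : MvPolynomial (Fin 2) ℝ) (p : ℝ × ℝ) :
    AnalyticAt ℝ (fun p : ℝ × ℝ => MvPolynomial.eval ![p.1, p.2] Q) p := by
  induction Q using MvPolynomial.induction_on with
  | C a => simpa using analyticAt_const
  | add p q hp hq =>
    simp only [map_add]
    exact hp.add hq
  | mul_X q i hp =>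
    simp only [map_mul, MvPolynomial.eval_X]
    refine hp.mul ?_
    fin_cases i
    · exact analyticAt_fst
    · exact analyticAt_snd

/-- Local structure of the zero set of a polynomial at a point that is regular in the vertical
direction. -/
theorem exists_box_of_pderiv_ne_zero {Q : MvPolynomial (Fin 2) ℝ} {s₀ y₀ : ℝ}
    (h0 : MvPolynomial.eval ![s₀, y₀] Q = 0)
    (h1 : MvPolynomial.eval ![s₀, y₀] (MvPolynomial.pderiv 1 Q) ≠ 0) :
    ∃ φ : ℝ → ℝ, AnalyticAt ℝ φ s₀ ∧
      ∀ᶠ v : ℝ × ℝ in 𝓝 (s₀, y₀), MvPolynomial.eval ![v.1, v.2] Q = 0 ↔ φ v.1 = v.2 := by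
  set f : ℝ × ℝ → ℝ := fun p => MvPolynomial.eval ![p.1, p.2] Q with hf
  have hA : AnalyticAt ℝ f (s₀, y₀) := analyticAt_eval₂ Q _
  have hcd : ContDiffAt ℝ ⊤ f (s₀, y₀) := hA.contDiffAt
  have hd : HasFDerivAt f (fderiv ℝ f (s₀, y₀)) (s₀, y₀) := hA.differentiableAt.hasFDerivAt
  have hval : fderiv ℝ f (s₀, y₀) (0, 1) =
      MvPolynomial.eval ![s₀, y₀] (MvPolynomial.pderiv 1 Q) := by
    have h2 : HasDerivAt (fun y : ℝ => (s₀, y)) ((0 : ℝ), (1 : ℝ)) y₀ :=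
      (hasDerivAt_const y₀ s₀).prodMk (hasDerivAt_id y₀)
    have h3 : HasFDerivAt f (fderiv ℝ f (s₀, y₀)) ((fun y : ℝ => (s₀, y)) y₀) := hd
    exact (h3.comp_hasDerivAt y₀ h2).unique (hasDerivAt_slice s₀ y₀ Q)
  have hinv : (fderiv ℝ f (s₀, y₀) ∘L .inr ℝ ℝ ℝ).IsInvertible := by
    refine ⟨ContinuousLinearEquiv.unitsEquivAut ℝ (Units.mk0 _ (hval ▸ h1)), ?_⟩
    ext
    simp
  refine ⟨hcd.implicitFunction (by simp) hinv, ?_, ?_⟩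
  · exact (hcd.contDiffAt_implicitFunction (by simp) hinv).analyticAt
  · have := hcd.eventually_apply_eq_iff_implicitFunction (by simp) hinv
    have h4 : f (s₀, y₀) = 0 := h0
    simpa only [h4] using this

/-- `γ` is analytic and semialgebraic on a neighbourhood of `[a, b]`. -/
def NiceOn (γ : ℝ → ℝ) (a b : ℝ) : Prop :=
  AnalyticOnNhd ℝ γ (Icc a b) ∧
    IsSemialgebraic {p : Fin 2 → ℝ | (a ≤ p 0 ∧ p 0 ≤ b) ∧ p 1 = γ (p 0)}

theorem isSemialgebraic_le {k : ℕ} (p q : MvPolynomial (Fin k) ℝ) :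
    IsSemialgebraic {x | MvPolynomial.eval x p ≤ MvPolynomial.eval x q} := by
  convert (IsSemialgebraic.pos_set (p - q)).compl using 1
  ext x
  simp

theorem isSemialgebraic_strip {k : ℕ} (i : Fin k) (a b : ℝ) :
    IsSemialgebraic {p : Fin k → ℝ | a ≤ p i ∧ p i ≤ b} := by
  have h1 := isSemialgebraic_le (.C a) (.X i)
  have h2 := isSemialgebraic_le (.X i) (.C b)
  simp only [MvPolynomial.eval_C, MvPolynomial.eval_X] at h1 h2
  exact h1.inter h2

theorem NiceOn.mono {γ : ℝ → ℝ} {a b a' b' : ℝ} (h : NiceOn γ a b) (ha : a ≤ a') (hb : b' ≤ b) :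
    NiceOn γ a' b' := by
  refine ⟨h.1.mono (Icc_subset_Icc ha hb), ?_⟩
  convert h.2.inter (isSemialgebraic_strip (0 : Fin 2) a' b') using 1
  ext p
  simp only [mem_inter_iff, mem_ofPred_eq]
  constructor
  · rintro ⟨⟨h1, h2⟩, h3⟩
    exact ⟨⟨⟨ha.trans h1, h2.trans hb⟩, h3⟩, h1, h2⟩
  · rintro ⟨⟨-, h3⟩, h1, h2⟩
    exact ⟨⟨h1, h2⟩, h3⟩

theorem exists_niceOn {P : MvPolynomial (Fin 2) ℝ} {γ : ℝ → ℝ} {a b : ℝ} (hab : a < b)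
    (hγ : ∀ s ∈ Ioo a b, ContinuousAt γ s)
    (hP : ∀ s ∈ Ioo a b, MvPolynomial.eval ![s, γ s] P = 0)
    (hne : ∀ s ∈ Ioo a b, ∃ y, MvPolynomial.eval ![s, y] P ≠ 0) :
    ∃ a' b', a < a' ∧ a' < b' ∧ b' < b ∧ NiceOn γ a' b' := by
  classical
  have hex : ∃ l, ∃ s ∈ Ioo a b, MvPolynomial.eval ![s, γ s] ((MvPolynomial.pderiv 1)^[l] P) ≠ 0 := by
    obtain ⟨s, hs⟩ := nonempty_Ioo.2 hab
    by_contra! hcon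
    obtain ⟨y, hy⟩ := hne s hs
    have h0 : slice s P = 0 := by
      by_contra hne0
      have := Polynomial.lt_rootMultiplicity_of_isRoot_iterate_derivative (p := slice s P)
        (t := γ s) (n := (slice s P).natDegree) hne0 (fun m _ => by
          rw [Polynomial.IsRoot, iterate_derivative_slice, eval_slice]
          exact hcon m s hs)
      have h2 := (Polynomial.count_roots (slice s P) (a := γ s)).symm.trans_le
        ((Multiset.count_le_card _ _).trans (Polynomial.card_roots' _))
      omega
    apply hy
    rw [← eval_slice, h0, Polynomial.eval_zero]
  obtain ⟨s₀, hs₀, hl⟩ := Nat.find_spec hex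
  have hmin := fun {l} => Nat.find_min hex (m := l)
  obtain ⟨l, hl'⟩ : ∃ l, Nat.find hex = l + 1 := by
    refine ⟨Nat.find hex - 1, ?_⟩
    have : Nat.find hex ≠ 0 := fun h => by
      rw [h] at hl
      exact hl (hP s₀ hs₀)
    omega
  rw [hl', Function.iterate_succ_apply'] at hl
  set Q := (MvPolynomial.pderiv 1)^[l] P
  have hQ : ∀ s ∈ Ioo a b, MvPolynomial.eval ![s, γ s] Q = 0 := by
    have := hmin (l := l) (by omega)
    push Not at this
    exact this
  obtain ⟨φ, hφ, hev⟩ := exists_box_of_pderiv_ne_zero (hQ s₀ hs₀) hl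
  obtain ⟨U, hU, V, hV, hUV⟩ :=
    Filter.eventually_prod_iff.1 (nhds_prod_eq (x := s₀) (y := γ s₀) ▸ hev)
  obtain ⟨r, hr, hrV⟩ := Metric.eventually_nhds_iff.1 hV
  have h1 : ∀ᶠ s in 𝓝 s₀, dist (γ s) (γ s₀) < r / 2 :=
    Metric.continuousAt_iff'.1 (hγ s₀ hs₀) _ (by positivity)
  obtain ⟨r', hr', hr'U⟩ := Metric.eventually_nhds_iff.1
    ((h1.and (Ioo_mem_nhds hs₀.1 hs₀.2)).and (hU.and hφ.eventually_analyticAt))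
  have hnear : ∀ s, |s - s₀| < r' → (dist (γ s) (γ s₀) < r / 2 ∧ s ∈ Ioo a b) ∧
      U s ∧ AnalyticAt ℝ φ s := fun s hs => hr'U hs
  have heq : ∀ s, |s - s₀| < r' → φ s = γ s := fun s hs => by
    obtain ⟨⟨h2, h3⟩, h4, h5⟩ := hnear s hs
    exact (hUV h4 (hrV (h2.trans (by linarith)))).1 (hQ s h3)
  refine ⟨s₀ - r' / 2, s₀ + r' / 2, ?_, by linarith, ?_, fun s hs => ?_, ?_⟩
  · have := (hnear (s₀ - r' / 2) (by rw [abs_lt]; constructor <;> linarith)).1.2.1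
    exact this
  · exact (hnear (s₀ + r' / 2) (by rw [abs_lt]; constructor <;> linarith)).1.2.2
  · have hs' : |s - s₀| < r' := by rw [abs_lt]; constructor <;> linarith [hs.1, hs.2]
    refine (hnear s hs').2.2.congr ?_
    have : ∀ᶠ x in 𝓝 s, |x - s₀| < r' :=
      (continuous_abs.comp (continuous_id.sub continuous_const)).continuousAt.eventually_lt
        continuousAt_const hs'
    filter_upwards [this] with x hx using heq x hx
  · convert ((isSemialgebraic_strip (0 : Fin 2) (s₀ - r' / 2) (s₀ + r' / 2)).inter
      (isSemialgebraic_strip (1 : Fin 2) (γ s₀ - r / 2) (γ s₀ + r / 2))).inter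
      (IsSemialgebraic.zero_set Q) using 1
    ext p
    simp only [mem_inter_iff, mem_ofPred_eq, and_assoc]
    refine and_congr_right fun h2 => and_congr_right fun h3 => ?_
    have hs' : |p 0 - s₀| < r' := by rw [abs_lt]; constructor <;> linarith
    obtain ⟨⟨h4, h5⟩, h6, h7⟩ := hnear _ hs'
    have hp : p = ![p 0, p 1] := by ext i; fin_cases i <;> rfl
    rw [Real.dist_eq, abs_lt] at h4
    constructor
    · intro h8
      rw [hp, h8]
      refine ⟨?_, ?_, hQ _ h5⟩
      · simp only [Matrix.cons_val_one, Matrix.cons_val_fin_one]; linarith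
      · simp only [Matrix.cons_val_one, Matrix.cons_val_fin_one]; linarith
    · rintro ⟨h8, h9, h10⟩
      rw [hp] at h10
      rw [← heq _ hs']
      refine ((hUV h6 (hrV ?_)).1 h10).symm
      rw [Real.dist_eq, abs_lt]
      constructor <;> linarith

end

section

open Set Filter Topology DSpace

theorem IsSemialgebraic.comap_poly {k l : ℕ} (f : Fin k → MvPolynomial (Fin l) ℝ)
    {s : Set (Fin k → ℝ)} (hs : IsSemialgebraic s) :
    IsSemialgebraic {v : Fin l → ℝ | (fun i => MvPolynomial.eval v (f i)) ∈ s} := by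
  have key : ∀ (v : Fin l → ℝ) (p : MvPolynomial (Fin k) ℝ),
      MvPolynomial.eval v (MvPolynomial.bind₁ f p) =
        MvPolynomial.eval (fun i => MvPolynomial.eval v (f i)) p := fun v p => by
    induction p using MvPolynomial.induction_on with
    | C a => simp
    | add p q hp hq => simp [hp, hq]
    | mul_X p i hp => simp [hp]
  induction hs with
  | zero_set p => simpa only [key, mem_ofPred_eq] using IsSemialgebraic.zero_set (MvPolynomial.bind₁ f p)
  | pos_set p => simpa only [key, mem_ofPred_eq] using IsSemialgebraic.pos_set (MvPolynomial.bind₁ f p)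
  | union _ _ h1 h2 => exact h1.union h2
  | inter _ _ h1 h2 => exact h1.inter h2
  | compl _ h => exact h.compl

/-- Every continuous definable path in `Z` with semialgebraic and analytic first projection has
constant second projection. -/
def NoCurve (S : RealStructure) (M N : ℕ) (Z : Set (Fin (M + N) → ℝ)) : Prop :=
  ∀ δ : ℝ → (Fin (M + N) → ℝ),
    Set.MapsTo δ (Set.Icc 0 1) Z → ContinuousOn δ (Set.Icc 0 1) →
    {p : Fin (1 + (M + N)) → ℝ | ∃ t ∈ Set.Icc (0 : ℝ) 1,
      p = Fin.append (fun _ : Fin 1 => t) (δ t)} ∈ S.sets (1 + (M + N)) →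
    IsSemialgebraic {p : Fin (1 + M) → ℝ | ∃ t ∈ Set.Icc (0 : ℝ) 1,
      p = Fin.append (fun _ : Fin 1 => t) (fun i : Fin M => δ t (Fin.castAdd N i))} →
    AnalyticOnNhd ℝ (fun t => fun i : Fin M => δ t (Fin.castAdd N i)) (Set.Ioo 0 1) →
    ∀ t₁ ∈ Set.Icc (0 : ℝ) 1, ∀ t₂ ∈ Set.Icc (0 : ℝ) 1,
      (fun j : Fin N => δ t₁ (Fin.natAdd M j)) = fun j : Fin N => δ t₂ (Fin.natAdd M j)

theorem df_mem {S : RealStructure} {n : ℕ} {s : Set (Fin n → ℝ)} :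
    Df S (fun x : Fin n → ℝ => x ∈ s) ↔ s ∈ S.sets n := by
  rw [df_prop]
  unfold DSet
  have : (emb : (Fin n → ℝ) → _) '' {x | x ∈ s} = s := by
    ext v
    exact ⟨fun ⟨x, hx, h⟩ => h ▸ hx, fun h => ⟨v, h, rfl⟩⟩
  rw [this]; rfl

variable {S : RealStructure} {M N : ℕ} {Z : Set (Fin (M + N) → ℝ)}

theorem eq_append_iff {n : ℕ} {t : ℝ} {y : Fin n → ℝ} {p : Fin (1 + n) → ℝ} :
    p = Fin.append (fun _ : Fin 1 => t) y ↔
      t = p (Fin.castAdd n 0) ∧ ∀ j, p (Fin.natAdd 1 j) = y j := by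
  constructor
  · rintro rfl
    simp
  · rintro ⟨h1, h2⟩
    ext i
    refine Fin.addCases (fun i => ?_) (fun i => ?_) i
    · rw [Fin.append_left, Subsingleton.elim i 0, h1]
    · rw [Fin.append_right, h2]

theorem NoCurve.eq_of_niceOn (H : NoCurve S M N Z) {γ : ℝ → Fin (M + N) → ℝ} (hγ : Df S γ)
    {a b : ℝ} (hab : a < b) (hc : ContinuousOn γ (Icc a b)) (hZ : ∀ s ∈ Icc a b, γ s ∈ Z)
    (hn : ∀ j : Fin M, NiceOn (fun s => γ s (Fin.castAdd N j)) a b) {s s' : ℝ}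
    (hs : s ∈ Icc a b) (hs' : s' ∈ Icc a b) (i : Fin N) :
    γ s (Fin.natAdd M i) = γ s' (Fin.natAdd M i) := by
  have hb : 0 < b - a := sub_pos.2 hab
  have hmap : ∀ t ∈ Icc (0 : ℝ) 1, a + (b - a) * t ∈ Icc a b := fun t ht =>
    ⟨by nlinarith [ht.1], by nlinarith [ht.2]⟩
  have hgraph : Df S (fun p : Fin (1 + (M + N)) → ℝ => 0 ≤ p (Fin.castAdd _ 0) ∧
      p (Fin.castAdd _ 0) ≤ 1 ∧
      ∀ j, p (Fin.natAdd 1 j) = γ (a + (b - a) * p (Fin.castAdd _ 0)) j) := by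
    fun_prop
  have hsa : IsSemialgebraic {p : Fin (1 + M) → ℝ | ∃ t ∈ Set.Icc (0 : ℝ) 1,
      p = Fin.append (fun _ : Fin 1 => t)
        (fun i : Fin M => γ (a + (b - a) * t) (Fin.castAdd N i))} := by
    have h1 := isSemialgebraic_strip (Fin.castAdd M (0 : Fin 1)) 0 1
    have h2 : ∀ j : Fin M, IsSemialgebraic {p : Fin (1 + M) → ℝ |
        (a ≤ a + (b - a) * p (Fin.castAdd M 0) ∧ a + (b - a) * p (Fin.castAdd M 0) ≤ b) ∧
        p (Fin.natAdd 1 j) = γ (a + (b - a) * p (Fin.castAdd M 0)) (Fin.castAdd N j)} := by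
      intro j
      have h3 := (hn j).2
      have h4 := h3.comap_poly (l := 1 + M)
        ![.C a + .C (b - a) * .X (Fin.castAdd M 0), .X (Fin.natAdd 1 j)]
      simpa only [mem_ofPred_eq, Matrix.cons_val_zero,
        Matrix.cons_val_one, map_add, map_mul, MvPolynomial.eval_C, MvPolynomial.eval_X] using h4
    convert h1.inter (IsSemialgebraic.forall_fin h2) using 1
    ext p
    simp only [eq_append_iff, mem_ofPred_eq, mem_inter_iff]
    constructor
    · rintro ⟨t, ht, rfl, h⟩
      exact ⟨ht, fun j => ⟨hmap _ ht, h j⟩⟩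
    · rintro ⟨ht, h⟩
      exact ⟨_, ht, rfl, fun j => (h j).2⟩
  have h := H (fun t => γ (a + (b - a) * t)) (fun t ht => hZ _ (hmap t ht))
    (hc.comp (by fun_prop) hmap) ?_ hsa ?_ ((s - a) / (b - a)) ?_ ((s' - a) / (b - a)) ?_
  · have := congrFun h i
    simpa [mul_div_cancel₀ _ hb.ne'] using this
  · rw [← df_mem]
    convert hgraph using 2 with p
    simp only [mem_ofPred_eq, eq_append_iff]
    constructor
    · rintro ⟨t, ht, rfl, h⟩
      exact ⟨ht.1, ht.2, h⟩
    · rintro ⟨h1, h2, h⟩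
      exact ⟨_, ⟨h1, h2⟩, rfl, h⟩
  · intro t ht
    refine AnalyticAt.pi fun j => ?_
    have h1 := (hn j).1 _ (hmap t (Ioo_subset_Icc_self ht))
    exact h1.fun_comp (f := fun t : ℝ => a + (b - a) * t) (by fun_prop)
  · exact ⟨div_nonneg (by linarith [hs.1]) hb.le, (div_le_one hb).2 (by linarith [hs.2])⟩
  · exact ⟨div_nonneg (by linarith [hs'.1]) hb.le, (div_le_one hb).2 (by linarith [hs'.2])⟩

end

section

open Set Filter Topology DSpace

theorem countable_image_of_eventually_eq {X Y : Type*} [TopologicalSpace X]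
    [SecondCountableTopology X] {f : X → Y} {s : Set X}
    (h : ∀ x ∈ s, ∀ᶠ y in 𝓝 x, f y = f x) : (f '' s).Countable := by
  obtain ⟨t, -, htc, ht⟩ := TopologicalSpace.countable_cover_nhdsWithin (f := fun x => {y | f y = f x}) (s := s)
    fun x hx => mem_nhdsWithin_of_mem_nhds (h x hx)
  refine (htc.image f).mono ?_
  rintro _ ⟨x, hx, rfl⟩
  obtain ⟨y, hy, hxy⟩ := mem_iUnion₂.1 (ht hx)
  exact ⟨y, hy, Eq.symm hxy⟩

theorem exists_niceOn_forall {ι : Type*} {P : ι → MvPolynomial (Fin 2) ℝ} {γ : ι → ℝ → ℝ}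
    {a b : ℝ} (hab : a < b) (hγ : ∀ j, ∀ s ∈ Ioo a b, ContinuousAt (γ j) s)
    (hP : ∀ j, ∀ s ∈ Ioo a b, MvPolynomial.eval ![s, γ j s] (P j) = 0)
    (hne : ∀ j, ∀ s ∈ Ioo a b, ∃ y, MvPolynomial.eval ![s, y] (P j) ≠ 0) (J : Finset ι) :
    ∃ a' b', a < a' ∧ a' < b' ∧ b' < b ∧ ∀ j ∈ J, NiceOn (γ j) a' b' := by
  classical
  induction J using Finset.induction_on with
  | empty => exact ⟨a + (b - a) / 3, b - (b - a) / 3, by linarith, by linarith, by linarith, by simp⟩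
  | insert j J _ ih =>
    obtain ⟨a₁, b₁, h1, h2, h3, h4⟩ := ih
    have hsub : ∀ s ∈ Ioo a₁ b₁, s ∈ Ioo a b := fun s hs => ⟨h1.trans hs.1, hs.2.trans h3⟩
    obtain ⟨a₂, b₂, h5, h6, h7, h8⟩ := exists_niceOn h2 (fun s hs => hγ j s (hsub s hs))
      (fun s hs => hP j s (hsub s hs)) (fun s hs => hne j s (hsub s hs))
    refine ⟨a₂, b₂, h1.trans h5, h6, h7.trans h3, fun i hi => ?_⟩
    rcases Finset.mem_insert.1 hi with rfl | hi
    · exact h8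
    · exact (h4 i hi).mono h5.le h7.le

variable {S : RealStructure}

theorem eq_of_dense_eventually_eq (hS : S.IsOMinimal) {g : ℝ → ℝ} (hg : Df S g) {a b : ℝ}
    (hc : ∀ s ∈ Ioo a b, ContinuousAt g s)
    (h : ∀ a' b', a ≤ a' → a' < b' → b' ≤ b → ∃ s ∈ Ioo a' b', ∀ᶠ t in 𝓝 s, g t = g s)
    {s s' : ℝ} (hs : s ∈ Ioo a b) (hs' : s' ∈ Ioo a b) : g s = g s' := by
  have hE : Df S (fun s : ℝ => ∀ᶠ t in 𝓝 s, g t = g s) :=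
    (Df.eventually₁ (E := ℝ) (P := fun p => g p.2 = g p.1) (by fun_prop)).comp
      (f := fun s : ℝ => (s, s)) (by fun_prop)
  have hfin : {s | (a < s ∧ s < b) ∧ ¬ ∀ᶠ t in 𝓝 s, g t = g s}.Finite := by
    refine finite_of_no_interval hS (by fun_prop) fun a' b' hab' => ?_
    by_cases hlt : max a a' < min b b'
    · obtain ⟨s, hs, hs'⟩ := h (max a a') (min b b') (le_max_left _ _) hlt (min_le_left _ _)
      exact ⟨s, ⟨(le_max_right _ _).trans_lt hs.1, hs.2.trans_le (min_le_right _ _)⟩,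
        fun h' => h'.2 hs'⟩
    · obtain ⟨s, hs⟩ := nonempty_Ioo.2 hab'
      refine ⟨s, hs, fun h' => hlt ?_⟩
      exact (max_lt h'.1.1 hs.1).trans (lt_min h'.1.2 hs.2)
  have hcount : (g '' Ioo a b).Countable := by
    have h1 : (g '' {s | ∀ᶠ t in 𝓝 s, g t = g s}).Countable :=
      countable_image_of_eventually_eq fun x hx => hx
    refine (h1.union (hfin.image g).countable).mono ?_
    rintro _ ⟨x, hx, rfl⟩
    by_cases hx' : ∀ᶠ t in 𝓝 x, g t = g x
    · exact .inl ⟨x, hx', rfl⟩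
    · exact .inr ⟨x, ⟨hx, hx'⟩, rfl⟩
  have hpre : IsPreconnected (g '' Ioo a b) :=
    isPreconnected_Ioo.image g fun s hs => (hc s hs).continuousWithinAt
  exact hcount.isTotallyDisconnected _ subset_rfl hpre ⟨s, hs, rfl⟩ ⟨s', hs', rfl⟩

variable {M N : ℕ} {Z : Set (Fin (M + N) → ℝ)}

theorem NoCurve.eq_of_poly (hS : S.IsOMinimal) (H : NoCurve S M N Z) {γ : ℝ → Fin (M + N) → ℝ}
    (hγ : Df S γ) {a b : ℝ} (hc : ∀ s ∈ Ioo a b, ContinuousAt γ s) (hZ : ∀ s ∈ Ioo a b, γ s ∈ Z)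
    {P : Fin M → MvPolynomial (Fin 2) ℝ}
    (hP : ∀ j, ∀ s ∈ Ioo a b, MvPolynomial.eval ![s, γ s (Fin.castAdd N j)] (P j) = 0)
    (hne : ∀ j, ∀ s ∈ Ioo a b, ∃ y, MvPolynomial.eval ![s, y] (P j) ≠ 0) {s s' : ℝ}
    (hs : s ∈ Ioo a b) (hs' : s' ∈ Ioo a b) (i : Fin N) :
    γ s (Fin.natAdd M i) = γ s' (Fin.natAdd M i) := by
  refine eq_of_dense_eventually_eq hS (g := fun s => γ s (Fin.natAdd M i)) (by fun_prop)
    (fun s hs => continuousAt_pi.1 (hc s hs) _) (fun a' b' ha hab hb => ?_) hs hs'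
  have hsub : ∀ s ∈ Ioo a' b', s ∈ Ioo a b := fun s hs => ⟨ha.trans_lt hs.1, hs.2.trans_le hb⟩
  obtain ⟨a₂, b₂, h1, h2, h3, h4⟩ := exists_niceOn_forall (γ := fun j s => γ s (Fin.castAdd N j))
    hab (fun j s hs => continuousAt_pi.1 (hc s (hsub s hs)) _) (fun j s hs => hP j s (hsub s hs))
    (fun j s hs => hne j s (hsub s hs)) Finset.univ
  have hsub' : ∀ s ∈ Icc a₂ b₂, s ∈ Ioo a b :=
    fun s hs => hsub s ⟨h1.trans_le hs.1, hs.2.trans_lt h3⟩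
  have key := fun s s' hs hs' => H.eq_of_niceOn hγ h2
    (fun s hs => (hc s (hsub' s hs)).continuousWithinAt) (fun s hs => hZ s (hsub' s hs))
    (fun j => h4 j (Finset.mem_univ j)) (s := s) (s' := s') hs hs' i
  obtain ⟨s₀, hs₀⟩ := nonempty_Ioo.2 h2
  refine ⟨s₀, ⟨h1.trans hs₀.1, hs₀.2.trans h3⟩, ?_⟩
  filter_upwards [Ioo_mem_nhds hs₀.1 hs₀.2] with t ht
  exact key _ _ (Ioo_subset_Icc_self ht) (Ioo_subset_Icc_self hs₀)

end

section

open Set Filter Topology DSpace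

/-- Evaluation at `(y, x)` of the polynomial with coefficients `h`. -/
def polyAt {k d : ℕ} (h : (Fin (k + 1) → Fin (d + 1)) → ℝ) (x : Fin k → ℝ) (y : ℝ) : ℝ :=
  ∑ u, h u * ∏ l, ins 0 y x l ^ (u l : ℕ)

/-- The restriction of `polyAt h` to the plane through `(0, z)` in the directions of `y` and of the
coordinate `i`. -/
noncomputable def axisPoly {k d : ℕ} (h : (Fin (k + 1) → Fin (d + 1)) → ℝ) (z : Fin k → ℝ)
    (i : Fin k) : MvPolynomial (Fin 2) ℝ :=
  ∑ u, .C (h u) * ∏ l, (Fin.cons (.X 1) (Function.update (fun l => .C (z l)) i (.X 0)) :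
    Fin (k + 1) → MvPolynomial (Fin 2) ℝ) l ^ (u l : ℕ)

theorem eval_axisPoly {k d : ℕ} (h : (Fin (k + 1) → Fin (d + 1)) → ℝ) (z : Fin k → ℝ)
    (i : Fin k) (s y : ℝ) :
    MvPolynomial.eval ![s, y] (axisPoly h z i) = polyAt h (Function.update z i s) y := by
  have key : ∀ l, MvPolynomial.eval ![s, y] ((Fin.cons (.X 1)
      (Function.update (fun l => .C (z l)) i (.X 0)) : Fin (k + 1) → MvPolynomial (Fin 2) ℝ) l) =
      ins 0 y (Function.update z i s) l := fun l => by
    refine Fin.cases ?_ (fun l => ?_) l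
    · simp
    · rw [ins_zero_succ, Fin.cons_succ]
      by_cases hl : l = i
      · subst hl; simp
      · simp [hl]
  simp only [axisPoly, polyAt, map_sum, map_mul, map_prod, map_pow, MvPolynomial.eval_C, key]

variable {S : RealStructure} {M N : ℕ} {Z : Set (Fin (M + N) → ℝ)}

/-- The conditions on a point under which the polynomial relations `h` control `φ`. -/
def Good {k d : ℕ} (U : (Fin k → ℝ) → Prop) (φ : (Fin k → ℝ) → Fin (M + N) → ℝ)
    (h : Fin M → (Fin (k + 1) → Fin (d + 1)) → ℝ) (x : Fin k → ℝ) : Prop :=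
  U x ∧ (∀ j, polyAt (h j) x (φ x (Fin.castAdd N j)) = 0) ∧
    (∀ i, ContinuousAt (fun x => φ x i) x) ∧ ∀ j, ∃ y, polyAt (h j) x y ≠ 0

theorem NoCurve.eventually_eq_of_good (hS : S.IsOMinimal) (H : NoCurve S M N Z) {k d : ℕ}
    {U : (Fin k → ℝ) → Prop} {φ : (Fin k → ℝ) → Fin (M + N) → ℝ} (hφ : Df S φ)
    (hZ : ∀ x, U x → φ x ∈ Z) {h : Fin M → (Fin (k + 1) → Fin (d + 1)) → ℝ} {x : Fin k → ℝ}
    (hx : ∀ᶠ x' in 𝓝 x, Good U φ h x') (i : Fin N) :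
    ∀ᶠ x' in 𝓝 x, φ x' (Fin.natAdd M i) = φ x (Fin.natAdd M i) := by
  classical
  obtain ⟨r, hr, hball⟩ := Metric.eventually_nhds_iff_ball.1 hx
  simp only [ball_pi x hr, Real.ball_eq_Ioo, mem_univ_pi] at hball
  have haxis : ∀ (z : Fin k → ℝ) (l : Fin k) (t : ℝ), (∀ l, z l ∈ Ioo (x l - r) (x l + r)) →
      t ∈ Ioo (x l - r) (x l + r) →
      φ (Function.update z l t) (Fin.natAdd M i) = φ z (Fin.natAdd M i) := by
    intro z l t hz ht
    have hup : Df S (fun s : ℝ => Function.update z l s) := by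
      refine Df.pi fun m => ?_
      by_cases hm : m = l
      · subst hm; simp only [Function.update_self]; fun_prop
      · simp only [Function.update_of_ne hm]; fun_prop
    have hg : ∀ s ∈ Ioo (x l - r) (x l + r), Good U φ h (Function.update z l s) := by
      intro s hs
      refine hball _ fun m => ?_
      by_cases hm : m = l
      · subst hm; simpa using hs
      · rw [Function.update_of_ne hm]; exact hz m
    have hcu : ∀ s, ContinuousAt (fun s : ℝ => Function.update z l s) s := fun s =>
      (continuous_const.update l continuous_id).continuousAt
    have := H.eq_of_poly hS (γ := fun s => φ (Function.update z l s)) (by fun_prop)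
      (fun s hs => continuousAt_pi.2 fun i =>
        ContinuousAt.comp (f := fun s : ℝ => Function.update z l s) (g := fun x => φ x i)
          ((hg s hs).2.2.1 i) (hcu s))
      (fun s hs => hZ _ (hg s hs).1) (P := fun j => axisPoly (h j) z l)
      (fun j s hs => by rw [eval_axisPoly]; exact (hg s hs).2.1 j)
      (fun j s hs => by simp only [eval_axisPoly]; exact (hg s hs).2.2.2 j) ht (hz l) i
    simpa using this
  rw [Metric.eventually_nhds_iff_ball]
  refine ⟨r, hr, fun x' hx' => ?_⟩
  simp only [ball_pi x hr, Real.ball_eq_Ioo, mem_univ_pi] at hx'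
  have hind : ∀ J : Finset (Fin k), φ (J.piecewise x' x) (Fin.natAdd M i) =
      φ x (Fin.natAdd M i) := by
    intro J
    induction J using Finset.induction_on with
    | empty => simp
    | insert l J _ ih =>
      rw [Finset.piecewise_insert, haxis _ _ _ (fun m => ?_) (hx' l), ih]
      by_cases hm : m ∈ J
      · rw [Finset.piecewise_eq_of_mem _ _ _ hm]; exact hx' m
      · rw [Finset.piecewise_eq_of_notMem _ _ _ hm]; constructor <;> linarith
  simpa using hind Finset.univ

end

section

open Set Filter Topology DSpace

theorem eq_zero_of_polyAt {k d : ℕ} {h : (Fin (k + 1) → Fin (d + 1)) → ℝ} {V : Set (Fin k → ℝ)}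
    (hV : IsOpen V) (hne : V.Nonempty) (h0 : ∀ x ∈ V, ∀ y, polyAt h x y = 0) : h = 0 := by
  classical
  set m : (Fin (k + 1) → Fin (d + 1)) → Fin (k + 1) →₀ ℕ := fun u =>
    Finsupp.equivFunOnFinite.symm fun l => (u l : ℕ) with hm
  have hinj : Function.Injective m := fun u v huv => funext fun l => by
    have := DFunLike.congr_fun huv l
    exact Fin.ext (by simpa [hm] using this)
  set p : MvPolynomial (Fin (k + 1)) ℝ := ∑ u, MvPolynomial.monomial (m u) (h u) with hp
  have heval : ∀ v, MvPolynomial.eval v p = ∑ u, h u * ∏ l, v l ^ (u l : ℕ) := fun v => by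
    simp only [hp, map_sum, MvPolynomial.eval_monomial]
    refine Finset.sum_congr rfl fun u _ => ?_
    rw [Finsupp.prod_fintype _ _ (by simp)]
    simp [hm]
  obtain ⟨x, hx⟩ := hne
  obtain ⟨r, hr, hball⟩ := Metric.isOpen_iff.1 hV x hx
  rw [ball_pi x hr] at hball
  have hp0 : p = 0 := by
    refine MvPolynomial.funext_set
      (Fin.cons univ fun l => Ioo (x l - r) (x l + r) : Fin (k + 1) → Set ℝ) (fun i => ?_)
      fun v hv => ?_
    · refine Fin.cases ?_ (fun i => ?_) i
      · simpa using infinite_univ (α := ℝ)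
      · simpa using Ioo_infinite (by linarith)
    · have h1 := h0 (fun l => v l.succ) (hball fun l _ => by
        have := hv l.succ (mem_univ _)
        simpa [Real.ball_eq_Ioo] using this) (v 0)
      rw [polyAt, ins_zero_self] at h1
      rw [heval, h1, map_zero]
  funext u
  have h1 : MvPolynomial.coeff (m u) p = h u := by
    simp only [hp, MvPolynomial.coeff_sum, MvPolynomial.coeff_monomial, hinj.eq_iff]
    simp
  rw [← h1, hp0]; simp

theorem continuous_ins_zero {k : ℕ} (y : ℝ) : Continuous fun x : Fin k → ℝ => ins 0 y x := by
  refine continuous_pi fun l => ?_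
  refine Fin.cases ?_ (fun l => ?_) l
  · simpa using continuous_const
  · simpa using continuous_apply l

theorem continuous_polyAt {k d : ℕ} (h : (Fin (k + 1) → Fin (d + 1)) → ℝ) (y : ℝ) :
    Continuous fun x => polyAt h x y := by
  have := continuous_ins_zero (k := k) y
  unfold polyAt
  fun_prop

theorem isOpen_polyAt_ne {k d : ℕ} (h : (Fin (k + 1) → Fin (d + 1)) → ℝ) :
    IsOpen {x | ∃ y, polyAt h x y ≠ 0} := by
  simp only [ofPred_exists]
  exact isOpen_iUnion fun y => isOpen_ne_fun (continuous_polyAt h y) continuous_const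

theorem dense_polyAt_ne {k d : ℕ} {h : (Fin (k + 1) → Fin (d + 1)) → ℝ} (h0 : h ≠ 0) :
    Dense {x | ∃ y, polyAt h x y ≠ 0} := by
  refine dense_iff_inter_open.2 fun V hV hne => ?_
  by_contra hcon
  refine h0 (eq_zero_of_polyAt hV hne fun x hx y => ?_)
  by_contra hxy
  exact hcon ⟨x, hx, y, hxy⟩

variable {S : RealStructure} {M N : ℕ}

theorem exists_eventually_good (hS : S.IsOMinimal) {k d : ℕ} {U : (Fin k → ℝ) → Prop}
    {φ : (Fin k → ℝ) → Fin (M + N) → ℝ} (hφ : Df S φ)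
    {h : Fin M → (Fin (k + 1) → Fin (d + 1)) → ℝ} (h0 : ∀ j, h j ≠ 0) {W : Set (Fin k → ℝ)}
    (hW : IsOpen W) (hne : W.Nonempty) (hU : ∀ x ∈ W, U x)
    (hP : ∀ x ∈ W, ∀ j, polyAt (h j) x (φ x (Fin.castAdd N j)) = 0) :
    ∃ x ∈ W, ∀ᶠ x' in 𝓝 x, Good U φ h x' := by
  obtain ⟨V, hVW, hV, hVne, hcont⟩ := exists_open_continuousAt hS hφ hW hne
  have hD : Dense (⋂ j, {x | ∃ y, polyAt (h j) x y ≠ 0}) :=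
    dense_iInter_of_isOpen (fun j => isOpen_polyAt_ne (h j)) fun j => dense_polyAt_ne (h0 j)
  obtain ⟨x, hxV, hxD⟩ := dense_iff_inter_open.1 hD V hV hVne
  refine ⟨x, hVW hxV, ?_⟩
  filter_upwards [hV.mem_nhds hxV,
    (isOpen_iInter_of_finite fun j => isOpen_polyAt_ne (h j)).mem_nhds hxD] with x' h1 h2
  exact ⟨hU _ (hVW h1), hP _ (hVW h1), continuousAt_pi.1 (hcont x' h1), fun j => mem_iInter.1 h2 j⟩

end

section

open Set Filter Topology DSpace

/-- `s` is finite with at most `b` elements. -/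
def FinCard {α : Type*} (s : Set α) (b : ℝ) : Prop := s.Finite ∧ (s.ncard : ℝ) ≤ b

section
variable {α : Type*}

theorem FinCard.mono {s t : Set α} {b c : ℝ} (h : FinCard t b) (hst : s ⊆ t) (hbc : b ≤ c) :
    FinCard s c :=
  ⟨h.1.subset hst, le_trans (Nat.cast_le.2 (ncard_le_ncard hst h.1)) (h.2.trans hbc)⟩

theorem FinCard.union {s t : Set α} {b c : ℝ} (hs : FinCard s b) (ht : FinCard t c) :
    FinCard (s ∪ t) (b + c) :=
  ⟨hs.1.union ht.1, le_trans (by exact_mod_cast ncard_union_le s t) (add_le_add hs.2 ht.2)⟩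

theorem FinCard.biUnion {ι : Type*} {s : ι → Set α} {b : ι → ℝ} (J : Finset ι)
    (h : ∀ i, FinCard (s i) (b i)) : FinCard (⋃ i ∈ J, s i) (∑ i ∈ J, b i) := by
  classical
  induction J using Finset.induction_on with
  | empty => simp [FinCard]
  | insert i J hi ih =>
    rw [Finset.set_biUnion_insert, Finset.sum_insert hi]
    exact (h i).union ih

theorem FinCard.iUnion {ι : Type*} [Fintype ι] {s : ι → Set α} {b : ι → ℝ}
    (h : ∀ i, FinCard (s i) (b i)) : FinCard (⋃ i, s i) (∑ i, b i) := by
  simpa using FinCard.biUnion Finset.univ h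

theorem finCard_range {ι : Type*} [Fintype ι] (f : ι → α) :
    FinCard (range f) (Fintype.card ι) := by
  refine ⟨finite_range f, ?_⟩
  rw [← image_univ]
  have := ncard_image_le (f := f) (finite_univ (α := ι))
  rw [ncard_univ, Nat.card_eq_fintype_card] at this
  exact_mod_cast this
end

variable {S : RealStructure} {E : Type} [DSpace E]

theorem finite_of_countable (hS : S.IsOMinimal) {P : ℝ → Prop} (hP : Df S P)
    (h : {x | P x}.Countable) : {x | P x}.Finite := by
  refine finite_of_no_interval hS hP fun a b hab => ?_
  by_contra! hcon
  have : (Ioo a b).Countable := h.mono hcon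
  rw [Cardinal.Real.Ioo_countable_iff] at this
  linarith

variable {M N : ℕ} {Z : Set (Fin (M + N) → ℝ)}

theorem Df.good {k d : ℕ} {U : E × (Fin k → ℝ) → Prop} {Φ : E × (Fin k → ℝ) → Fin (M + N) → ℝ}
    (hU : Df S U) (hΦ : Df S Φ) {n : ℕ} (eq : Fin M × (Fin (k + 1) → Fin (d + 1)) → Fin n) :
    Df S (fun p : (E × (Fin n → ℝ)) × (Fin k → ℝ) => Good (fun x => U (p.1.1, x))
      (fun x => Φ (p.1.1, x)) (fun j u => p.1.2 (eq (j, u))) p.2) := by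
  have hc : ∀ i, Df S (fun p : (E × (Fin n → ℝ)) × (Fin k → ℝ) =>
      ContinuousAt (fun x => Φ (p.1.1, x) i) p.2) := fun i =>
    (Df.continuousAt (f := fun q => Φ q i) (by fun_prop)).comp
      (f := fun p : (E × (Fin n → ℝ)) × (Fin k → ℝ) => (p.1.1, p.2)) (by fun_prop)
  unfold Good polyAt
  fun_prop

end

section

open Set Filter Topology DSpace

variable {S : RealStructure} {M N : ℕ} {Z : Set (Fin (M + N) → ℝ)}

/-- The number of values of the second projection at points with rational first projection of
bounded height on the graph of `Φ` is uniformly bounded. -/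
def CountOn {E : Type} {k : ℕ} (U : E × (Fin k → ℝ) → Prop)
    (Φ : E × (Fin k → ℝ) → Fin (M + N) → ℝ) (ε : ℝ) : Prop :=
  ∃ c : ℝ, 0 ≤ c ∧ ∀ e T, 1 ≤ T →
    FinCard {w : Fin N → ℝ | ∃ x, U (e, x) ∧ (∀ j, RatLe T (Φ (e, x) (Fin.castAdd N j))) ∧
      w = fun i => Φ (e, x) (Fin.natAdd M i)} (c * T ^ ε)

theorem NoCurve.finCard_good (hS : S.IsOMinimal) (H : NoCurve S M N Z) {E : Type} [DSpace E]
    {k d n : ℕ} {U : E × (Fin k → ℝ) → Prop} {Φ : E × (Fin k → ℝ) → Fin (M + N) → ℝ}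
    (hU : Df S U) (hΦ : Df S Φ) (hZ : ∀ p, U p → Φ p ∈ Z)
    (eq : Fin M × (Fin (k + 1) → Fin (d + 1)) → Fin n) :
    ∃ m : ℕ, ∀ p : E × (Fin n → ℝ), FinCard {w : Fin N → ℝ | ∃ x,
      (∀ᶠ x' in 𝓝 x, Good (fun x => U (p.1, x)) (fun x => Φ (p.1, x))
        (fun j u => p.2 (eq (j, u))) x') ∧ w = fun i => Φ (p.1, x) (Fin.natAdd M i)} m := by
  have hG := (hU.good hΦ eq).eventually
  set G : (E × (Fin n → ℝ)) × (Fin k → ℝ) → Prop := fun p => ∀ᶠ x' in 𝓝 p.2,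
    Good (fun x => U (p.1.1, x)) (fun x => Φ (p.1.1, x)) (fun j u => p.1.2 (eq (j, u))) x'
    with hGdef
  have hA : ∀ i : Fin N, ∃ (m : ℕ) (b : Fin m → E × (Fin n → ℝ) → ℝ), (∀ i, Df S (b i)) ∧
      ∀ p t, (∃ x, G (p, x) ∧ t = Φ (p.1, x) (Fin.natAdd M i)) → ∃ l, t = b l p := by
    intro i
    have hB : Df S (fun q : (E × (Fin n → ℝ)) × ℝ =>
        ∃ x, G (q.1, x) ∧ q.2 = Φ (q.1.1, x) (Fin.natAdd M i)) := by fun_prop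
    refine exists_enum_of_finite hS hB fun p => ?_
    refine finite_of_countable hS (P := fun t => ∃ x, G (p, x) ∧ t = Φ (p.1, x) (Fin.natAdd M i))
      (by fun_prop) ?_
    refine (countable_image_of_eventually_eq (s := {x | G (p, x)})
      (f := fun x => Φ (p.1, x) (Fin.natAdd M i)) fun x hx => ?_).mono ?_
    · exact H.eventually_eq_of_good hS (φ := fun x => Φ (p.1, x)) (by fun_prop)
        (fun x hx => hZ _ hx) hx i
    · rintro t ⟨x, hx, rfl⟩
      exact ⟨x, hx, rfl⟩
  choose m b hb hb' using hA
  refine ⟨Fintype.card (∀ i, Fin (m i)), fun p => ?_⟩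
  refine (finCard_range fun (f : ∀ i, Fin (m i)) (i : Fin N) => b i (f i) p).mono ?_ le_rfl
  rintro w ⟨x, hx, rfl⟩
  choose f hf using fun i => hb' i p _ ⟨x, hx, rfl⟩
  exact ⟨f, funext fun i => (hf i).symm⟩

/-- The part of the domain on which the relations `h` hold but which is not covered by
`NoCurve.finCard_good`. -/
def Bad {E : Type} {k d n : ℕ} (U : E × (Fin k → ℝ) → Prop)
    (Φ : E × (Fin k → ℝ) → Fin (M + N) → ℝ) (eq : Fin M × (Fin (k + 1) → Fin (d + 1)) → Fin n)
    (p : (E × (Fin n → ℝ)) × (Fin k → ℝ)) : Prop :=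
  (∀ j, ∃ u, p.1.2 (eq (j, u)) ≠ 0) ∧ U (p.1.1, p.2) ∧
    (∀ j, polyAt (fun u => p.1.2 (eq (j, u))) p.2 (Φ (p.1.1, p.2) (Fin.castAdd N j)) = 0) ∧
    ¬ ∀ᶠ x' in 𝓝 p.2, Good (fun x => U (p.1.1, x)) (fun x => Φ (p.1.1, x))
      (fun j u => p.1.2 (eq (j, u))) x'

theorem Df.bad {E : Type} [DSpace E] {k d n : ℕ} {U : E × (Fin k → ℝ) → Prop}
    {Φ : E × (Fin k → ℝ) → Fin (M + N) → ℝ} (hU : Df S U) (hΦ : Df S Φ)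
    (eq : Fin M × (Fin (k + 1) → Fin (d + 1)) → Fin n) : Df S (Bad U Φ eq) := by
  have hG := (hU.good hΦ eq).eventually
  unfold Bad polyAt
  fun_prop

theorem not_eventually_bad (hS : S.IsOMinimal) {E : Type} [DSpace E] {k d n : ℕ}
    {U : E × (Fin k → ℝ) → Prop} {Φ : E × (Fin k → ℝ) → Fin (M + N) → ℝ} (hΦ : Df S Φ)
    (eq : Fin M × (Fin (k + 1) → Fin (d + 1)) → Fin n) (p : E × (Fin n → ℝ)) (x : Fin k → ℝ) :
    ¬ ∀ᶠ y in 𝓝 x, Bad U Φ eq (p, y) := by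
  intro hx
  have hx' := hx.self_of_nhds
  obtain ⟨W, hW, hWo, hxW⟩ := eventually_nhds_iff.1 hx
  obtain ⟨y, hyW, hy⟩ := exists_eventually_good hS (U := fun x => U (p.1, x))
    (φ := fun x => Φ (p.1, x)) (by fun_prop) (h := fun j u => p.2 (eq (j, u)))
    (fun j => by
      obtain ⟨u, hu⟩ := hx'.1 j
      exact fun h => hu (congrFun h u)) hWo ⟨x, hxW⟩
    (fun y hy => (hW y hy).2.1) (fun y hy => (hW y hy).2.2.1)
  exact (hW y hyW).2.2.2 hy

end

section

open Set Filter Topology DSpace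

variable {S : RealStructure} {M N : ℕ} {Z : Set (Fin (M + N) → ℝ)}

theorem NoCurve.countOn (hS : S.IsOMinimal) (H : NoCurve S M N Z) (k : ℕ) :
    ∀ {E : Type} [DSpace E] (ι : Fin k → Fin M) {U : E × (Fin k → ℝ) → Prop}
      {Φ : E × (Fin k → ℝ) → Fin (M + N) → ℝ}, Df S U → Df S Φ → (∀ p, U p → Φ p ∈ Z) →
      (∀ p, U p → ∀ i, Φ p (Fin.castAdd N (ι i)) = p.2 i) → ∀ {ε : ℝ}, 0 < ε →
      CountOn U Φ ε := by
  induction k with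
  | zero =>
    intro E _ ι U Φ hU hΦ hZ hι ε hε
    refine ⟨1, zero_le_one, fun e T hT => ?_⟩
    refine (finCard_range fun _ : Unit => (fun i => Φ (e, Fin.elim0) (Fin.natAdd M i) :
      Fin N → ℝ)).mono ?_ ?_
    · rintro w ⟨x, -, -, rfl⟩
      rw [Subsingleton.elim x Fin.elim0]
      exact ⟨(), rfl⟩
    · simpa using Real.one_le_rpow hT hε.le
  | succ k ih =>
    intro E _ ι U Φ hU hΦ hZ hι ε hε
    obtain ⟨d, c, hc, hcov⟩ := exists_poly_cover hS (k + 1) M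
      (Φ := fun j p => Φ p (Fin.castAdd N j)) (fun j => by fun_prop) (half_pos hε)
    set eq := Fintype.equivFin (Fin M × (Fin (k + 1 + 1) → Fin (d + 1)))
    obtain ⟨m, hm⟩ := H.finCard_good hS hU hΦ hZ eq
    obtain ⟨L, hL, i, g, hg, hg'⟩ :=
      exists_graph_cover hS (hU.bad hΦ eq) (not_eventually_bad hS hΦ eq)
    have := Fintype.ofFinite L
    have hl : ∀ l, CountOn
        (fun p => U (p.1.1, ins (i l) (g l p) p.2)) (fun p => Φ (p.1.1, ins (i l) (g l p) p.2))
        (ε / 2) := by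
      intro l
      have hgl := hg l
      refine ih (fun j => ι ((i l).succAbove j)) (by fun_prop) (by fun_prop)
        (fun p hp => hZ _ hp) (fun p hp j => ?_) (half_pos hε)
      rw [hι _ hp]
      simp
    choose C hC0 hC using hl
    have hs := Finset.sum_nonneg fun l (_ : l ∈ Finset.univ) => hC0 l
    refine ⟨c * (m + ∑ l, C l), by positivity, fun e T hT => ?_⟩
    obtain ⟨I, _, h, hcard, hne, hsol⟩ := hcov e T hT
    set v : I → Fin (Fintype.card (Fin M × (Fin (k + 1 + 1) → Fin (d + 1)))) → ℝ :=
      fun a b => h a (eq.symm b).1 (eq.symm b).2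
    have hv : ∀ a j u, v a (eq (j, u)) = h a j u := fun a j u => by simp [v]
    have hT2 : 1 ≤ T ^ (ε / 2) := Real.one_le_rpow hT (half_pos hε).le
    have hfin := FinCard.iUnion fun a : I => (hm (e, v a)).union
      (FinCard.iUnion fun l => hC l (e, v a) T hT)
    refine hfin.mono ?_ ?_
    · rintro w ⟨x, hx, hr, rfl⟩
      have hx' := hι _ hx
      obtain ⟨a, ha⟩ := hsol x (fun j => by
        have := hr (ι j)
        rw [hx' j] at this
        exact this) hr
      refine mem_iUnion.2 ⟨a, ?_⟩
      by_cases hgood : ∀ᶠ x' in 𝓝 x, Good (fun x => U (e, x)) (fun x => Φ (e, x))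
        (fun j u => v a (eq (j, u))) x'
      · exact .inl ⟨x, hgood, rfl⟩
      · refine .inr ?_
        obtain ⟨l, hl⟩ := hg' (e, v a) x ⟨fun j => by
            simp only [hv]
            exact Function.ne_iff.1 (hne a j), hx, fun j => by
            simp only [hv]
            exact ha j, hgood⟩
        refine mem_iUnion.2 ⟨l, fun j => x ((i l).succAbove j), ?_⟩
        simp only [← hl, ins_self]
        exact ⟨hx, hr, trivial⟩
    · have hT3 : T ^ ε = T ^ (ε / 2) * T ^ (ε / 2) := by
        rw [← Real.rpow_add (by linarith)]; congr 1; ring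
      rw [Finset.sum_const, nsmul_eq_mul, Finset.card_univ, hT3, ← Finset.sum_mul]
      have h1 : (m : ℝ) + (∑ l, C l) * T ^ (ε / 2) ≤ (m + ∑ l, C l) * T ^ (ε / 2) := by
        have : (0 : ℝ) ≤ m := Nat.cast_nonneg m
        nlinarith
      calc (Fintype.card I : ℝ) * (m + (∑ l, C l) * T ^ (ε / 2))
          ≤ (c * T ^ (ε / 2)) * ((m + ∑ l, C l) * T ^ (ε / 2)) := by gcongr
        _ = _ := by ring

end

section

open Set Filter Topology DSpace

variable {S : RealStructure} {E : Type} [DSpace E] {M N : ℕ} {Z : Set (Fin (M + N) → ℝ)}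

theorem Df.append {a : E → Fin M → ℝ} {b : E → Fin N → ℝ} (ha : Df S a) (hb : Df S b) :
    Df S (fun e => Fin.append (a e) (b e)) := by
  refine Df.pi fun i => ?_
  refine Fin.addCases (fun i => ?_) (fun i => ?_) i
  · simp only [Fin.append_left]; fun_prop
  · simp only [Fin.append_right]; fun_prop

theorem niceOn_const (c a b : ℝ) : NiceOn (fun _ => c) a b := by
  refine ⟨fun _ _ => analyticAt_const, ?_⟩
  have h := IsSemialgebraic.eq_set (k := 2) (.X 1) (.C c)
  simp only [MvPolynomial.eval_C, MvPolynomial.eval_X] at h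
  exact (isSemialgebraic_strip (0 : Fin 2) a b).inter h

theorem NoCurve.finite_fibre (hS : S.IsOMinimal) (hZ : Z ∈ S.sets (M + N)) (H : NoCurve S M N Z)
    (y : Fin M → ℝ) (i : Fin N) :
    {t : ℝ | ∃ z : Fin N → ℝ, Fin.append y z ∈ Z ∧ z i = t}.Finite := by
  have hZ' := df_mem.2 hZ
  have hR : Df S (fun p : ℝ × (Fin N → ℝ) => Fin.append y p.2 ∈ Z ∧ p.2 i = p.1) := by
    have h1 : Df S (fun p : ℝ × (Fin N → ℝ) => Fin.append y p.2) := Df.append (by fun_prop) (by fun_prop)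
    have h2 := hZ'.comp h1
    fun_prop
  obtain ⟨g, hg, hg'⟩ := exists_df_choice hS hR
  refine finite_of_no_interval hS (by fun_prop) fun a b hab => ?_
  by_contra! hcon
  have hγ : Df S (fun t => Fin.append y (g t)) := Df.append (by fun_prop) hg
  have hF : (⋃ j, {t | ¬ DifferentiableAt ℝ (fun t => g t j) t}).Finite :=
    finite_iUnion fun j => finite_not_differentiableAt hS (by fun_prop)
  obtain ⟨s, hs, hsF⟩ := ((Ioo_infinite hab).sdiff hF).nonempty
  have hnear : ∀ᶠ t in 𝓝 s, t ∈ Ioo a b ∧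
      t ∉ ⋃ j, {t | ¬ DifferentiableAt ℝ (fun t => g t j) t} :=
    Filter.inter_mem (Ioo_mem_nhds hs.1 hs.2) (hF.isClosed.isOpen_compl.mem_nhds hsF)
  obtain ⟨r, hr, hball⟩ := Metric.eventually_nhds_iff_ball.1 hnear
  have hsub : ∀ t ∈ Icc s (s + r / 2), t ∈ Metric.ball s r := fun t ht => by
    rw [Real.ball_eq_Ioo]
    exact ⟨by linarith [ht.1], by linarith [ht.2]⟩
  have hval : ∀ t ∈ Icc s (s + r / 2), Fin.append y (g t) ∈ Z ∧ g t i = t := fun t ht =>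
    hg' t (hcon t (hball t (hsub t ht)).1)
  have hcont : ContinuousOn (fun t => Fin.append y (g t)) (Icc s (s + r / 2)) := by
    refine continuousOn_pi.2 fun j => ?_
    refine Fin.addCases (fun j => ?_) (fun j => ?_) j
    · simpa only [Fin.append_left] using continuousOn_const
    · simp only [Fin.append_right]
      intro t ht
      have := (hball t (hsub t ht)).2
      simp only [mem_iUnion, mem_ofPred_eq, not_exists, not_not] at this
      exact (this j).continuousAt.continuousWithinAt
  have hs1 : s ∈ Icc s (s + r / 2) := ⟨le_rfl, by linarith⟩
  have hs2 : s + r / 2 ∈ Icc s (s + r / 2) := ⟨by linarith, le_rfl⟩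
  have := H.eq_of_niceOn hγ (by linarith) hcont (fun t ht => (hval t ht).1)
    (fun j => by simpa only [Fin.append_left] using niceOn_const (y j) s (s + r / 2)) hs1 hs2 i
  simp only [Fin.append_right, (hval _ hs1).2, (hval _ hs2).2] at this
  linarith

theorem NoCurve.exists_bound (hS : S.IsOMinimal) (hZ : Z ∈ S.sets (M + N)) (H : NoCurve S M N Z)
    {ε : ℝ} (hε : 0 < ε) : ∃ c : ℝ, 0 < c ∧ ∀ T : ℝ, 1 ≤ T →
      (ZRatProj M N Z T).Finite ∧ ((ZRatProj M N Z T).ncard : ℝ) ≤ c * T ^ ε := by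
  have hZ' := df_mem.2 hZ
  have happ : ∀ {E : Type} [DSpace E] {a : E → Fin M → ℝ} {b : E → Fin N → ℝ}, Df S a → Df S b →
      Df S (fun e => Fin.append (a e) (b e) ∈ Z) := fun ha hb => hZ'.comp (ha.append hb)
  have henum : ∀ i : Fin N, ∃ (n : ℕ) (b : Fin n → (Fin M → ℝ) → ℝ), (∀ l, Df S (b l)) ∧
      ∀ y t, (∃ z : Fin N → ℝ, Fin.append y z ∈ Z ∧ z i = t) → ∃ l, t = b l y := fun i => by
    have h1 : Df S (fun p : ((Fin M → ℝ) × ℝ) × (Fin N → ℝ) => Fin.append p.1.1 p.2 ∈ Z) :=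
      happ (by fun_prop) (by fun_prop)
    exact exists_enum_of_finite hS (B := fun p : (Fin M → ℝ) × ℝ =>
      ∃ z : Fin N → ℝ, Fin.append p.1 z ∈ Z ∧ z i = p.2) (by fun_prop)
      fun y => H.finite_fibre hS hZ y i
  choose n b hb hb' using henum
  have hcount : ∀ f : (∀ i, Fin (n i)), CountOn (M := M) (N := N)
      (fun p : Unit × (Fin M → ℝ) => Fin.append p.2 (fun i => b i (f i) p.2) ∈ Z)
      (fun p => Fin.append p.2 (fun i => b i (f i) p.2)) ε := fun f => by
    have h1 : Df S (fun p : Unit × (Fin M → ℝ) => fun i => b i (f i) p.2) := by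
      refine Df.pi fun i => ?_
      have := hb i (f i)
      fun_prop
    exact H.countOn hS M id (happ (by fun_prop) h1) (Df.append (by fun_prop) h1)
      (fun p hp => hp) (fun p _ i => by simp) hε
  choose c hc0 hc using hcount
  have hs := Finset.sum_nonneg fun f (_ : f ∈ Finset.univ) => hc0 f
  refine ⟨∑ f, c f + 1, by positivity, fun T hT => ?_⟩
  refine (FinCard.iUnion fun f => hc f () T hT).mono ?_ ?_
  · rintro _ ⟨p, ⟨hp, hrat⟩, rfl⟩
    have hp' : Fin.append (fun i => p (Fin.castAdd N i)) (fun i => p (Fin.natAdd M i)) = p :=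
      Fin.append_castAdd_natAdd
    choose f hf using fun i => hb' i (fun i => p (Fin.castAdd N i)) (p (Fin.natAdd M i))
      ⟨fun i => p (Fin.natAdd M i), hp'.symm ▸ hp, rfl⟩
    refine mem_iUnion.2 ⟨f, fun i => p (Fin.castAdd N i), ?_⟩
    simp only [← hf, hp']
    exact ⟨hp, hrat, trivial⟩
  · rw [← Finset.sum_mul]
    have : (0 : ℝ) ≤ T ^ ε := by positivity
    nlinarith

end

/-- **Proposition (Habegger–Pila, Corollary 7.2).** Let `Z ⊆ ℝ^{M+N}` be definable in an
o-minimal structure. For every `ε > 0` there is `c = c(Z, ε) > 0` such that, if `T ≥ 1` and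
`#π₂(Z∼(ℚ,T)) > cT^ε`, then there is a continuous definable `δ : [0,1] → Z` such that `π₁ ∘ δ`
is semialgebraic and real analytic on `(0,1)`, and `π₂ ∘ δ` is non-constant. -/
theorem statement5 (S : RealStructure) (hS : S.IsOMinimal) (M N : ℕ)
    (Z : Set (Fin (M + N) → ℝ)) (hZ : Z ∈ S.sets (M + N)) :
    ∀ ε : ℝ, 0 < ε → ∃ c : ℝ, 0 < c ∧ ∀ T : ℝ, 1 ≤ T →
      ¬ ((ZRatProj M N Z T).Finite ∧ ((ZRatProj M N Z T).ncard : ℝ) ≤ c * T ^ ε) →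
      ∃ δ : ℝ → (Fin (M + N) → ℝ),
        Set.MapsTo δ (Set.Icc 0 1) Z ∧ ContinuousOn δ (Set.Icc 0 1) ∧
        {p : Fin (1 + (M + N)) → ℝ | ∃ t ∈ Set.Icc (0 : ℝ) 1,
          p = Fin.append (fun _ : Fin 1 => t) (δ t)} ∈ S.sets (1 + (M + N)) ∧
        IsSemialgebraic {p : Fin (1 + M) → ℝ | ∃ t ∈ Set.Icc (0 : ℝ) 1,
          p = Fin.append (fun _ : Fin 1 => t) (fun i : Fin M => δ t (Fin.castAdd N i))} ∧
        AnalyticOnNhd ℝ (fun t => fun i : Fin M => δ t (Fin.castAdd N i)) (Set.Ioo 0 1) ∧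
        ∃ t₁ ∈ Set.Icc (0 : ℝ) 1, ∃ t₂ ∈ Set.Icc (0 : ℝ) 1,
          (fun j : Fin N => δ t₁ (Fin.natAdd M j)) ≠ fun j : Fin N => δ t₂ (Fin.natAdd M j) := by
  intro ε hε
  by_cases H : NoCurve S M N Z
  · obtain ⟨c, hc, h⟩ := H.exists_bound hS hZ hε
    exact ⟨c, hc, fun T hT hcon => absurd (h T hT) hcon⟩
  · refine ⟨1, one_pos, fun T _ _ => ?_⟩
    unfold NoCurve at H
    push Not at H
    exact H
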